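/- Comparison principle (Theorem 1.1): Under the stated assumptions on the operator H = L + I and on the data ψ_i, c_{i,j}, g_i, if (u_1⁺,…,u_d⁺) with u_i⁺ ∈ LSC_p is a viscosity supersolution of the system (S) and (u_1⁻,…,u_d⁻) with u_i⁻ ∈ USC_p is a viscosity subsolution of (S), then u_i⁻(x,t) ≤ u_i⁺(x,t) for every i ∈ {1,…,d} and every (x,t) ∈ ℝ^N×(0,T]. -/

import Mathlib

open MeasureTheory Set Filter Real
open scoped Topology

noncomputable section

abbrev Euc (n : ℕ) : Type := EuclideanSpace ℝ (Fin n)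

/-- Spatial partial derivative `∂_{x_k} φ(x,t)`. -/
noncomputable def pd1 {N : ℕ} (φ : Euc N → ℝ → ℝ) (x : Euc N) (t : ℝ) (k : Fin N) : ℝ :=
  fderiv ℝ (fun x' => φ x' t) x (EuclideanSpace.single k 1)

/-- Second spatial partial derivative `∂_{x_k x_m} φ(x,t)`. -/
noncomputable def pd2 {N : ℕ} (φ : Euc N → ℝ → ℝ) (x : Euc N) (t : ℝ) (k m : Fin N) : ℝ :=
  fderiv ℝ (fun x' => pd1 φ x' t m) x (EuclideanSpace.single k 1)

/-- Time derivative `∂_t φ(x,t)`. -/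
noncomputable def pdt {N : ℕ} (φ : Euc N → ℝ → ℝ) (x : Euc N) (t : ℝ) : ℝ :=
  deriv (fun s => φ x s) t

/-- `φ ∈ C^{1,2}(ℝ^N × [0,T))`. -/
def IsC12 {N : ℕ} (T : ℝ) (φ : Euc N → ℝ → ℝ) : Prop :=
  (∀ t ∈ Ico (0:ℝ) T, ContDiff ℝ 2 (fun x => φ x t)) ∧
  (∀ x : Euc N, ∀ t ∈ Ico (0:ℝ) T, DifferentiableAt ℝ (fun s => φ x s) t) ∧
  ContinuousOn (fun p : Euc N × ℝ => φ p.1 p.2) (univ ×ˢ Ico 0 T)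

/-- The local (degenerate parabolic) operator `L`. -/
noncomputable def Lop {N : ℕ} (σ : Euc N → ℝ → Matrix (Fin N) (Fin N) ℝ)
    (a : Euc N → ℝ → Fin N → ℝ) (φ : Euc N → ℝ → ℝ) (x : Euc N) (t : ℝ) : ℝ :=
  (∑ k : Fin N, ∑ m : Fin N, (σ x t * (σ x t).transpose) k m * pd2 φ x t k m)
    + (∑ k : Fin N, a x t k * pd1 φ x t k) + pdt φ x t

/-- The integro-differential kernel `K(x,t,z,φ,p)`. -/
noncomputable def Kker {N l : ℕ} (η : Euc N → ℝ → Euc l → Euc N)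
    (x : Euc N) (t : ℝ) (z : Euc l) (φ : Euc N → ℝ → ℝ) (p : Fin N → ℝ) : ℝ :=
  φ (x + η x t z) t - φ x t - (if ‖z‖ ≤ 1 then ∑ k : Fin N, η x t z k * p k else 0)

/-- The small-jumps part `I_κ` of the non-local operator. -/
noncomputable def Ismall {N l : ℕ} (ν : Measure (Euc l)) (η : Euc N → ℝ → Euc l → Euc N)
    (κ : ℝ) (φ : Euc N → ℝ → ℝ) (p : Fin N → ℝ) (x : Euc N) (t : ℝ) : ℝ :=
  ∫ z in {z : Euc l | 0 < ‖z‖ ∧ ‖z‖ < κ}, Kker η x t z φ p ∂ν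

/-- The large-jumps part `I^κ` of the non-local operator. -/
noncomputable def Ilarge {N l : ℕ} (ν : Measure (Euc l)) (η : Euc N → ℝ → Euc l → Euc N)
    (κ : ℝ) (u : Euc N → ℝ → ℝ) (p : Fin N → ℝ) (x : Euc N) (t : ℝ) : ℝ :=
  ∫ z in {z : Euc l | κ ≤ ‖z‖}, Kker η x t z u p ∂ν

/-- The full non-local operator `I(x,t,φ)`. -/
noncomputable def Iop {N l : ℕ} (ν : Measure (Euc l)) (η : Euc N → ℝ → Euc l → Euc N)
    (φ : Euc N → ℝ → ℝ) (x : Euc N) (t : ℝ) : ℝ :=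
  ∫ z in {z : Euc l | z ≠ 0}, Kker η x t z φ (pd1 φ x t) ∂ν

/-- The operator `H^κ(x,t,φ,u) = Lφ + I_κ(φ,Dφ) + I^κ(u,Dφ)`. -/
noncomputable def Hkop {N l : ℕ} (σ : Euc N → ℝ → Matrix (Fin N) (Fin N) ℝ)
    (a : Euc N → ℝ → Fin N → ℝ) (ν : Measure (Euc l)) (η : Euc N → ℝ → Euc l → Euc N)
    (κ : ℝ) (φ u : Euc N → ℝ → ℝ) (x : Euc N) (t : ℝ) : ℝ :=
  Lop σ a φ x t + Ismall ν η κ φ (pd1 φ x t) x t + Ilarge ν η κ u (pd1 φ x t) x t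

/-- The operator `H = L + I`. -/
noncomputable def Hop {N l : ℕ} (σ : Euc N → ℝ → Matrix (Fin N) (Fin N) ℝ)
    (a : Euc N → ℝ → Fin N → ℝ) (ν : Measure (Euc l)) (η : Euc N → ℝ → Euc l → Euc N)
    (φ : Euc N → ℝ → ℝ) (x : Euc N) (t : ℝ) : ℝ :=
  Lop σ a φ x t + Iop ν η φ x t

/-- Structural assumptions on the operator `H = L + I`. -/
structure OperatorAssumptions (N l : ℕ) (T : ℝ)
    (σ : Euc N → ℝ → Matrix (Fin N) (Fin N) ℝ) (a : Euc N → ℝ → Fin N → ℝ)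
    (ν : Measure (Euc l)) (η : Euc N → ℝ → Euc l → Euc N) : Prop where
  dimN : 1 ≤ N
  diml : 1 ≤ l
  hT : 0 < T
  coeff : ∃ A : ℝ, 1 ≤ A ∧ ∀ (x y : Euc N) (t s : ℝ), t ∈ Icc 0 T → s ∈ Icc 0 T →
    ∀ k m : Fin N,
      |a x t k - a y s k| + |σ x t k m - σ y s k m| ≤ A * ‖x - y‖ ∧
      |a x t k| + |σ x t k m| ≤ A * (1 + ‖x‖)
  levy_null : ν ({0} : Set (Euc l)) = 0
  levy : ∃ Λ₀ At : ℝ, 0 < Λ₀ ∧ 1 ≤ At ∧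
    IntegrableOn (fun z : Euc l => ‖z‖ ^ 2) {z | 0 < ‖z‖ ∧ ‖z‖ ≤ 1} ν ∧
    IntegrableOn (fun z : Euc l => Real.exp (Λ₀ * ‖z‖)) {z | 1 < ‖z‖} ν ∧
    (∫ z in {z : Euc l | 0 < ‖z‖ ∧ ‖z‖ ≤ 1}, ‖z‖ ^ 2 ∂ν)
      + (∫ z in {z : Euc l | 1 < ‖z‖}, Real.exp (Λ₀ * ‖z‖) ∂ν) ≤ At
  eta_cont : ∀ z : Euc l, Continuous (fun p : Euc N × ℝ => η p.1 p.2 z)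
  eta_meas : ∀ (x : Euc N) (t : ℝ), Measurable (fun z => η x t z)
  eta_bound : ∃ B : ℝ, 1 ≤ B ∧ ∀ (x y : Euc N) (t : ℝ) (z : Euc l) (k : Fin N),
    |η x t z k| ≤ B * min ‖z‖ 1 ∧ |η x t z k - η y t z k| ≤ B * min ‖z‖ 1 * ‖x - y‖

/-- Assumptions on the data `ψ_i`, `c_{i,j}`, `g_i`. -/
structure DataAssumptions (N d : ℕ) (T : ℝ)
    (ψ : Fin d → Euc N → ℝ → ℝ) (c : Fin d → Fin d → Euc N → ℝ → ℝ)
    (g : Fin d → Euc N → ℝ) : Prop where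
  dimd : 1 ≤ d
  cont_psi : ∀ i, Continuous (fun p : Euc N × ℝ => ψ i p.1 p.2)
  cont_c : ∀ i j, Continuous (fun p : Euc N × ℝ => c i j p.1 p.2)
  cont_g : ∀ i, Continuous (g i)
  growth : ∃ B γ : ℝ, 1 ≤ B ∧ 1 ≤ γ ∧ ∀ (i j : Fin d) (x : Euc N), ∀ t ∈ Icc (0:ℝ) T,
    |ψ i x t| + |c i j x t| + |g i x| ≤ B * (1 + ‖x‖ ^ γ)
  c_diag : ∀ (i : Fin d) (x : Euc N) (t : ℝ), c i i x t = 0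
  no_loop : ∀ (k : ℕ), ∀ idx : Fin (k + 2) → Fin d, Function.Injective idx →
    ∀ (x : Euc N), ∀ t ∈ Icc (0:ℝ) T, 0 < ∑ m : Fin (k + 2), c (idx m) (idx (m + 1)) x t
  terminal : ∀ (i : Fin d) (x : Euc N), ∀ j ≠ i, -(c i j x T) + g j x ≤ g i x

/-- Membership in `USC_p(ℝ^N × [0,T])`. -/
def USCp {N : ℕ} (T : ℝ) (h : Euc N → ℝ → ℝ) : Prop :=
  UpperSemicontinuousOn (fun p : Euc N × ℝ => h p.1 p.2) (univ ×ˢ Icc 0 T) ∧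
  ∃ c γ : ℝ, 1 ≤ c ∧ 1 ≤ γ ∧ ∀ (x : Euc N), ∀ t ∈ Icc (0:ℝ) T, |h x t| ≤ c * (1 + ‖x‖ ^ γ)

/-- Membership in `LSC_p(ℝ^N × [0,T])`. -/
def LSCp {N : ℕ} (T : ℝ) (h : Euc N → ℝ → ℝ) : Prop :=
  LowerSemicontinuousOn (fun p : Euc N × ℝ => h p.1 p.2) (univ ×ˢ Icc 0 T) ∧
  ∃ c γ : ℝ, 1 ≤ c ∧ 1 ≤ γ ∧ ∀ (x : Euc N), ∀ t ∈ Icc (0:ℝ) T, |h x t| ≤ c * (1 + ‖x‖ ^ γ)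

/-- Membership in `C_p(ℝ^N × [0,T])`. -/
def Cp {N : ℕ} (T : ℝ) (h : Euc N → ℝ → ℝ) : Prop :=
  ContinuousOn (fun p : Euc N × ℝ => h p.1 p.2) (univ ×ˢ Icc 0 T) ∧
  ∃ c γ : ℝ, 1 ≤ c ∧ 1 ≤ γ ∧ ∀ (x : Euc N), ∀ t ∈ Icc (0:ℝ) T, |h x t| ≤ c * (1 + ‖x‖ ^ γ)

/-- Viscosity supersolution of the system (S). -/
def IsSupersol {N l d : ℕ} (T : ℝ) (σ : Euc N → ℝ → Matrix (Fin N) (Fin N) ℝ)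
    (a : Euc N → ℝ → Fin N → ℝ) (ν : Measure (Euc l)) (η : Euc N → ℝ → Euc l → Euc N)
    (ψ : Fin d → Euc N → ℝ → ℝ) (c : Fin d → Fin d → Euc N → ℝ → ℝ)
    (g : Fin d → Euc N → ℝ) (u : Fin d → Euc N → ℝ → ℝ) : Prop :=
  (∀ i, LSCp T (u i)) ∧
  (∀ (i : Fin d) (x : Euc N), g i x ≤ u i x T) ∧
  (∀ (i : Fin d) (x₀ : Euc N) (t₀ : ℝ), t₀ ∈ Ioo (0:ℝ) T →
    ∀ φ : Euc N → ℝ → ℝ, IsC12 T φ → φ x₀ t₀ = u i x₀ t₀ →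
      (∀ (x : Euc N), ∀ t ∈ Ico (0:ℝ) T, φ x t - u i x t ≤ φ x₀ t₀ - u i x₀ t₀) →
      ∀ κ ∈ Ioo (0:ℝ) 1,
        0 ≤ -(Hkop σ a ν η κ φ (u i) x₀ t₀) - ψ i x₀ t₀ ∧
        ∀ j ≠ i, -(c i j x₀ t₀) + u j x₀ t₀ ≤ u i x₀ t₀)

/-- Viscosity subsolution of the system (S). -/
def IsSubsol {N l d : ℕ} (T : ℝ) (σ : Euc N → ℝ → Matrix (Fin N) (Fin N) ℝ)
    (a : Euc N → ℝ → Fin N → ℝ) (ν : Measure (Euc l)) (η : Euc N → ℝ → Euc l → Euc N)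
    (ψ : Fin d → Euc N → ℝ → ℝ) (c : Fin d → Fin d → Euc N → ℝ → ℝ)
    (g : Fin d → Euc N → ℝ) (u : Fin d → Euc N → ℝ → ℝ) : Prop :=
  (∀ i, USCp T (u i)) ∧
  (∀ (i : Fin d) (x : Euc N), u i x T ≤ g i x) ∧
  (∀ (i : Fin d) (x₀ : Euc N) (t₀ : ℝ), t₀ ∈ Ioo (0:ℝ) T →
    ∀ φ : Euc N → ℝ → ℝ, IsC12 T φ → φ x₀ t₀ = u i x₀ t₀ →
      (∀ (x : Euc N), ∀ t ∈ Ico (0:ℝ) T, φ x₀ t₀ - u i x₀ t₀ ≤ φ x t - u i x t) →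
      ∀ κ ∈ Ioo (0:ℝ) 1,
        (-(Hkop σ a ν η κ φ (u i) x₀ t₀) - ψ i x₀ t₀ ≤ 0) ∨
        (∃ j ≠ i, u i x₀ t₀ ≤ -(c i j x₀ t₀) + u j x₀ t₀))

end

theorem addHaar_image_eq_zero_of_lipschitzOnWith {E : Type*} [NormedAddCommGroup E]
    [InnerProductSpace ℝ E] [FiniteDimensional ℝ E] [MeasurableSpace E] [BorelSpace E]
    (μ : Measure E) [μ.IsAddHaarMeasure] {f : E → E} {s : Set E} {C : NNReal}
    (hf : LipschitzOnWith C f s) (hs : μ s = 0) : μ (f '' s) = 0 := by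
  set ν : Measure E := Measure.hausdorffMeasure (Module.finrank ℝ E : ℝ)
  have h1 : ν ≪ μ := Measure.absolutelyContinuous_isAddHaarMeasure ν μ
  have h2 : μ ≪ ν := Measure.absolutelyContinuous_isAddHaarMeasure μ ν
  apply h2
  have h3 := hf.hausdorffMeasure_image_le (d := (Module.finrank ℝ E : ℝ)) (by positivity)
  rw [show Measure.hausdorffMeasure (Module.finrank ℝ E : ℝ) s = 0 from h1 hs, mul_zero] at h3
  exact le_antisymm h3 bot_le

/-- A Taylor expansion of a subgradient selection integrates to a second-order expansion. -/
theorem second_order_of_subgradient_expansion {E : Type*} [NormedAddCommGroup E]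
    [InnerProductSpace ℝ E] {g : E → ℝ} {s : E → E}
    (hs : ∀ y y', g y + inner ℝ (s y) (y' - y) ≤ g y') {y₀ : E} {A : E →L[ℝ] E}
    (hA : ∀ ε > 0, ∃ ρ > 0, ∀ h, ‖h‖ < ρ → ‖s (y₀ + h) - s y₀ - A h‖ ≤ ε * ‖h‖) :
    ∀ ε > 0, ∃ ρ > 0, ∀ h, ‖h‖ < ρ →
      |g (y₀ + h) - g y₀ - inner ℝ (s y₀) h - inner ℝ (A h) h / 2| ≤ ε * ‖h‖ ^ 2 := by
  intro ε hε
  obtain ⟨ρ, hρ, hA⟩ := hA ε hε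
  refine ⟨ρ, hρ, fun h hh => ?_⟩
  have key : ∀ τ : ℝ, 0 ≤ τ → τ ≤ 1 →
      |inner ℝ (s (y₀ + τ • h)) h - inner ℝ (s y₀) h - τ * inner ℝ (A h) h| ≤ ε * ‖h‖ ^ 2 := by
    intro τ h0 h1
    have hn : ‖τ • h‖ ≤ ‖h‖ := by
      rw [norm_smul, Real.norm_of_nonneg h0]
      nlinarith [norm_nonneg h]
    have h2 := hA (τ • h) (hn.trans_lt hh)
    have h3 : inner ℝ (s (y₀ + τ • h)) h - inner ℝ (s y₀) h - τ * inner ℝ (A h) h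
        = inner ℝ (s (y₀ + τ • h) - s y₀ - A (τ • h)) h := by
      rw [inner_sub_left, inner_sub_left, map_smul, real_inner_smul_left]
    rw [h3]
    calc _ ≤ ‖s (y₀ + τ • h) - s y₀ - A (τ • h)‖ * ‖h‖ := abs_real_inner_le_norm _ _
      _ ≤ (ε * ‖h‖) * ‖h‖ := by
        gcongr
        exact h2.trans (by gcongr)
      _ = _ := by ring
  set a := inner ℝ (A h) h with ha
  set b := inner ℝ (s y₀) h with hb
  have step : ∀ τ τ' : ℝ, (τ' - τ) * inner ℝ (s (y₀ + τ • h)) h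
      ≤ g (y₀ + τ' • h) - g (y₀ + τ • h) := by
    intro τ τ'
    have := hs (y₀ + τ • h) (y₀ + τ' • h)
    rw [add_sub_add_left_eq_sub, ← sub_smul, real_inner_smul_right] at this
    linarith
  have main : ∀ n : ℕ, 0 < n →
      |g (y₀ + h) - g y₀ - b - a / 2| ≤ |a| / (2 * n) + ε * ‖h‖ ^ 2 := by
    intro n hn
    have hn' : (0 : ℝ) < n := by exact_mod_cast hn
    have ind : ∀ k : ℕ, k ≤ n →
        g (y₀ + ((k : ℝ) / n) • h) - g y₀ ≤
          (k / n) * b + k * (k + 1) / (2 * n ^ 2) * a + (k / n) * (ε * ‖h‖ ^ 2) ∧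
        (k / n) * b + k * (k - 1) / (2 * n ^ 2) * a - (k / n) * (ε * ‖h‖ ^ 2) ≤
          g (y₀ + ((k : ℝ) / n) • h) - g y₀ := by
      intro k
      induction k with
      | zero => intro _; simp
      | succ k ih =>
        intro hk
        obtain ⟨i1, i2⟩ := ih (by omega)
        have hk' : ((k : ℝ) + 1) ≤ n := by exact_mod_cast hk
        have k1 := abs_le.1 (key ((k : ℝ) / n) (by positivity)
          ((div_le_one hn').2 (by linarith)))
        have k2 := abs_le.1 (key (((k : ℝ) + 1) / n) (by positivity) ((div_le_one hn').2 hk'))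
        have s1 := step ((k : ℝ) / n) (((k : ℝ) + 1) / n)
        have s2 := step (((k : ℝ) + 1) / n) ((k : ℝ) / n)
        have e1 : ((k : ℝ) + 1) / n - k / n = 1 / n := by ring
        have e2 : (k : ℝ) / n - (k + 1) / n = -(1 / n) := by ring
        rw [e1] at s1
        rw [e2] at s2
        have hp : (0 : ℝ) < 1 / n := by positivity
        push_cast
        constructor
        · have : 1 / (n : ℝ) * inner ℝ (s (y₀ + (((k : ℝ) + 1) / n) • h)) h ≤
            1 / n * (b + ((k : ℝ) + 1) / n * a + ε * ‖h‖ ^ 2) := by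
            gcongr; linarith [k2.2]
          have e3 : ((k : ℝ) + 1) / n * b + (k + 1) * (k + 1 + 1) / (2 * n ^ 2) * a
              + (k + 1) / n * (ε * ‖h‖ ^ 2)
            = ((k / n) * b + k * (k + 1) / (2 * n ^ 2) * a + (k / n) * (ε * ‖h‖ ^ 2))
              + 1 / n * (b + ((k : ℝ) + 1) / n * a + ε * ‖h‖ ^ 2) := by
            field_simp; ring
          linarith
        · have : 1 / (n : ℝ) * (b + (k : ℝ) / n * a - ε * ‖h‖ ^ 2) ≤
            1 / n * inner ℝ (s (y₀ + ((k : ℝ) / n) • h)) h := by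
            gcongr; linarith [k1.1]
          have e3 : ((k : ℝ) + 1) / n * b + (k + 1) * (k + 1 - 1) / (2 * n ^ 2) * a
              - (k + 1) / n * (ε * ‖h‖ ^ 2)
            = ((k / n) * b + k * (k - 1) / (2 * n ^ 2) * a - (k / n) * (ε * ‖h‖ ^ 2))
              + 1 / n * (b + (k : ℝ) / n * a - ε * ‖h‖ ^ 2) := by
            field_simp; ring
          linarith
    obtain ⟨i1, i2⟩ := ind n le_rfl
    rw [div_self hn'.ne', one_smul] at i1 i2
    have e1 : (n : ℝ) * (n + 1) / (2 * n ^ 2) * a = a / 2 + a / (2 * n) := by field_simp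
    have e2 : (n : ℝ) * (n - 1) / (2 * n ^ 2) * a = a / 2 - a / (2 * n) := by field_simp
    rw [e1] at i1
    rw [e2] at i2
    have e3 : |a / (2 * n)| = |a| / (2 * n) := by
      rw [abs_div, abs_of_pos (by positivity : (0 : ℝ) < 2 * n)]
    have e4 := abs_le.1 e3.le
    rw [abs_le]
    constructor <;> linarith
  have lim : Tendsto (fun n : ℕ => |a| / (2 * n) + ε * ‖h‖ ^ 2) atTop (𝓝 (0 + ε * ‖h‖ ^ 2)) := by
    apply Tendsto.add_const
    apply Tendsto.const_div_atTop
    exact (tendsto_natCast_atTop_atTop).const_mul_atTop (by norm_num)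
  rw [zero_add] at lim
  exact ge_of_tendsto lim ((eventually_gt_atTop 0).mono main)

theorem subgradient_continuousAt_of_differentiableAt {E : Type*} [NormedAddCommGroup E]
    [InnerProductSpace ℝ E] {g : E → ℝ} {s : E → E}
    (hs : ∀ y y', g y + inner ℝ (s y) (y' - y) ≤ g y') {y₀ : E} (hg : DifferentiableAt ℝ g y₀) :
    ∀ ε > 0, ∃ ρ > 0, ∀ y, ‖y - y₀‖ < ρ → ‖s y - s y₀‖ ≤ ε := by
  intro ε hε
  have hd : HasFDerivAt (fun y => g y - innerSL ℝ (s y₀) y)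
      (fderiv ℝ g y₀ - innerSL ℝ (s y₀)) y₀ :=
    hg.hasFDerivAt.sub (innerSL ℝ (s y₀)).hasFDerivAt
  have hmin : IsLocalMin (fun y => g y - innerSL ℝ (s y₀) y) y₀ := by
    refine Eventually.of_forall fun y => ?_
    have := hs y₀ y
    rw [inner_sub_right] at this
    simp only [innerSL_apply_apply]
    linarith
  have h0 := hmin.hasFDerivAt_eq_zero hd
  rw [h0, hasFDerivAt_iff_isLittleO] at hd
  have := hd.def (c := ε / 2) (by positivity)
  obtain ⟨ρ, hρ, hball⟩ := Metric.eventually_nhds_iff.1 this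
  refine ⟨ρ / 2, by positivity, fun y hy => ?_⟩
  by_contra hcon
  push Not at hcon
  set d := s y - s y₀ with hdd
  have hdpos : 0 < ‖d‖ := hε.trans hcon
  have hyne : 0 < ‖y - y₀‖ := by
    rw [norm_pos_iff, sub_ne_zero]
    rintro rfl
    simp [hdd] at hdpos
  set τ := ‖y - y₀‖ with hτ
  set v := (τ / ‖d‖) • d with hv
  have hvn : ‖v‖ = τ := by
    rw [hv, norm_smul, Real.norm_of_nonneg (by positivity)]
    field_simp
  have hin : inner ℝ d v = τ * ‖d‖ := by
    rw [hv, real_inner_smul_right, real_inner_self_eq_norm_sq]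
    field_simp
  have hb : ‖y + v - y₀‖ ≤ 2 * τ := by
    rw [show y + v - y₀ = (y - y₀) + v by abel]
    exact (norm_add_le _ _).trans (by rw [hvn]; linarith)
  have h1 := hball (y := y + v) (by rw [dist_eq_norm]; linarith)
  simp only [innerSL_apply_apply, zero_apply, sub_zero,
    Real.norm_eq_abs] at h1
  have h2 := (abs_le.1 h1).2
  have h3 := hs y (y + v)
  rw [add_sub_cancel_left] at h3
  have h4 := hs y₀ y
  rw [inner_sub_right] at h4
  rw [inner_add_right] at h2
  have h5 : inner ℝ (s y) v = inner ℝ d v + inner ℝ (s y₀) v := by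
    rw [hdd, inner_sub_left]; ring
  have h6 : ε / 2 * ‖y + v - y₀‖ ≤ ε / 2 * (2 * τ) := by gcongr
  have h7 : τ * ε < τ * ‖d‖ := by gcongr
  nlinarith

/-- Alexandrov's theorem for a function with a bounded global selection of subgradients. -/
theorem ae_second_order_of_subgradient {E : Type*} [NormedAddCommGroup E]
    [InnerProductSpace ℝ E] [FiniteDimensional ℝ E] [MeasurableSpace E] [BorelSpace E]
    (μ : Measure E) [μ.IsAddHaarMeasure] {g : E → ℝ} {s : E → E} {M : ℝ}
    (hM : ∀ y, ‖s y‖ ≤ M)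
    (hs : ∀ y y', g y + inner ℝ (s y) (y' - y) ≤ g y') :
    ∀ᵐ y ∂μ, ∃ A : E →L[ℝ] E, ∀ ε > 0, ∃ ρ > 0, ∀ h, ‖h‖ < ρ →
      |g (y + h) - g y - inner ℝ (s y) h - inner ℝ (A h) h| ≤ ε * ‖h‖ ^ 2 := by
  have hM0 : 0 ≤ M := (norm_nonneg _).trans (hM 0)
  have hlip : LipschitzWith ⟨M, hM0⟩ g := by
    apply LipschitzWith.of_le_add_mul
    intro x y
    have h1 := hs x y
    have h2 := (abs_le.1 (abs_real_inner_le_norm (s x) (y - x))).1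
    have h3 : ‖s x‖ * ‖y - x‖ ≤ M * ‖y - x‖ := by gcongr; exact hM x
    rw [dist_comm, dist_eq_norm]
    change g x ≤ g y + M * ‖y - x‖
    linarith
  have hN1 := hlip.ae_differentiableAt (μ := μ)
  set Φ : E → E := fun y => y + s y with hΦ
  have hexp : ∀ y y', ‖y - y'‖ ≤ ‖Φ y - Φ y'‖ := by
    intro y y'
    have h1 := hs y y'
    have h2 := hs y' y
    have h3 : 0 ≤ inner ℝ (s y - s y') (y - y') := by
      rw [← neg_sub y' y, inner_neg_right] at h2
      rw [inner_sub_left, ← neg_sub y' y, inner_neg_right, inner_neg_right]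
      linarith
    have h4 : ‖y - y'‖ ^ 2 ≤ ‖Φ y - Φ y'‖ * ‖y - y'‖ := by
      calc ‖y - y'‖ ^ 2 ≤ inner ℝ (Φ y - Φ y') (y - y') := by
            rw [show Φ y - Φ y' = (y - y') + (s y - s y') by simp only [hΦ]; abel,
              inner_add_left, real_inner_self_eq_norm_sq]
            linarith
        _ ≤ _ := real_inner_le_norm _ _
    rcases (norm_nonneg (y - y')).eq_or_lt with h | h
    · rw [← h]; exact norm_nonneg _
    · nlinarith
  have hinj : Function.Injective Φ := by
    intro y y' h
    have := hexp y y'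
    rw [h, sub_self, norm_zero] at this
    exact sub_eq_zero.1 (norm_le_zero_iff.1 this)
  set J : E → E := Function.invFun Φ with hJ
  have hJΦ : ∀ y, J (Φ y) = y := Function.leftInverse_invFun hinj
  set X : Set E := range Φ with hX
  have hJlip : LipschitzOnWith 1 J X := by
    apply LipschitzOnWith.of_dist_le_mul
    rintro _ ⟨y, rfl⟩ _ ⟨y', rfl⟩
    rw [hJΦ, hJΦ, dist_eq_norm, dist_eq_norm, NNReal.coe_one, one_mul]
    exact hexp y y'
  have hN2 : μ {x | ¬ (x ∈ X → DifferentiableWithinAt ℝ J X x)} = 0 :=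
    hJlip.ae_differentiableWithinAt_of_mem (μ := μ)
  set N2 := {x | ¬ (x ∈ X → DifferentiableWithinAt ℝ J X x)} with hN2d
  have hN2X : N2 ⊆ X := fun x hx => by
    simp only [hN2d, mem_ofPred_eq, Classical.not_imp] at hx
    exact hx.1
  have hJN2 : μ (J '' N2) = 0 :=
    addHaar_image_eq_zero_of_lipschitzOnWith μ (hJlip.mono hN2X) hN2
  set N3 := {x | x ∈ X ∧ DifferentiableWithinAt ℝ J X x ∧ (fderivWithin ℝ J X x).det = 0}
    with hN3d
  have hJN3 : μ (J '' N3) = 0 := by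
    apply addHaar_image_eq_zero_of_det_fderivWithin_eq_zero μ
      (f' := fun x => fderivWithin ℝ J X x)
    · intro x hx
      exact hx.2.1.hasFDerivWithinAt.mono fun z hz => hz.1
    · intro x hx
      exact hx.2.2
  have hA2 : ∀ᵐ y ∂μ, y ∉ J '' N2 := measure_eq_zero_iff_ae_notMem.1 hJN2
  have hA3 : ∀ᵐ y ∂μ, y ∉ J '' N3 := measure_eq_zero_iff_ae_notMem.1 hJN3
  filter_upwards [hN1, hA2, hA3] with y₀ hd h2 h3
  have hx0 : Φ y₀ ∈ X := mem_range_self _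
  have hdiff : DifferentiableWithinAt ℝ J X (Φ y₀) := by
    by_contra hc
    exact h2 ⟨Φ y₀, fun hh => hc (hh hx0), hJΦ y₀⟩
  have hdet : (fderivWithin ℝ J X (Φ y₀)).det ≠ 0 := fun hc =>
    h3 ⟨Φ y₀, ⟨hx0, hdiff, hc⟩, hJΦ y₀⟩
  set D := fderivWithin ℝ J X (Φ y₀) with hD
  set e := D.toContinuousLinearEquivOfDetNeZero hdet with he
  have heD : ∀ v, e v = D v := fun v => by simp [he]
  set B : E →L[ℝ] E := (e.symm : E →L[ℝ] E) with hB
  have hBe : ∀ v, B (D v) = v := fun v => by rw [← heD]; simp [hB]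
  have hexpn : ∀ ε > 0, ∃ ρ > 0, ∀ h, ‖h‖ < ρ →
      ‖s (y₀ + h) - s y₀ - (B - ContinuousLinearMap.id ℝ E) h‖ ≤ ε * ‖h‖ := by
    intro ε hε
    set b := ‖B‖ + 1 with hb
    have hbpos : 0 < b := by positivity
    set ε' := min (1 / (2 * b)) (ε / (2 * b ^ 2)) with hε'
    have hε'pos : 0 < ε' := by positivity
    have hdl := hdiff.hasFDerivWithinAt
    rw [hasFDerivWithinAt_iff_isLittleO] at hdl
    have := hdl.def hε'pos
    obtain ⟨ρ1, hρ1, hball⟩ := Metric.eventually_nhds_iff.1 (eventually_nhdsWithin_iff.1 this)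
    obtain ⟨ρ2, hρ2, hcont⟩ :=
      subgradient_continuousAt_of_differentiableAt hs hd (ρ1 / 2) (by positivity)
    refine ⟨min (ρ1 / 2) ρ2, by positivity, fun h hh => ?_⟩
    have hh1 : ‖h‖ < ρ1 / 2 := hh.trans_le (min_le_left _ _)
    have hh2 : ‖h‖ < ρ2 := hh.trans_le (min_le_right _ _)
    have hs2 := hcont (y₀ + h) (by rwa [add_sub_cancel_left])
    set w := Φ (y₀ + h) - Φ y₀ with hw
    have hw' : w = h + (s (y₀ + h) - s y₀) := by simp only [hw, hΦ]; abel
    have hwn : ‖w‖ < ρ1 := by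
      rw [hw']
      exact (norm_add_le _ _).trans_lt (by linarith)
    have hr := hball (y := Φ (y₀ + h)) (by rw [dist_eq_norm]; exact hwn) (mem_range_self _)
    rw [hJΦ, hJΦ, add_sub_cancel_left] at hr
    change ‖h - D w‖ ≤ ε' * ‖w‖ at hr
    have hBr : ‖B (h - D w)‖ ≤ b * (ε' * ‖w‖) :=
      (B.le_opNorm _).trans (by gcongr; linarith)
    have hBh : ‖B h‖ ≤ b * ‖h‖ := (B.le_opNorm _).trans (by gcongr; linarith)
    have hwe : B (h - D w) = B h - w := by rw [map_sub, hBe]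
    have hsmall : b * ε' ≤ 1 / 2 := by
      calc b * ε' ≤ b * (1 / (2 * b)) := by gcongr; exact min_le_left _ _
        _ = 1 / 2 := by field_simp
    have hwb : ‖w‖ ≤ 2 * b * ‖h‖ := by
      have h1 : ‖w‖ ≤ ‖B h‖ + ‖B (h - D w)‖ := by
        calc ‖w‖ = ‖B h - B (h - D w)‖ := by rw [hwe, sub_sub_cancel]
          _ ≤ _ := norm_sub_le _ _
      nlinarith [norm_nonneg w]
    have e1 : s (y₀ + h) - s y₀ - (B - ContinuousLinearMap.id ℝ E) h = -(B (h - D w)) := by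
      rw [hwe, hw']
      simp only [sub_apply, ContinuousLinearMap.id_apply]
      abel
    rw [e1, norm_neg]
    calc _ ≤ b * (ε' * ‖w‖) := hBr
      _ ≤ b * ((ε / (2 * b ^ 2)) * (2 * b * ‖h‖)) := by
        gcongr; exact min_le_right _ _
      _ = ε * ‖h‖ := by field_simp
  refine ⟨(1 / 2 : ℝ) • (B - ContinuousLinearMap.id ℝ E), fun ε hε => ?_⟩
  obtain ⟨ρ, hρ, H⟩ := second_order_of_subgradient_expansion hs hexpn ε hε
  refine ⟨ρ, hρ, fun h hh => ?_⟩
  convert H h hh using 3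
  rw [smul_apply, real_inner_smul_left]
  ring

/-- Sup-convolution of `G` over the set `W`, with quadratic kernel of strength `D`. -/
noncomputable def supConv {E : Type*} [NormedAddCommGroup E] (W : Set E) (G : E → ℝ) (D : ℝ)
    (z : E) : ℝ :=
  sSup ((fun w => G w - D * ‖z - w‖ ^ 2) '' W)

theorem supConv_attained {E : Type*} [NormedAddCommGroup E] {W : Set E} (hW : IsCompact W)
    (hne : W.Nonempty) {G : E → ℝ} (hG : UpperSemicontinuousOn G W) (D : ℝ) (z : E) :
    ∃ w ∈ W, supConv W G D z = G w - D * ‖z - w‖ ^ 2 ∧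
      ∀ w' ∈ W, G w' - D * ‖z - w'‖ ^ 2 ≤ supConv W G D z := by
  have hc : Continuous fun w : E => -(D * ‖z - w‖ ^ 2) := by fun_prop
  have husc : UpperSemicontinuousOn (fun w => G w + -(D * ‖z - w‖ ^ 2)) W :=
    hG.add (hc.upperSemicontinuous.upperSemicontinuousOn W)
  obtain ⟨w, hw, hmax⟩ := husc.exists_isMaxOn hne hW
  have hg : IsGreatest ((fun w => G w - D * ‖z - w‖ ^ 2) '' W) (G w - D * ‖z - w‖ ^ 2) := by
    refine ⟨⟨w, hw, rfl⟩, ?_⟩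
    rintro _ ⟨w', hw', rfl⟩
    have : G w' + -(D * ‖z - w'‖ ^ 2) ≤ G w + -(D * ‖z - w‖ ^ 2) := hmax hw'
    change G w' - D * ‖z - w'‖ ^ 2 ≤ _
    linarith
  have heq : supConv W G D z = G w - D * ‖z - w‖ ^ 2 := hg.csSup_eq
  refine ⟨w, hw, heq, fun w' hw' => ?_⟩
  rw [heq]
  exact hg.2 ⟨w', hw', rfl⟩

theorem eq_zero_of_inner_le_sq {E : Type*} [NormedAddCommGroup E] [InnerProductSpace ℝ E]
    {v : E} {C : ℝ} (h : ∀ k : E, ‖k‖ ≤ 1 → inner ℝ v k ≤ C * ‖k‖ ^ 2) : v = 0 := by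
  by_contra hv
  have hv' : 0 < ‖v‖ := norm_pos_iff.2 hv
  set b := |C| + 1 with hb
  have hbp : 0 < b := by positivity
  set τ := min (1 / ‖v‖) (1 / (2 * b)) with hτ
  have hτp : 0 < τ := by positivity
  have h1 : τ * ‖v‖ ≤ 1 := by
    calc τ * ‖v‖ ≤ 1 / ‖v‖ * ‖v‖ := by gcongr; exact min_le_left _ _
      _ = 1 := by field_simp
  have h2 : τ * b ≤ 1 / 2 := by
    calc τ * b ≤ 1 / (2 * b) * b := by gcongr; exact min_le_right _ _
      _ = 1 / 2 := by field_simp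
  have hn : ‖τ • v‖ = τ * ‖v‖ := by rw [norm_smul, Real.norm_of_nonneg hτp.le]
  have h3 := h (τ • v) (by rw [hn]; exact h1)
  rw [real_inner_smul_right, real_inner_self_eq_norm_sq, hn] at h3
  have h4 : C ≤ b := by rw [hb]; linarith [le_abs_self C]
  have h5 : C * (τ * ‖v‖) ^ 2 ≤ b * (τ * ‖v‖) ^ 2 := by gcongr
  have h6 : b * (τ * ‖v‖) ^ 2 = (τ * b) * (τ * ‖v‖ ^ 2) := by ring
  have h7 : (τ * b) * (τ * ‖v‖ ^ 2) ≤ 1 / 2 * (τ * ‖v‖ ^ 2) := by gcongr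
  have h8 : 0 < τ * ‖v‖ ^ 2 := by positivity
  linarith

/-- A linear perturbation of size at most `r` of `supConv W G D - φ` attains its maximum at a
point where the sup-convolution has a second-order expansion. -/
theorem exists_perturbed_max_second_order {E : Type*} [NormedAddCommGroup E]
    [InnerProductSpace ℝ E] [FiniteDimensional ℝ E] {W : Set E} (hW : IsCompact W)
    (hne : W.Nonempty) {G : E → ℝ} (hG : UpperSemicontinuousOn G W) {φ : E → ℝ} {grad : E → E}
    (hφ : Continuous φ)
    (hsc : ∀ R : ℝ, ∃ C : ℝ, ∀ z, ‖z‖ ≤ R → ∀ h, ‖h‖ ≤ 1 →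
      φ (z + h) ≤ φ z + inner ℝ (grad z) h + C * ‖h‖ ^ 2)
    (hco : ∃ c > 0, ∃ C₀ : ℝ, ∀ z, c * ‖z‖ ^ 2 - C₀ ≤ φ z) {D r : ℝ} (hD : 0 < D) (hr : 0 < r) :
    ∃ (z q : E) (A : E →L[ℝ] E), ‖q‖ ≤ r ∧
      (∀ z', supConv W G D z' - φ z' - inner ℝ q z' ≤ supConv W G D z - φ z - inner ℝ q z) ∧
      ∀ ε > 0, ∃ ρ > 0, ∀ h, ‖h‖ < ρ →
        |supConv W G D (z + h) - supConv W G D z - inner ℝ (grad z + q) h - inner ℝ (A h) h|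
          ≤ ε * ‖h‖ ^ 2 := by
  wlog hr1 : r ≤ 1 generalizing r
  · obtain ⟨z, q, A, h1, h2⟩ := this one_pos le_rfl
    exact ⟨z, q, A, h1.trans (by linarith), h2⟩
  let _ : MeasurableSpace E := borel E
  have : BorelSpace E := ⟨rfl⟩
  set μ : Measure E := volume
  set S := supConv W G D with hS
  choose w hwW hweq hwle using supConv_attained hW hne hG D
  set s : E → E := fun z => (2 * D) • w z with hs
  set g : E → ℝ := fun z => S z + D * ‖z‖ ^ 2 with hg
  have hsub : ∀ y y', g y + inner ℝ (s y) (y' - y) ≤ g y' := by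
    intro y y'
    have h1 := hwle y' (w y) (hwW y)
    have h2 := hweq y
    simp only [hg, hs, hS]
    rw [h2]
    rw [norm_sub_sq_real] at h1 ⊢
    rw [real_inner_smul_left, inner_sub_right, real_inner_comm y (w y), real_inner_comm y' (w y)]
    nlinarith
  obtain ⟨Mw, hMw⟩ := hW.isBounded.exists_norm_le
  have hsM : ∀ y, ‖s y‖ ≤ 2 * D * Mw := by
    intro y
    simp only [hs]
    rw [norm_smul, Real.norm_of_nonneg (by positivity)]
    gcongr
    exact hMw _ (hwW y)
  have hMw0 : 0 ≤ 2 * D * Mw := (norm_nonneg _).trans (hsM 0)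
  have hgood := ae_second_order_of_subgradient μ hsM hsub
  have hgcont : Continuous g := by
    have hlip : LipschitzWith ⟨2 * D * Mw, hMw0⟩ g := by
      apply LipschitzWith.of_le_add_mul
      intro x y
      have h1 := hsub x y
      have h2 := (abs_le.1 (abs_real_inner_le_norm (s x) (y - x))).1
      have h3 : ‖s x‖ * ‖y - x‖ ≤ 2 * D * Mw * ‖y - x‖ := by gcongr; exact hsM x
      rw [dist_comm, dist_eq_norm]
      change g x ≤ g y + 2 * D * Mw * ‖y - x‖
      linarith
    exact hlip.continuous
  have hSg : ∀ z, S z = g z - D * ‖z‖ ^ 2 := fun z => by simp [hg]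
  have hScont : Continuous S := by
    have : S = fun z => g z - D * ‖z‖ ^ 2 := funext hSg
    rw [this]
    fun_prop
  have hSlow : ∀ z h, S z + inner ℝ ((2 * D) • (w z - z)) h - D * ‖h‖ ^ 2 ≤ S (z + h) := by
    intro z h
    have h1 := hsub z (z + h)
    rw [add_sub_cancel_left] at h1
    rw [hSg, hSg, norm_add_sq_real, smul_sub, inner_sub_left, real_inner_smul_left (x := z)]
    simp only [hs] at h1
    linarith
  obtain ⟨MG, hMG⟩ : ∃ MG, ∀ a ∈ W, G a ≤ MG := by
    obtain ⟨a, -, ha⟩ := hG.exists_isMaxOn hne hW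
    exact ⟨G a, fun b hb => ha hb⟩
  have hSM : ∀ z, S z ≤ MG := fun z => by
    rw [hS, hweq z]
    have := hMG _ (hwW z)
    have : 0 ≤ D * ‖z - w z‖ ^ 2 := by positivity
    linarith
  obtain ⟨c, hc, C₀, hco⟩ := hco
  set M := |MG + C₀ - S 0 + φ 0| with hM
  set R := (1 + M) / c + 1 with hR
  have hM0 : 0 ≤ M := abs_nonneg _
  have hR0 : 0 ≤ R := by positivity
  have hbound : ∀ z q : E, ‖q‖ ≤ r → S 0 - φ 0 ≤ S z - φ z - inner ℝ q z → ‖z‖ ≤ R := by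
    intro z q hq hz
    by_contra hcon
    push Not at hcon
    have h1 := hSM z
    have h2 := hco z
    have h3 := (abs_le.1 (abs_real_inner_le_norm q z)).1
    have h4 : ‖q‖ * ‖z‖ ≤ 1 * ‖z‖ := by gcongr; linarith
    have h5 : c * ‖z‖ ^ 2 ≤ ‖z‖ + M := by
      have := le_abs_self (MG + C₀ - S 0 + φ 0)
      linarith
    have h6 : 1 ≤ ‖z‖ := by
      have : 1 ≤ R := by rw [hR]; have : 0 ≤ (1 + M) / c := by positivity
                         linarith
      linarith
    have h7 : c * ‖z‖ > 1 + M := by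
      have : c * R = 1 + M + c := by rw [hR]; field_simp
      nlinarith
    nlinarith
  have hexist : ∀ q : E, ‖q‖ ≤ r → ∃ z, ∀ z', S z' - φ z' - inner ℝ q z' ≤
      S z - φ z - inner ℝ q z := by
    intro q hq
    have hcont : Continuous fun z => S z - φ z - inner ℝ q z := by fun_prop
    obtain ⟨z, -, hz⟩ := (isCompact_closedBall (0 : E) R).exists_isMaxOn
      ⟨0, by simpa using hR0⟩ hcont.continuousOn
    refine ⟨z, fun z' => ?_⟩
    by_cases hz' : ‖z'‖ ≤ R
    · exact hz (by simpa using hz')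
    · have h1 : ¬ (S 0 - φ 0 ≤ S z' - φ z' - inner ℝ q z') := fun h => hz' (hbound z' q hq h)
      have h2 : S 0 - φ 0 - inner ℝ q 0 ≤ S z - φ z - inner ℝ q z :=
        hz (show (0 : E) ∈ Metric.closedBall 0 R by simpa using hR0)
      rw [inner_zero_right] at h2
      linarith
  set K : Set E := {z | ∃ q : E, ‖q‖ ≤ r ∧ ∀ z', S z' - φ z' - inner ℝ q z' ≤
      S z - φ z - inner ℝ q z} with hK
  have hKR : ∀ z ∈ K, ‖z‖ ≤ R := by
    rintro z ⟨q, hq, hz⟩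
    refine hbound z q hq ?_
    simpa using hz 0
  obtain ⟨C₁, hC₁⟩ := hsc R
  set T : E → E := fun z => (2 * D) • (w z - z) - grad z with hT
  have hqT : ∀ z q : E, ‖z‖ ≤ R → (∀ z', S z' - φ z' - inner ℝ q z' ≤ S z - φ z - inner ℝ q z) →
      q = T z := by
    intro z q hz hmax
    have : T z - q = 0 := by
      apply eq_zero_of_inner_le_sq (C := C₁ + D)
      intro h hh
      have h1 := hmax (z + h)
      have h2 := hC₁ z hz h hh
      have h3 := hSlow z h
      rw [inner_add_right] at h1
      simp only [hT]
      rw [inner_sub_left, inner_sub_left]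
      linarith
    rw [sub_eq_zero] at this
    exact this.symm
  set C := max (C₁ + D) 1 with hC
  have hC1 : 1 ≤ C := le_max_right _ _
  have hTlip : LipschitzOnWith ⟨4 * C, by positivity⟩ T K := by
    apply LipschitzOnWith.of_dist_le_mul
    rintro z₂ ⟨q₂, hq₂, hz₂⟩ z₁ ⟨q₁, hq₁, hz₁⟩
    have hR₁ := hKR z₁ ⟨q₁, hq₁, hz₁⟩
    have hR₂ := hKR z₂ ⟨q₂, hq₂, hz₂⟩
    rw [← hqT z₁ q₁ hR₁ hz₁, ← hqT z₂ q₂ hR₂ hz₂, dist_eq_norm, dist_eq_norm]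
    change ‖q₂ - q₁‖ ≤ 4 * C * ‖z₂ - z₁‖
    set Δ := q₂ - q₁ with hΔ
    have hΔ2 : ‖Δ‖ ≤ 2 := (norm_sub_le _ _).trans (by linarith)
    set h := (1 / (2 * C)) • Δ with hh
    have hhn : ‖h‖ = ‖Δ‖ / (2 * C) := by
      rw [hh, norm_smul, Real.norm_of_nonneg (by positivity)]; ring
    have hh1 : ‖h‖ ≤ 1 := by
      rw [hhn, div_le_one (by positivity)]; linarith
    have a1 := hz₁ (z₂ + h)
    have a2 := hSlow z₂ h
    have a3 := hC₁ z₂ hR₂ h hh1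
    have a4 := hz₂ z₁
    have a5 : inner ℝ q₂ h = inner ℝ ((2 * D) • (w z₂ - z₂)) h - inner ℝ (grad z₂) h := by
      rw [hqT z₂ q₂ hR₂ hz₂, hT, inner_sub_left]
    have a6 : (C₁ + D) * ‖h‖ ^ 2 ≤ C * ‖h‖ ^ 2 := by gcongr; exact le_max_left _ _
    have a7 : inner ℝ Δ h = ‖Δ‖ ^ 2 / (2 * C) := by
      rw [hh, real_inner_smul_right, real_inner_self_eq_norm_sq]; ring
    have a8 : inner ℝ Δ h = inner ℝ q₂ h - inner ℝ q₁ h := by rw [hΔ, inner_sub_left]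
    have a9 : inner ℝ Δ (z₁ - z₂) = inner ℝ q₂ z₁ - inner ℝ q₁ z₁ - inner ℝ q₂ z₂
        + inner ℝ q₁ z₂ := by rw [hΔ, inner_sub_left, inner_sub_right, inner_sub_right]; ring
    have a10 := real_inner_le_norm Δ (z₁ - z₂)
    rw [norm_sub_rev z₁ z₂] at a10
    rw [inner_add_right] at a1
    have a11 : C * ‖h‖ ^ 2 = ‖Δ‖ ^ 2 / (4 * C) := by rw [hhn]; field_simp; ring
    have a12 : ‖Δ‖ ^ 2 / (2 * C) - ‖Δ‖ ^ 2 / (4 * C) = ‖Δ‖ ^ 2 / (4 * C) := by field_simp; ring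
    have a13 : ‖Δ‖ ^ 2 / (4 * C) ≤ ‖Δ‖ * ‖z₂ - z₁‖ := by linarith
    rw [div_le_iff₀ (by positivity)] at a13
    rcases (norm_nonneg Δ).eq_or_lt with h0 | h0
    · rw [← h0]; positivity
    · nlinarith
  have hTK : Metric.closedBall (0 : E) r ⊆ T '' K := by
    intro q hq
    have hq' : ‖q‖ ≤ r := by simpa using hq
    obtain ⟨z, hz⟩ := hexist q hq'
    have hzK : z ∈ K := ⟨q, hq', hz⟩
    exact ⟨z, hzK, (hqT z q (hKR z hzK) hz).symm⟩
  have hKpos : μ K ≠ 0 := by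
    intro h0
    have h1 := addHaar_image_eq_zero_of_lipschitzOnWith μ hTlip h0
    have h2 := measure_mono_null hTK h1
    exact (Metric.measure_closedBall_pos μ (0 : E) hr).ne' h2
  obtain ⟨z, ⟨q, hq, hz⟩, A, hA⟩ : ∃ z ∈ K, ∃ A : E →L[ℝ] E, ∀ ε > 0, ∃ ρ > 0, ∀ h, ‖h‖ < ρ →
      |g (z + h) - g z - inner ℝ (s z) h - inner ℝ (A h) h| ≤ ε * ‖h‖ ^ 2 := by
    by_contra hcon
    push Not at hcon
    apply hKpos
    refine measure_mono_null ?_ hgood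
    intro z hz
    simp only [mem_compl_iff, mem_ofPred_eq]
    rintro ⟨A, hA⟩
    obtain ⟨ε, hε, h⟩ := hcon z hz A
    obtain ⟨ρ, hρ, h'⟩ := hA ε hε
    obtain ⟨k, hk, hk'⟩ := h ρ hρ
    exact absurd (h' k hk) (not_le.2 hk')
  refine ⟨z, q, A - D • ContinuousLinearMap.id ℝ E, hq, hz, fun ε hε => ?_⟩
  obtain ⟨ρ, hρ, h'⟩ := hA ε hε
  refine ⟨ρ, hρ, fun h hh => ?_⟩
  convert h' h hh using 2
  have hqq := hqT z q (hKR z ⟨q, hq, hz⟩) hz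
  have : grad z + q = (2 * D) • (w z - z) := by
    rw [hqq]; simp only [hT]; exact add_sub_cancel _ _
  rw [this, hSg, hSg, norm_add_sq_real, smul_sub, inner_sub_left, real_inner_smul_left (x := z),
    sub_apply, inner_sub_left, smul_apply, ContinuousLinearMap.id_apply]
  simp only [hs, real_inner_smul_left, real_inner_self_eq_norm_sq]
  ring

/-- Doubling of variables with quadratic penalization: near-maximum points of
`u₁ a + u₂ b - D‖x - a‖² - D‖y - b‖² - ϑ‖x - c‖² - ϑ‖y - c‖² - ⟪Λ (x - y), x - y⟫`
at which both functions have second-order superjets with controlled second-order parts. -/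
theorem exists_doubling_superjets {V : Type*} [NormedAddCommGroup V] [InnerProductSpace ℝ V]
    [FiniteDimensional ℝ V] {W : Set V} (hW : IsCompact W) (hne : W.Nonempty) {u₁ u₂ : V → ℝ}
    (hu₁ : UpperSemicontinuousOn u₁ W) (hu₂ : UpperSemicontinuousOn u₂ W) (Λ : V →L[ℝ] V)
    (hΛs : ∀ h k, inner ℝ (Λ h) k = inner ℝ (Λ k) h) (hΛp : ∀ h, 0 ≤ inner ℝ (Λ h) h) (c : V)
    {ϑ D r : ℝ} (hϑ : 0 < ϑ) (hD : 0 < D) (hr : 0 < r) :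
    ∃ (x y w₁ w₂ q₁ q₂ : V) (Q₁ Q₂ : V →L[ℝ] V), w₁ ∈ W ∧ w₂ ∈ W ∧ ‖q₁‖ ≤ r ∧ ‖q₂‖ ≤ r ∧
      (∀ x' y', ∀ a ∈ W, ∀ b ∈ W, u₁ a - D * ‖x' - a‖ ^ 2 + u₂ b - D * ‖y' - b‖ ^ 2
          - (ϑ * ‖x' - c‖ ^ 2 + ϑ * ‖y' - c‖ ^ 2 + inner ℝ (Λ (x' - y')) (x' - y'))
          - inner ℝ q₁ x' - inner ℝ q₂ y' ≤
        u₁ w₁ - D * ‖x - w₁‖ ^ 2 + u₂ w₂ - D * ‖y - w₂‖ ^ 2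
          - (ϑ * ‖x - c‖ ^ 2 + ϑ * ‖y - c‖ ^ 2 + inner ℝ (Λ (x - y)) (x - y))
          - inner ℝ q₁ x - inner ℝ q₂ y) ∧
      (∀ ε > 0, ∃ ρ > 0, ∀ a ∈ W, ‖a - w₁‖ < ρ → u₁ a ≤ u₁ w₁
          + inner ℝ ((2 * ϑ) • (x - c) + (2 : ℝ) • Λ (x - y) + q₁) (a - w₁)
          + inner ℝ (Q₁ (a - w₁)) (a - w₁) + ε * ‖a - w₁‖ ^ 2) ∧
      (∀ ε > 0, ∃ ρ > 0, ∀ b ∈ W, ‖b - w₂‖ < ρ → u₂ b ≤ u₂ w₂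
          + inner ℝ ((2 * ϑ) • (y - c) - (2 : ℝ) • Λ (x - y) + q₂) (b - w₂)
          + inner ℝ (Q₂ (b - w₂)) (b - w₂) + ε * ‖b - w₂‖ ^ 2) ∧
      ∀ h k, inner ℝ (Q₁ h) h + inner ℝ (Q₂ k) k ≤
        ϑ * ‖h‖ ^ 2 + ϑ * ‖k‖ ^ 2 + inner ℝ (Λ (h - k)) (h - k) := by
  let pr : V → V → WithLp 2 (V × V) := fun a b => WithLp.toLp 2 (a, b)
  set W' : Set (WithLp 2 (V × V)) := {ζ | ζ.fst ∈ W ∧ ζ.snd ∈ W} with hW'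
  have hcpr : Continuous fun p : V × V => pr p.1 p.2 := WithLp.prod_continuous_toLp 2 V V
  have hW'c : IsCompact W' := by
    have : W' = (fun p : V × V => pr p.1 p.2) '' (W ×ˢ W) := by
      ext ζ
      constructor
      · rintro ⟨h1, h2⟩
        exact ⟨(ζ.fst, ζ.snd), ⟨h1, h2⟩, rfl⟩
      · rintro ⟨p, ⟨h1, h2⟩, rfl⟩
        exact ⟨h1, h2⟩
    rw [this]
    exact (hW.prod hW).image hcpr
  have hW'ne : W'.Nonempty := by
    obtain ⟨a, ha⟩ := hne
    exact ⟨pr a a, ha, ha⟩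
  set G : WithLp 2 (V × V) → ℝ := fun ζ => u₁ ζ.fst + u₂ ζ.snd with hG
  have hcf : Continuous fun ζ : WithLp 2 (V × V) => ζ.fst :=
    continuous_fst.comp (WithLp.prod_continuous_ofLp 2 V V)
  have hcs : Continuous fun ζ : WithLp 2 (V × V) => ζ.snd :=
    continuous_snd.comp (WithLp.prod_continuous_ofLp 2 V V)
  have hGu : UpperSemicontinuousOn G W' :=
    UpperSemicontinuousOn.add
      (hu₁.comp hcf.continuousOn fun ζ hζ => hζ.1)
      (hu₂.comp hcs.continuousOn fun ζ hζ => hζ.2)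
  set φ : WithLp 2 (V × V) → ℝ := fun ζ => ϑ * ‖ζ.fst - c‖ ^ 2 + ϑ * ‖ζ.snd - c‖ ^ 2
    + inner ℝ (Λ (ζ.fst - ζ.snd)) (ζ.fst - ζ.snd) with hφ
  set grad : WithLp 2 (V × V) → WithLp 2 (V × V) := fun ζ =>
    pr ((2 * ϑ) • (ζ.fst - c) + (2 : ℝ) • Λ (ζ.fst - ζ.snd))
      ((2 * ϑ) • (ζ.snd - c) - (2 : ℝ) • Λ (ζ.fst - ζ.snd)) with hgrad
  have hφc : Continuous φ := by
    simp only [hφ]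
    fun_prop
  set Φ : WithLp 2 (V × V) → ℝ := fun h => ϑ * ‖h.fst‖ ^ 2 + ϑ * ‖h.snd‖ ^ 2
    + inner ℝ (Λ (h.fst - h.snd)) (h.fst - h.snd) with hΦ
  have hexp : ∀ z h, φ (z + h) = φ z + inner ℝ (grad z) h + Φ h := by
    intro z h
    have hin : inner ℝ (grad z) h = inner ℝ (grad z).fst h.fst + inner ℝ (grad z).snd h.snd :=
      WithLp.prod_inner_apply _ _
    rw [hin]
    simp only [hφ, hΦ, hgrad, pr, WithLp.add_fst, WithLp.add_snd, WithLp.toLp_fst, WithLp.toLp_snd]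
    rw [show z.fst + h.fst - c = (z.fst - c) + h.fst by abel,
      show z.snd + h.snd - c = (z.snd - c) + h.snd by abel,
      show z.fst + h.fst - (z.snd + h.snd) = (z.fst - z.snd) + (h.fst - h.snd) by abel,
      norm_add_sq_real, norm_add_sq_real, map_add, inner_add_left, inner_add_left,
      inner_add_right, inner_add_right, inner_sub_left ((2 * ϑ) • (z.snd - c)),
      hΛs (h.fst - h.snd) (z.fst - z.snd),
      real_inner_smul_left, real_inner_smul_left, real_inner_smul_left, real_inner_smul_left,
      inner_sub_right (Λ (z.fst - z.snd)) h.fst]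
    ring
  have hΦle : ∀ h, Φ h ≤ (ϑ + 2 * ‖Λ‖) * ‖h‖ ^ 2 := by
    intro h
    have h1 : inner ℝ (Λ (h.fst - h.snd)) (h.fst - h.snd) ≤ ‖Λ‖ * ‖h.fst - h.snd‖ ^ 2 := by
      refine (real_inner_le_norm _ _).trans ?_
      have := Λ.le_opNorm (h.fst - h.snd)
      nlinarith [norm_nonneg (h.fst - h.snd)]
    have h2 : ‖h.fst - h.snd‖ ^ 2 ≤ 2 * (‖h.fst‖ ^ 2 + ‖h.snd‖ ^ 2) := by
      have := parallelogram_law_with_norm ℝ h.fst h.snd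
      nlinarith [sq_nonneg ‖h.fst + h.snd‖]
    have h3 := mul_le_mul_of_nonneg_left h2 (norm_nonneg Λ)
    rw [WithLp.prod_norm_sq_eq_of_L2]
    simp only [hΦ]
    linarith
  have hco : ∃ c > 0, ∃ C₀ : ℝ, ∀ z, c * ‖z‖ ^ 2 - C₀ ≤ φ z := by
    refine ⟨ϑ / 2, by positivity, ϑ * (2 * ‖c‖ ^ 2), fun z => ?_⟩
    have key : ∀ v : V, ‖v‖ ^ 2 / 2 - ‖c‖ ^ 2 ≤ ‖v - c‖ ^ 2 := by
      intro v
      have := norm_sub_sq_real v c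
      have h2 : ‖v - (2 : ℝ) • c‖ ^ 2 = ‖v‖ ^ 2 - 4 * inner ℝ v c + 4 * ‖c‖ ^ 2 := by
        rw [norm_sub_sq_real, real_inner_smul_right, norm_smul]
        norm_num
        ring
      nlinarith [sq_nonneg ‖v - (2 : ℝ) • c‖]
    rw [WithLp.prod_norm_sq_eq_of_L2]
    simp only [hφ]
    have h1 := mul_le_mul_of_nonneg_left (key z.fst) hϑ.le
    have h2 := mul_le_mul_of_nonneg_left (key z.snd) hϑ.le
    have h3 := hΛp (z.fst - z.snd)
    linarith
  obtain ⟨z, q, A, hq, hmax, hA⟩ := exists_perturbed_max_second_order hW'c hW'ne hGu hφc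
    (fun _ => ⟨ϑ + 2 * ‖Λ‖, fun z _ h _ => by rw [hexp]; linarith [hΦle h]⟩) hco hD hr
  set S := supConv W' G D with hS
  choose w hwW hweq hwle using supConv_attained hW'c hW'ne hGu D
  have hnsq : ∀ a b : V, ‖pr a b‖ ^ 2 = ‖a‖ ^ 2 + ‖b‖ ^ 2 := fun a b =>
    WithLp.prod_norm_sq_eq_of_L2 _
  have hSge : ∀ ζ, ∀ a ∈ W, ∀ b ∈ W, u₁ a - D * ‖ζ.fst - a‖ ^ 2 + u₂ b - D * ‖ζ.snd - b‖ ^ 2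
      ≤ S ζ := by
    intro ζ a ha b hb
    have h1 := hwle ζ (pr a b) ⟨ha, hb⟩
    have h2 : ‖ζ - pr a b‖ ^ 2 = ‖ζ.fst - a‖ ^ 2 + ‖ζ.snd - b‖ ^ 2 :=
      WithLp.prod_norm_sq_eq_of_L2 _
    rw [h2] at h1
    change u₁ a + u₂ b - _ ≤ _ at h1
    linarith
  have hSeq : ∀ ζ, S ζ = u₁ (w ζ).fst - D * ‖ζ.fst - (w ζ).fst‖ ^ 2 + u₂ (w ζ).snd
      - D * ‖ζ.snd - (w ζ).snd‖ ^ 2 := by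
    intro ζ
    rw [hS, hweq ζ, WithLp.prod_norm_sq_eq_of_L2]
    simp only [hG, WithLp.sub_fst, WithLp.sub_snd]
    ring
  have hsplit : ∀ h k : V, S (z + pr h 0) + S (z + pr 0 k) ≤ S (z + pr h k) + S z := by
    intro h k
    have h1 := hSeq (z + pr h 0)
    have h2 := hSeq (z + pr 0 k)
    have h3 := hSge (z + pr h k) _ (hwW (z + pr h 0)).1 _ (hwW (z + pr 0 k)).2
    have h4 := hSge z _ (hwW (z + pr 0 k)).1 _ (hwW (z + pr h 0)).2
    simp only [WithLp.add_fst, WithLp.add_snd, pr, WithLp.toLp_fst, WithLp.toLp_snd,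
      add_zero] at h1 h2 h3 h4 ⊢
    linarith
  have hi1 : ∀ (ζ : WithLp 2 (V × V)) (h : V), inner ℝ ζ (pr h 0) = inner ℝ ζ.fst h := by
    intro ζ h
    simp [pr, WithLp.prod_inner_apply]
  have hi2 : ∀ (ζ : WithLp 2 (V × V)) (h : V), inner ℝ ζ (pr 0 h) = inner ℝ ζ.snd h := by
    intro ζ h
    simp [pr, WithLp.prod_inner_apply]
  have hn1 : ∀ h : V, ‖pr h 0‖ = ‖h‖ := fun h => by
    rw [← sq_eq_sq₀ (norm_nonneg _) (norm_nonneg _), hnsq]; simp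
  have hn2 : ∀ h : V, ‖pr 0 h‖ = ‖h‖ := fun h => by
    rw [← sq_eq_sq₀ (norm_nonneg _) (norm_nonneg _), hnsq]; simp
  let i₁ : V →L[ℝ] WithLp 2 (V × V) :=
    (WithLp.prodContinuousLinearEquiv 2 ℝ V V).symm.toContinuousLinearMap.comp
      (ContinuousLinearMap.inl ℝ V V)
  let i₂ : V →L[ℝ] WithLp 2 (V × V) :=
    (WithLp.prodContinuousLinearEquiv 2 ℝ V V).symm.toContinuousLinearMap.comp
      (ContinuousLinearMap.inr ℝ V V)
  let p₁ : WithLp 2 (V × V) →L[ℝ] V := (ContinuousLinearMap.fst ℝ V V).comp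
    (WithLp.prodContinuousLinearEquiv 2 ℝ V V).toContinuousLinearMap
  let p₂ : WithLp 2 (V × V) →L[ℝ] V := (ContinuousLinearMap.snd ℝ V V).comp
    (WithLp.prodContinuousLinearEquiv 2 ℝ V V).toContinuousLinearMap
  have hi₁ : ∀ h, i₁ h = pr h 0 := fun h => rfl
  have hi₂ : ∀ h, i₂ h = pr 0 h := fun h => rfl
  have hp₁ : ∀ ζ, p₁ ζ = ζ.fst := fun h => rfl
  have hp₂ : ∀ ζ, p₂ ζ = ζ.snd := fun h => rfl
  have hgq1 : (grad z + q).fst = (2 * ϑ) • (z.fst - c) + (2 : ℝ) • Λ (z.fst - z.snd) + q.fst :=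
    rfl
  have hgq2 : (grad z + q).snd = (2 * ϑ) • (z.snd - c) - (2 : ℝ) • Λ (z.fst - z.snd) + q.snd :=
    rfl
  have hqsq := WithLp.prod_norm_sq_eq_of_L2 q
  refine ⟨z.fst, z.snd, (w z).fst, (w z).snd, q.fst, q.snd, p₁.comp (A.comp i₁),
    p₂.comp (A.comp i₂), (hwW z).1, (hwW z).2, ?_, ?_, ?_, ?_, ?_, ?_⟩
  · refine le_trans (abs_le_of_sq_le_sq' ?_ (norm_nonneg q)).2 hq
    nlinarith [sq_nonneg ‖q.snd‖]
  · refine le_trans (abs_le_of_sq_le_sq' ?_ (norm_nonneg q)).2 hq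
    nlinarith [sq_nonneg ‖q.fst‖]
  · intro x' y' a ha b hb
    have h1 := hmax (pr x' y')
    have h2 := hSge (pr x' y') a ha b hb
    have h3 := hSeq z
    have h4 : inner ℝ q (pr x' y') = inner ℝ q.fst x' + inner ℝ q.snd y' :=
      WithLp.prod_inner_apply _ _
    have h5 : inner ℝ q z = inner ℝ q.fst z.fst + inner ℝ q.snd z.snd :=
      WithLp.prod_inner_apply _ _
    have h6 : φ (pr x' y') = ϑ * ‖x' - c‖ ^ 2 + ϑ * ‖y' - c‖ ^ 2
      + inner ℝ (Λ (x' - y')) (x' - y') := rfl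
    have h7 : φ z = ϑ * ‖z.fst - c‖ ^ 2 + ϑ * ‖z.snd - c‖ ^ 2
      + inner ℝ (Λ (z.fst - z.snd)) (z.fst - z.snd) := rfl
    change u₁ a - D * ‖x' - a‖ ^ 2 + u₂ b - D * ‖y' - b‖ ^ 2 ≤ _ at h2
    linarith
  · intro ε hε
    obtain ⟨ρ, hρ, h'⟩ := hA ε hε
    refine ⟨ρ, hρ, fun a ha haρ => ?_⟩
    have h1 := (abs_le.1 (h' (pr (a - (w z).fst) 0) (by rwa [hn1]))).2
    rw [hi1, hi1, hn1, hgq1] at h1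
    have h2 := hSge (z + pr (a - (w z).fst) 0) a ha _ (hwW z).2
    have h3 := hSeq z
    simp only [WithLp.add_fst, WithLp.add_snd, pr, WithLp.toLp_fst, WithLp.toLp_snd, add_zero] at h2
    rw [show z.fst + (a - (w z).fst) - a = z.fst - (w z).fst by abel] at h2
    simp only [ContinuousLinearMap.comp_apply, hp₁, hi₁]
    simp only [pr] at h1 ⊢
    linarith
  · intro ε hε
    obtain ⟨ρ, hρ, h'⟩ := hA ε hε
    refine ⟨ρ, hρ, fun a ha haρ => ?_⟩
    have h1 := (abs_le.1 (h' (pr 0 (a - (w z).snd)) (by rwa [hn2]))).2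
    rw [hi2, hi2, hn2, hgq2] at h1
    have h2 := hSge (z + pr 0 (a - (w z).snd)) _ (hwW z).1 a ha
    have h3 := hSeq z
    simp only [WithLp.add_fst, WithLp.add_snd, pr, WithLp.toLp_fst, WithLp.toLp_snd, add_zero] at h2
    rw [show z.snd + (a - (w z).snd) - a = z.snd - (w z).snd by abel] at h2
    simp only [ContinuousLinearMap.comp_apply, hp₂, hi₂]
    simp only [pr] at h1 ⊢
    linarith
  · intro h k
    refine le_of_forall_pos_le_add fun ε hε => ?_
    set n := ‖h‖ ^ 2 + ‖k‖ ^ 2 with hn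
    obtain ⟨ρ, hρ, h'⟩ := hA (ε / (2 * (n + 1))) (by positivity)
    obtain ⟨τ, hτ0, hτh, hτk⟩ : ∃ τ : ℝ, 0 < τ ∧ τ * ‖h‖ < ρ ∧ τ * ‖k‖ < ρ := by
      refine ⟨ρ / (‖h‖ + ‖k‖ + 1), by positivity, ?_, ?_⟩ <;>
      · rw [div_mul_eq_mul_div, div_lt_iff₀ (by positivity)]
        gcongr
        linarith [norm_nonneg h, norm_nonneg k]
    have h1 := (abs_le.1 (h' (pr (τ • h) 0)
      (by rwa [hn1, norm_smul, Real.norm_of_nonneg hτ0.le]))).1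
    have h2 := (abs_le.1 (h' (pr 0 (τ • k))
      (by rwa [hn2, norm_smul, Real.norm_of_nonneg hτ0.le]))).1
    have h3 := hsplit (τ • h) (τ • k)
    have h4 := hmax (z + pr (τ • h) (τ • k))
    rw [hexp, inner_add_right] at h4
    have h5 : pr (τ • h) (τ • k) = pr (τ • h) 0 + pr 0 (τ • k) := by
      simp only [pr, ← WithLp.toLp_add, Prod.mk_add_mk, add_zero, zero_add]
    have h6 : Φ (pr (τ • h) (τ • k)) = τ ^ 2 * (ϑ * ‖h‖ ^ 2 + ϑ * ‖k‖ ^ 2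
        + inner ℝ (Λ (h - k)) (h - k)) := by
      change ϑ * ‖τ • h‖ ^ 2 + ϑ * ‖τ • k‖ ^ 2 + inner ℝ (Λ (τ • h - τ • k)) (τ • h - τ • k) = _
      rw [← smul_sub, map_smul, real_inner_smul_left, real_inner_smul_right, norm_smul, norm_smul,
        Real.norm_of_nonneg hτ0.le]
      ring
    have h7 : inner ℝ (A (pr (τ • h) 0)) (pr (τ • h) 0) = τ ^ 2 * inner ℝ (A (pr h 0)).fst h := by
      rw [← hi₁, map_smul, map_smul, real_inner_smul_left, real_inner_smul_right, hi₁, hi1]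
      ring
    have h8 : inner ℝ (A (pr 0 (τ • k))) (pr 0 (τ • k)) = τ ^ 2 * inner ℝ (A (pr 0 k)).snd k := by
      rw [← hi₂, map_smul, map_smul, real_inner_smul_left, real_inner_smul_right, hi₂, hi2]
      ring
    have h9 : inner ℝ (grad z) (pr (τ • h) (τ • k)) + inner ℝ q (pr (τ • h) (τ • k)) =
        inner ℝ (grad z + q) (pr (τ • h) 0) + inner ℝ (grad z + q) (pr 0 (τ • k)) := by
      rw [← inner_add_left, h5, inner_add_right]
    rw [h7, hn1, norm_smul, Real.norm_of_nonneg hτ0.le] at h1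
    rw [h8, hn2, norm_smul, Real.norm_of_nonneg hτ0.le] at h2
    have h10 : ε / (2 * (n + 1)) * (τ * ‖h‖) ^ 2 + ε / (2 * (n + 1)) * (τ * ‖k‖) ^ 2
        ≤ τ ^ 2 * ε := by
      have : ε / (2 * (n + 1)) * (τ * ‖h‖) ^ 2 + ε / (2 * (n + 1)) * (τ * ‖k‖) ^ 2
        = τ ^ 2 * (ε * (n / (2 * (n + 1)))) := by rw [hn]; field_simp
      rw [this]
      gcongr
      have : n / (2 * (n + 1)) ≤ 1 := by
        rw [div_le_one (by positivity)]
        have : 0 ≤ n := by positivity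
        linarith
      nlinarith
    have h11 : τ ^ 2 * (inner ℝ (A (pr h 0)).fst h + inner ℝ (A (pr 0 k)).snd k) ≤
        τ ^ 2 * (ϑ * ‖h‖ ^ 2 + ϑ * ‖k‖ ^ 2 + inner ℝ (Λ (h - k)) (h - k) + ε) := by
      linarith
    exact le_of_mul_le_mul_left h11 (by positivity)

/-- Space-time with its Euclidean norm. -/
abbrev SpaceTime (N : ℕ) : Type := WithLp 2 (Euc N × ℝ)

/-- The space-time point with components `x` and `t`. -/
noncomputable def st {N : ℕ} (x : Euc N) (t : ℝ) : SpaceTime N := WithLp.toLp 2 (x, t)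

@[simp] theorem st_fst {N : ℕ} (x : Euc N) (t : ℝ) : (st x t).fst = x := rfl

@[simp] theorem st_snd {N : ℕ} (x : Euc N) (t : ℝ) : (st x t).snd = t := rfl

theorem st_eta {N : ℕ} (ζ : SpaceTime N) : st ζ.fst ζ.snd = ζ := rfl

theorem st_sub {N : ℕ} (x y : Euc N) (t s : ℝ) : st x t - st y s = st (x - y) (t - s) := rfl

theorem st_add {N : ℕ} (x y : Euc N) (t s : ℝ) : st x t + st y s = st (x + y) (t + s) := rfl

theorem inner_eq_fst_snd {N : ℕ} (ζ ξ : SpaceTime N) :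
    inner ℝ ζ ξ = inner ℝ ζ.fst ξ.fst + ζ.snd * ξ.snd := by
  have := WithLp.prod_inner_apply (𝕜 := ℝ) ζ ξ
  rw [this]
  simp [mul_comm]

theorem norm_st_sq {N : ℕ} (x : Euc N) (t : ℝ) : ‖st x t‖ ^ 2 = ‖x‖ ^ 2 + t ^ 2 := by
  have := WithLp.prod_norm_sq_eq_of_L2 (st x t)
  rw [this]
  simp

theorem norm_st_zero {N : ℕ} (x : Euc N) : ‖st x 0‖ = ‖x‖ := by
  rw [← sq_eq_sq₀ (norm_nonneg _) (norm_nonneg _), norm_st_sq]; simp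

theorem norm_fst_le_norm_st {N : ℕ} (ζ : SpaceTime N) : ‖ζ.fst‖ ≤ ‖ζ‖ := by
  have := norm_st_sq ζ.fst ζ.snd
  rw [st_eta] at this
  exact (abs_le_of_sq_le_sq' (by nlinarith [sq_nonneg ζ.snd]) (norm_nonneg ζ)).2

theorem abs_snd_le_norm_st {N : ℕ} (ζ : SpaceTime N) : |ζ.snd| ≤ ‖ζ‖ := by
  have := norm_st_sq ζ.fst ζ.snd
  rw [st_eta] at this
  exact abs_le_of_sq_le_sq (by nlinarith [sq_nonneg ‖ζ.fst‖]) (norm_nonneg ζ)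

/-- The linear map `h ↦ (h, 0)` into space-time. -/
noncomputable def stInl (N : ℕ) : Euc N →L[ℝ] SpaceTime N :=
  (WithLp.prodContinuousLinearEquiv 2 ℝ (Euc N) ℝ).symm.toContinuousLinearMap.comp
    (ContinuousLinearMap.inl ℝ (Euc N) ℝ)

theorem stInl_apply {N : ℕ} (h : Euc N) : stInl N h = st h 0 := rfl

theorem contDiff_st {N : ℕ} {n : WithTop ℕ∞} :
    ContDiff ℝ n fun p : Euc N × ℝ => st p.1 p.2 :=
  (WithLp.prodContinuousLinearEquiv 2 ℝ (Euc N) ℝ).symm.contDiff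

theorem continuous_st {N : ℕ} : Continuous fun p : Euc N × ℝ => st p.1 p.2 :=
  (contDiff_st (n := 0)).continuous

/-- Second-order polynomial plus a high-order growth term. -/
noncomputable def jetPoly {V : Type*} [NormedAddCommGroup V] [InnerProductSpace ℝ V] (P : V)
    (Q : V →L[ℝ] V) (C : ℝ) (m : ℕ) (ζ : V) : ℝ :=
  inner ℝ P ζ + inner ℝ (Q ζ) ζ + C * (‖ζ‖ ^ 2) ^ (m + 2)

section JetPoly

variable {V : Type*} [NormedAddCommGroup V] [InnerProductSpace ℝ V] (P : V) (Q : V →L[ℝ] V)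
  (C : ℝ) (m : ℕ)

theorem contDiff_jetPoly {n : WithTop ℕ∞} : ContDiff ℝ n (jetPoly P Q C m) := by
  have h1 : ContDiff ℝ n fun ζ : V => inner ℝ P ζ := contDiff_const.inner ℝ contDiff_id
  have h2 : ContDiff ℝ n fun ζ : V => inner ℝ (Q ζ) ζ := Q.contDiff.inner ℝ contDiff_id
  have h3 : ContDiff ℝ n fun ζ : V => C * (‖ζ‖ ^ 2) ^ (m + 2) :=
    contDiff_const.mul ((contDiff_id.norm_sq ℝ).pow _)
  exact (h1.add h2).add h3

/-- The gradient of `jetPoly`, paired with a direction. -/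
noncomputable def jetPolyDeriv (ζ h : V) : ℝ :=
  inner ℝ P h + (inner ℝ (Q ζ) h + inner ℝ (Q h) ζ)
    + C * ((m + 2 : ℕ) * (‖ζ‖ ^ 2) ^ (m + 1) * (2 * inner ℝ ζ h))

theorem fderiv_jetPoly (ζ h : V) : fderiv ℝ (jetPoly P Q C m) ζ h = jetPolyDeriv P Q C m ζ h := by
  have h1 : HasFDerivAt (fun ζ : V => inner ℝ P ζ) (innerSL ℝ P) ζ := (innerSL ℝ P).hasFDerivAt
  have h2 := (Q.hasFDerivAt (x := ζ)).inner ℝ (hasFDerivAt_id ζ)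
  have h3 := ((hasStrictFDerivAt_norm_sq ζ).hasFDerivAt.pow (m + 2)).const_mul C
  have h4 := ((h1.add h2).add h3).fderiv
  change fderiv ℝ (jetPoly P Q C m) ζ = _ at h4
  rw [h4]
  simp [jetPolyDeriv, fderivInnerCLM_apply]

theorem fderiv_jetPolyDeriv_zero (h k : V) :
    fderiv ℝ (fun ζ => jetPolyDeriv P Q C m ζ h) 0 k = inner ℝ (Q k) h + inner ℝ (Q h) k := by
  have h1 : HasFDerivAt (fun ζ : V => inner ℝ (Q ζ) h) ((innerSL ℝ h).comp Q) 0 := by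
    have := ((innerSL ℝ h).comp Q).hasFDerivAt (x := (0 : V))
    refine this.congr_of_eventuallyEq (Eventually.of_forall fun ζ => ?_)
    simp [real_inner_comm]
  have h2 : HasFDerivAt (fun ζ : V => inner ℝ (Q h) ζ) (innerSL ℝ (Q h)) 0 :=
    (innerSL ℝ (Q h)).hasFDerivAt
  have h3 : HasFDerivAt (fun ζ : V => 2 * inner ℝ ζ h) ((2 : ℝ) • innerSL ℝ h) 0 := by
    refine ((2 : ℝ) • innerSL ℝ h).hasFDerivAt.congr_of_eventuallyEq
      (Eventually.of_forall fun ζ => ?_)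
    simp [real_inner_comm]
  have h4 := (((hasStrictFDerivAt_norm_sq (0 : V)).hasFDerivAt.pow (m + 1)).const_mul
    ((m + 2 : ℕ) : ℝ)).mul h3
  have h5 := (((hasFDerivAt_const (inner ℝ P h) (0 : V)).add (h1.add h2)).add (h4.const_mul C))
  have h6 := h5.fderiv
  change fderiv ℝ (fun ζ => jetPolyDeriv P Q C m ζ h) 0 = _ at h6
  rw [h6]
  simp [real_inner_comm]

theorem differentiable_jetPolyDeriv (h : V) :
    Differentiable ℝ fun ζ => jetPolyDeriv P Q C m ζ h := by
  have : (fun ζ => jetPolyDeriv P Q C m ζ h) = fun ζ => fderiv ℝ (jetPoly P Q C m) ζ h :=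
    funext fun ζ => (fderiv_jetPoly P Q C m ζ h).symm
  rw [this]
  have hd : ContDiff ℝ 1 (fderiv ℝ (jetPoly P Q C m)) :=
    (contDiff_jetPoly P Q C m (n := 2)).fderiv_right (by norm_num)
  exact fun ζ => (hd.differentiable (by norm_num) ζ).clm_apply (differentiableAt_const h)

end JetPoly

/-- Test function on space-time built from a second-order jet at `(x₀, t₀)`. -/
noncomputable def jetTest {N : ℕ} (x₀ : Euc N) (t₀ u₀ : ℝ) (P : SpaceTime N)
    (Q : SpaceTime N →L[ℝ] SpaceTime N) (C : ℝ) (m : ℕ) (x : Euc N) (t : ℝ) : ℝ :=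
  u₀ + jetPoly P Q C m (st (x - x₀) (t - t₀))

section JetTest

variable {N : ℕ} (x₀ : Euc N) (t₀ u₀ : ℝ) (P : SpaceTime N)
    (Q : SpaceTime N →L[ℝ] SpaceTime N) (C : ℝ) (m : ℕ)

theorem isC12_jetTest (T : ℝ) : IsC12 T (jetTest x₀ t₀ u₀ P Q C m) := by
  have hst : ContDiff ℝ 2 fun p : Euc N × ℝ => st (p.1 - x₀) (p.2 - t₀) :=
    ContDiff.comp (g := fun p : Euc N × ℝ => st p.1 p.2)
      (f := fun p : Euc N × ℝ => (p.1 - x₀, p.2 - t₀)) contDiff_st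
      ((contDiff_fst.sub contDiff_const).prodMk (contDiff_snd.sub contDiff_const))
  set F : Euc N × ℝ → ℝ := fun p => jetTest x₀ t₀ u₀ P Q C m p.1 p.2 with hF
  have h : ContDiff ℝ 2 F :=
    contDiff_const.add (ContDiff.comp (g := jetPoly P Q C m)
      (f := fun p : Euc N × ℝ => st (p.1 - x₀) (p.2 - t₀)) (contDiff_jetPoly P Q C m) hst)
  refine ⟨fun t _ => ?_, fun x t _ => ?_, h.continuous.continuousOn⟩
  · exact ContDiff.comp (g := F) (f := fun x : Euc N => (x, t)) h
      (contDiff_id.prodMk contDiff_const)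
  · have : ContDiff ℝ 2 (F ∘ fun s => (x, s)) :=
      ContDiff.comp (g := F) (f := fun s : ℝ => (x, s)) h (contDiff_const.prodMk contDiff_id)
    exact this.differentiable (by norm_num) t

theorem pd1_jetTest (x : Euc N) (t : ℝ) (k : Fin N) :
    pd1 (jetTest x₀ t₀ u₀ P Q C m) x t k =
      jetPolyDeriv P Q C m (st (x - x₀) (t - t₀)) (st (EuclideanSpace.single k 1) 0) := by
  have h1 : HasFDerivAt (fun x' : Euc N => st (x' - x₀) (t - t₀)) (stInl N) x := by
    have h2 : HasFDerivAt (fun x' : Euc N => stInl N x' + st (-x₀) (t - t₀)) (stInl N) x :=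
      ((stInl N).hasFDerivAt).add_const _
    refine h2.congr_of_eventuallyEq (Eventually.of_forall fun x' => ?_)
    change st (x' - x₀) (t - t₀) = stInl N x' + st (-x₀) (t - t₀)
    rw [stInl_apply, st_add, zero_add, ← sub_eq_add_neg x']
  have h3 := (((contDiff_jetPoly P Q C m (n := 2)).differentiable (by norm_num)
    (st (x - x₀) (t - t₀))).hasFDerivAt.comp x h1).const_add u₀
  unfold pd1
  have h4 := h3.fderiv
  change fderiv ℝ (fun x' => jetTest x₀ t₀ u₀ P Q C m x' t) x = _ at h4
  rw [h4, ContinuousLinearMap.comp_apply, fderiv_jetPoly, stInl_apply]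

theorem pd1_jetTest_self (k : Fin N) :
    pd1 (jetTest x₀ t₀ u₀ P Q C m) x₀ t₀ k = P.fst k := by
  rw [pd1_jetTest, sub_self, sub_self]
  have h0 : st (0 : Euc N) (0 : ℝ) = 0 := rfl
  simp only [h0, jetPolyDeriv, map_zero, inner_zero_left, inner_zero_right, inner_eq_fst_snd,
    st_fst, st_snd]
  simp [EuclideanSpace.inner_single_right]

theorem pd2_jetTest_self (k j : Fin N) :
    pd2 (jetTest x₀ t₀ u₀ P Q C m) x₀ t₀ k j =
      inner ℝ (Q (st (EuclideanSpace.single k 1) 0)) (st (EuclideanSpace.single j 1) 0)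
      + inner ℝ (Q (st (EuclideanSpace.single j 1) 0)) (st (EuclideanSpace.single k 1) 0) := by
  have h1 : HasFDerivAt (fun x' : Euc N => st (x' - x₀) (t₀ - t₀)) (stInl N) x₀ := by
    have h2 : HasFDerivAt (fun x' : Euc N => stInl N x' + st (-x₀) 0) (stInl N) x₀ :=
      ((stInl N).hasFDerivAt).add_const _
    refine h2.congr_of_eventuallyEq (Eventually.of_forall fun x' => ?_)
    change st (x' - x₀) (t₀ - t₀) = stInl N x' + st (-x₀) 0
    rw [stInl_apply, st_add, zero_add, ← sub_eq_add_neg x', sub_self]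
  have h3 := ((differentiable_jetPolyDeriv P Q C m (st (EuclideanSpace.single j 1) 0))
    (st (x₀ - x₀) (t₀ - t₀))).hasFDerivAt.comp x₀ h1
  unfold pd2
  simp only [pd1_jetTest]
  have h4 := h3.fderiv
  simp only [Function.comp_def] at h4
  rw [h4, ContinuousLinearMap.comp_apply, sub_self, sub_self]
  have h0 : st (0 : Euc N) (0 : ℝ) = 0 := rfl
  rw [h0, fderiv_jetPolyDeriv_zero, stInl_apply]

theorem pdt_jetTest_self : pdt (jetTest x₀ t₀ u₀ P Q C m) x₀ t₀ = P.snd := by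
  let inr : ℝ →L[ℝ] SpaceTime N :=
    (WithLp.prodContinuousLinearEquiv 2 ℝ (Euc N) ℝ).symm.toContinuousLinearMap.comp
      (ContinuousLinearMap.inr ℝ (Euc N) ℝ)
  have h1 : HasFDerivAt (fun s : ℝ => st (x₀ - x₀) (s - t₀)) inr t₀ := by
    rw [sub_self]
    exact inr.hasFDerivAt.comp t₀ ((hasFDerivAt_id t₀).sub_const t₀)
  have h3 := (((contDiff_jetPoly P Q C m (n := 2)).differentiable (by norm_num)
    (st (x₀ - x₀) (t₀ - t₀))).hasFDerivAt.comp t₀ h1).const_add u₀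
  have h4 := h3.hasDerivAt.deriv
  change pdt (jetTest x₀ t₀ u₀ P Q C m) x₀ t₀ = _ at h4
  have h5 : inr 1 = st 0 1 := rfl
  rw [h4, ContinuousLinearMap.comp_apply, h5, fderiv_jetPoly, sub_self, sub_self]
  have h0 : st (0 : Euc N) (0 : ℝ) = 0 := rfl
  simp only [h0, jetPolyDeriv, map_zero, inner_zero_left, inner_zero_right, inner_eq_fst_snd,
    st_fst, st_snd]
  simp

/-- The local operator evaluated on the jet test function, in terms of the columns of `σ`. -/
theorem Lop_jetTest (σ : Euc N → ℝ → Matrix (Fin N) (Fin N) ℝ) (a : Euc N → ℝ → Fin N → ℝ) :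
    Lop σ a (jetTest x₀ t₀ u₀ P Q C m) x₀ t₀ =
      2 * ∑ j, inner ℝ (Q (st (WithLp.toLp 2 fun k => σ x₀ t₀ k j) 0))
          (st (WithLp.toLp 2 fun k => σ x₀ t₀ k j) 0)
        + ∑ k, a x₀ t₀ k * P.fst k + P.snd := by
  unfold Lop
  simp only [pd1_jetTest_self, pdt_jetTest_self, pd2_jetTest_self]
  congr 2
  set e : Fin N → SpaceTime N := fun k => st (EuclideanSpace.single k 1) 0 with he
  have hcol : ∀ j, st (WithLp.toLp 2 fun k => σ x₀ t₀ k j) 0 = ∑ k, σ x₀ t₀ k j • e k := by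
    intro j
    have : (WithLp.toLp 2 fun k => σ x₀ t₀ k j : Euc N) =
        ∑ k, σ x₀ t₀ k j • EuclideanSpace.single k (1 : ℝ) := by
      ext i
      simp [Pi.single_apply]
    rw [← stInl_apply, this, map_sum]
    simp only [map_smul, stInl_apply, he]
  have hq : ∀ j, inner ℝ (Q (st (WithLp.toLp 2 fun k => σ x₀ t₀ k j) 0))
      (st (WithLp.toLp 2 fun k => σ x₀ t₀ k j) 0) =
      ∑ k, ∑ i, σ x₀ t₀ k j * σ x₀ t₀ i j * inner ℝ (Q (e k)) (e i) := by
    intro j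
    rw [hcol, map_sum, sum_inner]
    refine Finset.sum_congr rfl fun k _ => ?_
    rw [inner_sum]
    refine Finset.sum_congr rfl fun i _ => ?_
    rw [map_smul, real_inner_smul_left, real_inner_smul_right]
    ring
  simp only [hq]
  have h1 : ∀ k i, (σ x₀ t₀ * (σ x₀ t₀).transpose) k i = ∑ j, σ x₀ t₀ k j * σ x₀ t₀ i j := by
    intro k i
    simp [Matrix.mul_apply]
  have h2 : ∑ j, ∑ k, ∑ i, σ x₀ t₀ k j * σ x₀ t₀ i j * inner ℝ (Q (e k)) (e i) =
      ∑ k, ∑ i, (σ x₀ t₀ * (σ x₀ t₀).transpose) k i * inner ℝ (Q (e k)) (e i) := by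
    rw [Finset.sum_comm]
    refine Finset.sum_congr rfl fun k _ => ?_
    rw [Finset.sum_comm]
    refine Finset.sum_congr rfl fun i _ => ?_
    rw [h1, Finset.sum_mul]
  have h3 : ∑ k, ∑ i, (σ x₀ t₀ * (σ x₀ t₀).transpose) k i * inner ℝ (Q (e i)) (e k) =
      ∑ k, ∑ i, (σ x₀ t₀ * (σ x₀ t₀).transpose) k i * inner ℝ (Q (e k)) (e i) := by
    rw [Finset.sum_comm]
    refine Finset.sum_congr rfl fun k _ => Finset.sum_congr rfl fun i _ => ?_
    rw [h1, h1]
    congr 1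
    exact Finset.sum_congr rfl fun j _ => mul_comm _ _
  rw [h2, two_mul]
  nth_rewrite 2 [← h3]
  rw [← Finset.sum_add_distrib]
  refine Finset.sum_congr rfl fun k _ => ?_
  rw [← Finset.sum_add_distrib]
  refine Finset.sum_congr rfl fun i _ => ?_
  ring

end JetTest

theorem exists_const_mul_pow_dominates (c γ X ρ a b d : ℝ) (hc : 0 ≤ c) (hX : 0 ≤ X)
    (hγ : 0 ≤ γ) (hρ : 0 < ρ) (ha : 0 ≤ a) (hb : 0 ≤ b) (hd : 0 ≤ d) :
    ∃ (m : ℕ) (C : ℝ), 0 ≤ C ∧ ∀ s, ρ ≤ s →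
      c * (1 + (X + s) ^ γ) + a + b * s + d * s ^ 2 ≤ C * (s ^ 2) ^ (m + 2) := by
  set m := ⌈γ⌉₊ with hm
  set n := 2 * (m + 2) with hn
  have hγn : γ ≤ (n : ℝ) := by
    have := Nat.le_ceil γ
    rw [hn]; push_cast
    linarith
  set K := c * (2 + (X + ρ) ^ n) + a + b * ρ + d * ρ ^ 2 with hK
  refine ⟨m, K / ρ ^ n, by positivity, fun s hs => ?_⟩
  have hs0 : 0 < s := hρ.trans_le hs
  obtain ⟨r, hr⟩ : ∃ r, s = ρ * r := ⟨s / ρ, by field_simp⟩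
  have hr1 : 1 ≤ r := by
    rw [hr] at hs
    exact (le_mul_iff_one_le_right hρ).1 hs
  have h1 : 1 ≤ r ^ n := one_le_pow₀ hr1
  have h2 : r ≤ r ^ n := le_self_pow₀ hr1 (by omega)
  have h3 : r ^ 2 ≤ r ^ n := pow_le_pow_right₀ hr1 (by omega)
  have h4 : (X + s) ^ γ ≤ 1 + (X + ρ) ^ n * r ^ n := by
    have h5 : X + s ≤ (X + ρ) * r := by rw [hr]; nlinarith
    rcases le_total (X + s) 1 with h | h
    · have := Real.rpow_le_one (by positivity : 0 ≤ X + s) h hγ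
      have : 0 ≤ (X + ρ) ^ n * r ^ n := by positivity
      linarith
    · have h6 : (X + s) ^ γ ≤ (X + s) ^ (n : ℝ) := Real.rpow_le_rpow_of_exponent_le h hγn
      rw [Real.rpow_natCast] at h6
      have h7 : (X + s) ^ n ≤ ((X + ρ) * r) ^ n := by gcongr
      rw [mul_pow] at h7
      linarith
  have h8 : K / ρ ^ n * (s ^ 2) ^ (m + 2) = K * r ^ n := by
    rw [← pow_mul, ← hn, hr, mul_pow]
    field_simp
  rw [h8, hK]
  have h9 : c * (1 + (X + s) ^ γ) ≤ c * ((2 + (X + ρ) ^ n) * r ^ n) := by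
    gcongr
    nlinarith
  have h10 : a ≤ a * r ^ n := le_mul_of_one_le_right ha h1
  have h11 : b * s ≤ b * ρ * r ^ n := by rw [hr, ← mul_assoc]; gcongr
  have h12 : d * s ^ 2 ≤ d * ρ ^ 2 * r ^ n := by rw [hr, mul_pow, ← mul_assoc]; gcongr
  linarith

theorem exists_setIntegral_norm_sq_small {l : ℕ} {ν : Measure (Euc l)}
    (hν : IntegrableOn (fun z : Euc l => ‖z‖ ^ 2) {z | 0 < ‖z‖ ∧ ‖z‖ ≤ 1} ν) {e : ℝ} (he : 0 < e) :
    ∃ κ₀ ∈ Ioo (0 : ℝ) 1, ∀ κ ∈ Ioo 0 κ₀,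
      ∫ z in {z : Euc l | 0 < ‖z‖ ∧ ‖z‖ < κ}, ‖z‖ ^ 2 ∂ν ≤ e := by
  set s : ℕ → Set (Euc l) := fun n => {z | 0 < ‖z‖ ∧ ‖z‖ ≤ 1 / ((n : ℝ) + 1)} with hs
  have hmeas : ∀ n, MeasurableSet (s n) := fun n =>
    (measurableSet_lt measurable_const measurable_norm).inter
      (measurableSet_le measurable_norm measurable_const)
  have hanti : Antitone s := by
    intro n m hnm z hz
    refine ⟨hz.1, hz.2.trans ?_⟩
    gcongr
  have hs0 : s 0 = {z | 0 < ‖z‖ ∧ ‖z‖ ≤ 1} := by simp [hs]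
  have hlim := tendsto_setIntegral_of_antitone hmeas hanti ⟨0, by rw [hs0]; exact hν⟩
  have hempty : ⋂ n, s n = ∅ := by
    ext z
    simp only [mem_iInter, mem_empty_iff_false, iff_false, not_forall]
    rcases (norm_nonneg z).eq_or_lt with h | h
    · exact ⟨0, fun hz => absurd hz.1 (by rw [← h]; simp)⟩
    · obtain ⟨n, hn⟩ := exists_nat_one_div_lt h
      exact ⟨n, fun hz => absurd hz.2 (not_le.2 hn)⟩
  rw [hempty, setIntegral_empty] at hlim
  obtain ⟨n, hn⟩ := (hlim.eventually (gt_mem_nhds he)).exists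
  refine ⟨1 / ((n : ℝ) + 2), ⟨by positivity, ?_⟩, fun κ hκ => ?_⟩
  · rw [div_lt_one (by positivity)]
    linarith [(Nat.cast_nonneg n : (0 : ℝ) ≤ n)]
  · refine le_trans ?_ hn.le
    refine setIntegral_mono_set (hν.mono_set ?_) (ae_of_all _ fun z => by positivity)
      (Eventually.of_forall ?_)
    · rw [← hs0]; exact hanti (Nat.zero_le n)
    · rintro z ⟨h1, h2⟩
      refine ⟨h1, h2.le.trans (hκ.2.le.trans ?_)⟩
      gcongr
      linarith

/-- A viscosity inequality required of all globally touching test functions passes to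
second-order superjets. -/
theorem viscosity_inequality_of_superjet {N l : ℕ} {T : ℝ}
    {σ : Euc N → ℝ → Matrix (Fin N) (Fin N) ℝ} {a : Euc N → ℝ → Fin N → ℝ}
    {ν : Measure (Euc l)} {η : Euc N → ℝ → Euc l → Euc N} {B : ℝ}
    (hη : ∀ x t z, ‖η x t z‖ ≤ B * min ‖z‖ 1)
    (hν : IntegrableOn (fun z : Euc l => ‖z‖ ^ 2) {z | 0 < ‖z‖ ∧ ‖z‖ ≤ 1} ν)
    {u : Euc N → ℝ → ℝ} {c γ : ℝ} (hc : 0 ≤ c) (hγ : 0 ≤ γ)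
    (hu : ∀ x, ∀ t ∈ Icc (0 : ℝ) T, |u x t| ≤ c * (1 + ‖x‖ ^ γ))
    {x₀ : Euc N} {t₀ : ℝ} {P : SpaceTime N}
    {Q : SpaceTime N →L[ℝ] SpaceTime N}
    (hjet : ∀ ε > 0, ∃ ρ > 0, ∀ x, ∀ t ∈ Icc (0 : ℝ) T, ‖st (x - x₀) (t - t₀)‖ < ρ →
      u x t ≤ u x₀ t₀ + inner ℝ P (st (x - x₀) (t - t₀))
        + inner ℝ (Q (st (x - x₀) (t - t₀))) (st (x - x₀) (t - t₀))
        + ε * ‖st (x - x₀) (t - t₀)‖ ^ 2)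
    {R : ℝ} (hR : ∀ φ : Euc N → ℝ → ℝ, IsC12 T φ → φ x₀ t₀ = u x₀ t₀ →
      (∀ x, ∀ t ∈ Ico (0 : ℝ) T, φ x₀ t₀ - u x₀ t₀ ≤ φ x t - u x t) →
      ∀ κ ∈ Ioo (0 : ℝ) 1, R ≤ Hkop σ a ν η κ φ u x₀ t₀) {e : ℝ} (he : 0 < e) :
    ∃ κ₀ ∈ Ioo (0 : ℝ) 1, ∀ κ ∈ Ioo 0 κ₀, R ≤
      2 * ∑ j, inner ℝ (Q (st (WithLp.toLp 2 fun k => σ x₀ t₀ k j) 0))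
          (st (WithLp.toLp 2 fun k => σ x₀ t₀ k j) 0)
        + ∑ k, a x₀ t₀ k * P.fst k + P.snd
        + Ilarge ν η κ u (fun k => P.fst k) x₀ t₀ + e := by
  set S := ∑ j, ‖st (WithLp.toLp 2 fun k => σ x₀ t₀ k j : Euc N) 0‖ ^ 2 with hS
  have hS0 : 0 ≤ S := Finset.sum_nonneg fun _ _ => by positivity
  set ε := e / (4 * (S + 1)) with hε
  have hεp : 0 < ε := by positivity
  obtain ⟨ρ, hρ, hloc⟩ := hjet ε hεp
  set Q' : SpaceTime N →L[ℝ] SpaceTime N := Q + ε • ContinuousLinearMap.id ℝ _ with hQ'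
  have hQ'i : ∀ ζ, inner ℝ (Q' ζ) ζ = inner ℝ (Q ζ) ζ + ε * ‖ζ‖ ^ 2 := by
    intro ζ
    rw [hQ', add_apply, inner_add_left, smul_apply, ContinuousLinearMap.id_apply,
      real_inner_smul_left, real_inner_self_eq_norm_sq]
  obtain ⟨m, C, hC, hdom⟩ := exists_const_mul_pow_dominates c γ ‖x₀‖ ρ |u x₀ t₀| ‖P‖ ‖Q'‖ hc
    (norm_nonneg _) hγ hρ (abs_nonneg _) (norm_nonneg _) (norm_nonneg _)
  have hQn : ∀ ζ, |inner ℝ (Q' ζ) ζ| ≤ ‖Q'‖ * ‖ζ‖ ^ 2 := by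
    intro ζ
    refine (abs_real_inner_le_norm _ _).trans ?_
    have := Q'.le_opNorm ζ
    nlinarith [norm_nonneg ζ]
  set φ := jetTest x₀ t₀ (u x₀ t₀) P Q' C m with hφ
  have hφ0 : φ x₀ t₀ = u x₀ t₀ := by
    have h0 : st (0 : Euc N) (0 : ℝ) = 0 := rfl
    rw [hφ, jetTest, sub_self, sub_self, h0, jetPoly]
    simp
  have htouch : ∀ x, ∀ t ∈ Ico (0 : ℝ) T, φ x₀ t₀ - u x₀ t₀ ≤ φ x t - u x t := by
    intro x t ht
    rw [hφ0, sub_self, sub_nonneg]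
    simp only [hφ, jetTest, jetPoly]
    set ζ := st (x - x₀) (t - t₀) with hζ
    rcases lt_or_ge ‖ζ‖ ρ with h | h
    · have h1 := hloc x t ⟨ht.1, ht.2.le⟩ h
      have : 0 ≤ C * (‖ζ‖ ^ 2) ^ (m + 2) := by positivity
      rw [hQ'i]
      linarith
    · have h1 := hdom ‖ζ‖ h
      have h2 := (abs_le.1 (hu x t ⟨ht.1, ht.2.le⟩)).2
      have h3 := (abs_le.1 (abs_real_inner_le_norm P ζ)).1
      have h4 := (abs_le.1 (hQn ζ)).1
      have h5 := neg_abs_le (u x₀ t₀)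
      have h6 : ‖x‖ ≤ ‖x₀‖ + ‖ζ‖ := by
        have h7 : ‖x - x₀‖ ≤ ‖ζ‖ := norm_fst_le_norm_st ζ
        have h8 := norm_add_le x₀ (x - x₀)
        rw [add_sub_cancel] at h8
        linarith
      have h9 : c * (1 + ‖x‖ ^ γ) ≤ c * (1 + (‖x₀‖ + ‖ζ‖) ^ γ) := by gcongr
      linarith
  set C' := ‖Q'‖ * B ^ 2 + C * (B ^ 2) ^ (m + 2) with hC'
  have hC'0 : 0 ≤ C' := by positivity
  obtain ⟨κ₀, hκ₀, hsmall⟩ := exists_setIntegral_norm_sq_small hν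
    (show 0 < e / (2 * (C' + 1)) by positivity)
  refine ⟨κ₀, hκ₀, fun κ hκ => ?_⟩
  have hκ1 : κ < 1 := hκ.2.trans hκ₀.2
  have hmain := hR φ (isC12_jetTest _ _ _ _ _ _ _ T) hφ0 htouch κ ⟨hκ.1, hκ1⟩
  have hpd : pd1 φ x₀ t₀ = fun k => P.fst k := funext fun k => pd1_jetTest_self _ _ _ _ _ _ _ k
  rw [Hkop, hφ, Lop_jetTest, ← hφ, hpd] at hmain
  have hIs : Ismall ν η κ φ (fun k => P.fst k) x₀ t₀ ≤ e / 2 := by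
    have hK : ∀ z : Euc l, ‖z‖ ≤ 1 → |Kker η x₀ t₀ z φ (fun k => P.fst k)| ≤ C' * ‖z‖ ^ 2 := by
      intro z hz
      have h1 : ‖η x₀ t₀ z‖ ≤ B * ‖z‖ := by
        have := hη x₀ t₀ z
        rwa [min_eq_left hz] at this
      have h2 : inner ℝ P (st (η x₀ t₀ z) 0) = ∑ k, η x₀ t₀ z k * P.fst k := by
        rw [inner_eq_fst_snd, st_fst, st_snd, mul_zero, add_zero, PiLp.inner_apply]
        simp
      have h3 : Kker η x₀ t₀ z φ (fun k => P.fst k) =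
          inner ℝ (Q' (st (η x₀ t₀ z) 0)) (st (η x₀ t₀ z) 0)
            + C * (‖η x₀ t₀ z‖ ^ 2) ^ (m + 2) := by
        rw [Kker, if_pos hz, hφ0]
        simp only [hφ, jetTest, jetPoly]
        rw [add_sub_cancel_left, add_sub_cancel_left, sub_self, norm_st_zero, h2]
        ring
      rw [h3]
      have h4 := hQn (st (η x₀ t₀ z) 0)
      rw [norm_st_zero] at h4
      have h5 : ‖η x₀ t₀ z‖ ^ 2 ≤ B ^ 2 * ‖z‖ ^ 2 := by rw [← mul_pow]; gcongr
      have h6 : (‖η x₀ t₀ z‖ ^ 2) ^ (m + 2) ≤ (B ^ 2) ^ (m + 2) * ‖z‖ ^ 2 := by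
        calc (‖η x₀ t₀ z‖ ^ 2) ^ (m + 2) ≤ (B ^ 2 * ‖z‖ ^ 2) ^ (m + 2) := by gcongr
          _ = (B ^ 2) ^ (m + 2) * (‖z‖ ^ 2) ^ (m + 2) := mul_pow _ _ _
          _ ≤ (B ^ 2) ^ (m + 2) * ‖z‖ ^ 2 := by
            gcongr
            exact pow_le_of_le_one (by positivity) (pow_le_one₀ (norm_nonneg z) hz) (by omega)
      have h7 : |C * (‖η x₀ t₀ z‖ ^ 2) ^ (m + 2)| ≤ C * ((B ^ 2) ^ (m + 2) * ‖z‖ ^ 2) := by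
        rw [abs_of_nonneg (by positivity)]
        gcongr
      have h8 := mul_le_mul_of_nonneg_left h5 (norm_nonneg Q')
      refine (abs_add_le _ _).trans ?_
      rw [hC']
      linarith
    have hmeas : MeasurableSet {z : Euc l | 0 < ‖z‖ ∧ ‖z‖ < κ} :=
      (measurableSet_lt measurable_const measurable_norm).inter
        (measurableSet_lt measurable_norm measurable_const)
    have hint : IntegrableOn (fun z : Euc l => C' * ‖z‖ ^ 2) {z | 0 < ‖z‖ ∧ ‖z‖ < κ} ν :=
      (hν.mono_set fun z hz => ⟨hz.1, (hz.2.trans hκ1).le⟩).const_mul C'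
    have h1 : ‖Ismall ν η κ φ (fun k => P.fst k) x₀ t₀‖ ≤
        ∫ z in {z : Euc l | 0 < ‖z‖ ∧ ‖z‖ < κ}, C' * ‖z‖ ^ 2 ∂ν := by
      refine norm_integral_le_of_norm_le hint ?_
      refine (ae_restrict_iff' hmeas).2 (ae_of_all _ fun z hz => ?_)
      exact hK z (hz.2.trans hκ1).le
    rw [integral_const_mul] at h1
    have h2 := mul_le_mul_of_nonneg_left (hsmall κ hκ) hC'0
    have h3 : C' * (e / (2 * (C' + 1))) ≤ e / 2 := by
      rw [mul_div_assoc', div_le_div_iff₀ (by positivity) (by positivity)]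
      nlinarith
    exact (le_abs_self _).trans (h1.trans (h2.trans h3))
  have hsum : 2 * ∑ j, inner ℝ (Q' (st (WithLp.toLp 2 fun k => σ x₀ t₀ k j) 0))
          (st (WithLp.toLp 2 fun k => σ x₀ t₀ k j) 0) ≤
      2 * ∑ j, inner ℝ (Q (st (WithLp.toLp 2 fun k => σ x₀ t₀ k j) 0))
          (st (WithLp.toLp 2 fun k => σ x₀ t₀ k j) 0) + e / 2 := by
    simp only [hQ'i]
    rw [Finset.sum_add_distrib, ← Finset.mul_sum, ← hS]
    have : ε * S ≤ e / 4 := by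
      rw [hε, div_mul_eq_mul_div, div_le_div_iff₀ (by positivity) (by positivity)]
      nlinarith
    linarith
  linarith

theorem exists_one_add_pow_le (n : ℕ) (R : ℝ) : ∃ C : ℝ, 0 ≤ C ∧ ∀ r : ℝ, 0 ≤ 1 + r → r ≤ R →
    (1 + r) ^ (n + 1) ≤ 1 + (n + 1) * r + C * r ^ 2 := by
  induction n with
  | zero => exact ⟨0, le_rfl, fun r _ _ => by simp⟩
  | succ n ih =>
    obtain ⟨C, hC, h⟩ := ih
    refine ⟨n + 1 + C * (1 + |R|), by positivity, fun r hr hR => ?_⟩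
    have h1 := mul_le_mul_of_nonneg_right (h r hr hR) hr
    have h2 : C * r ^ 2 * (1 + r) ≤ C * r ^ 2 * (1 + |R|) := by
      gcongr
      exact hR.trans (le_abs_self R)
    rw [pow_succ]
    push_cast
    nlinarith

/-- Uniform second-order expansion of `(1 + ‖x‖²)^(n+1)`. -/
theorem exists_one_add_norm_sq_pow_expansion {E : Type*} [NormedAddCommGroup E]
    [InnerProductSpace ℝ E] (n : ℕ) {R : ℝ} (hR : 0 ≤ R) :
    ∃ C : ℝ, 0 ≤ C ∧ ∀ x h : E, ‖h‖ ≤ R →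
      |(1 + ‖x + h‖ ^ 2) ^ (n + 1) - (1 + ‖x‖ ^ 2) ^ (n + 1)
        - 2 * (n + 1) * (1 + ‖x‖ ^ 2) ^ n * inner ℝ x h| ≤ C * (1 + ‖x‖ ^ 2) ^ n * ‖h‖ ^ 2 := by
  obtain ⟨C, hC, hpow⟩ := exists_one_add_pow_le n (R + R ^ 2)
  refine ⟨n + 1 + C * (8 + 2 * R ^ 2), by positivity, fun x h hh => ?_⟩
  set p := 1 + ‖x‖ ^ 2 with hp
  have hp1 : 1 ≤ p := by rw [hp]; nlinarith [norm_nonneg x]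
  have hp0 : 0 < p := by linarith
  set s := 2 * inner ℝ x h + ‖h‖ ^ 2 with hs
  have hph : 1 + ‖x + h‖ ^ 2 = p * (1 + s / p) := by
    rw [norm_add_sq_real, mul_add, mul_div_cancel₀ _ hp0.ne', hs, hp]
    ring
  have hpos : 0 ≤ 1 + s / p := by
    by_contra hcon
    push Not at hcon
    have : 1 + ‖x + h‖ ^ 2 < 0 := by rw [hph]; exact mul_neg_of_pos_of_neg hp0 hcon
    nlinarith [sq_nonneg ‖x + h‖]
  have hin := abs_real_inner_le_norm x h
  have hxh : ‖x‖ * ‖h‖ ≤ ‖x‖ * R := by gcongr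
  have hsle : |s| ≤ ‖h‖ * (2 * ‖x‖ + R) := by
    have h1 : |s| ≤ |2 * inner ℝ x h| + |‖h‖ ^ 2| := abs_add_le _ _
    rw [abs_mul, abs_two, abs_of_nonneg (sq_nonneg ‖h‖)] at h1
    nlinarith [norm_nonneg h]
  have hrR : s / p ≤ R + R ^ 2 := by
    rw [div_le_iff₀ hp0]
    have h1 : ‖h‖ * (2 * ‖x‖ + R) ≤ R * (2 * ‖x‖ + R) := by gcongr
    have h2 := le_abs_self s
    have h3 : 2 * ‖x‖ ≤ p := by rw [hp]; nlinarith [sq_nonneg (‖x‖ - 1)]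
    have h4 : R ^ 2 * 1 ≤ R ^ 2 * p := by gcongr
    have h5 : R * (2 * ‖x‖) ≤ R * p := by gcongr
    nlinarith
  have hup := hpow (s / p) hpos hrR
  have hlow : 1 + ((n + 1 : ℕ) : ℝ) * (s / p) ≤ (1 + s / p) ^ (n + 1) :=
    one_add_mul_le_pow (by linarith) _
  push_cast at hlow
  have hr2 : p ^ (n + 1) * (s / p) ^ 2 ≤ (8 + 2 * R ^ 2) * p ^ n * ‖h‖ ^ 2 := by
    have h1 : s ^ 2 ≤ ‖h‖ ^ 2 * ((8 + 2 * R ^ 2) * p) := by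
      have h2 : s ^ 2 ≤ (‖h‖ * (2 * ‖x‖ + R)) ^ 2 := sq_le_sq' (by
        have := neg_abs_le s; linarith) ((le_abs_self s).trans hsle)
      rw [mul_pow] at h2
      refine h2.trans ?_
      gcongr
      rw [hp]
      nlinarith [sq_nonneg (2 * ‖x‖ - R), sq_nonneg (R * ‖x‖)]
    have h3 : p ^ (n + 1) * (s / p) ^ 2 = p ^ n * (s ^ 2 / p) := by
      rw [pow_succ]; field_simp
    rw [h3]
    have h4 : s ^ 2 / p ≤ ‖h‖ ^ 2 * (8 + 2 * R ^ 2) := by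
      rw [div_le_iff₀ hp0]; linarith
    have h5 := mul_le_mul_of_nonneg_left h4 (pow_pos hp0 n).le
    linarith
  have hlin : p ^ (n + 1) * ((n + 1) * (s / p)) = (n + 1) * p ^ n * s := by
    rw [pow_succ]; field_simp
  have hpn : 0 < p ^ (n + 1) := pow_pos hp0 _
  rw [hph, mul_pow]
  have h1 := mul_le_mul_of_nonneg_left hup hpn.le
  have h2 := mul_le_mul_of_nonneg_left hlow hpn.le
  have h3 := mul_le_mul_of_nonneg_left hr2 hC
  have h4 : 0 ≤ (n + 1) * p ^ n * ‖h‖ ^ 2 := by positivity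
  have h5 : (n + 1) * p ^ n * s =
      2 * (n + 1) * p ^ n * inner ℝ x h + (n + 1) * p ^ n * ‖h‖ ^ 2 := by
    rw [hs]; ring
  have h6 : 0 ≤ C * ((8 + 2 * R ^ 2) * p ^ n * ‖h‖ ^ 2) := by positivity
  rw [abs_le]
  constructor
  · linarith
  · linarith

/-- The penalty function used to localize the comparison argument. -/
noncomputable def penalty {N : ℕ} (T lam θ C k : ℝ) (n : ℕ) (x : Euc N) (t : ℝ) : ℝ :=
  θ * Real.exp (lam * (T - t)) * (1 + ‖x‖ ^ 2) ^ (n + 1) + C * Real.exp (-(k * t))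

theorem continuous_penalty {N : ℕ} (T lam θ C k : ℝ) (n : ℕ) :
    Continuous fun p : Euc N × ℝ => penalty T lam θ C k n p.1 p.2 := by
  unfold penalty
  fun_prop

set_option maxHeartbeats 1000000 in
/-- For `lam` large the penalty is a strict supersolution, expressed through its first-order
expansion and a quadratic upper bound. -/
theorem exists_penalty_strict_supersolution {N : ℕ} {T B b₀ ν₁ K₁ K₂ : ℝ} (n : ℕ) (hB : 0 < B)
    (hb₀ : 0 ≤ b₀) (hν₁ : 0 ≤ ν₁) (hK₁ : 0 ≤ K₁) (hK₂ : 0 ≤ K₂)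
    {S : Euc N → ℝ → ℝ} {a : Euc N → ℝ → Fin N → ℝ}
    (hS : ∀ x, ∀ t ∈ Icc (0 : ℝ) T, S x t ≤ K₁ * (1 + ‖x‖ ^ 2))
    (ha : ∀ x, ∀ t ∈ Icc (0 : ℝ) T, ∀ v : Euc N,
      ∑ k, a x t k * v k ≤ K₂ * (1 + ‖x‖) * ‖v‖) :
    ∃ lam : ℝ, 0 ≤ lam ∧ ∀ θ C k : ℝ, 0 < θ → 0 < C → 0 < k →
      ∃ (Df : Euc N → ℝ → Euc N) (ft M : Euc N → ℝ → ℝ),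
        (∀ x t, 0 ≤ M x t) ∧
        (∀ x t h, ‖h‖ ≤ B → penalty T lam θ C k n (x + h) t ≤
          penalty T lam θ C k n x t + inner ℝ (Df x t) h + M x t * ‖h‖ ^ 2) ∧
        (∀ x t, ∃ M' : ℝ, ∃ ρ > 0, ∀ h τ, ‖h‖ < ρ → |τ| < ρ →
          penalty T lam θ C k n (x + h) (t + τ) ≤ penalty T lam θ C k n x t
            + inner ℝ (Df x t) h + ft x t * τ + M x t * ‖h‖ ^ 2 + M' * τ ^ 2) ∧
        ∀ x, ∀ t ∈ Icc (0 : ℝ) T, 2 * (M x t * S x t) + ∑ k, a x t k * Df x t k + ft x t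
          + M x t * B ^ 2 * b₀ + B * ‖Df x t‖ * ν₁ ≤ -(k * C * Real.exp (-(k * T))) := by
  obtain ⟨C₁, hC₁, hexp⟩ := exists_one_add_norm_sq_pow_expansion (E := Euc N) n hB.le
  set Cq := C₁ + 1 with hCq
  set lam := 2 * Cq * K₁ + 3 * K₂ * (n + 1) + Cq * B ^ 2 * b₀ + B * (n + 1) * ν₁ with hlam
  have hlam0 : 0 ≤ lam := by positivity
  refine ⟨lam, hlam0, fun θ C k hθ hC hk => ?_⟩
  set E : ℝ → ℝ := fun t => θ * Real.exp (lam * (T - t)) with hE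
  have hEp : ∀ t, 0 < E t := fun t => by simp only [hE]; positivity
  refine ⟨fun x t => (E t * (2 * (n + 1) * (1 + ‖x‖ ^ 2) ^ n)) • x,
    fun x t => -(lam * E t * (1 + ‖x‖ ^ 2) ^ (n + 1)) - k * C * Real.exp (-(k * t)),
    fun x t => E t * (Cq * (1 + ‖x‖ ^ 2) ^ n), fun x t => ?_, fun x t h hh => ?_, fun x t => ?_,
    fun x t ht => ?_⟩
  · have := hEp t
    positivity
  · have h1 := (abs_le.1 (hexp x h hh)).2
    have h2 := mul_le_mul_of_nonneg_left h1 (hEp t).le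
    rw [real_inner_smul_left]
    have h3 : 0 ≤ E t * ((1 + ‖x‖ ^ 2) ^ n * ‖h‖ ^ 2) := by
      have := hEp t
      positivity
    simp only [penalty]
    change E t * _ + _ ≤ E t * _ + _ + _ + _
    rw [hCq]
    linarith
  · set p := 1 + ‖x‖ ^ 2 with hp
    have hp1 : 1 ≤ p := by rw [hp]; nlinarith [norm_nonneg x]
    have hpn : 1 ≤ p ^ n := one_le_pow₀ hp1
    set K := 2 * (n + 1) * p ^ n * ‖x‖ + C₁ * p ^ n * B with hK
    have hK0 : 0 ≤ K := by positivity
    refine ⟨E t * (lam ^ 2 * p ^ (n + 1) + (lam * K) ^ 2) + C * Real.exp (-(k * t)) * k ^ 2,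
      min B (1 / (lam + k + 1)), by positivity, fun h τ hh hτ => ?_⟩
    have hhB : ‖h‖ ≤ B := (hh.trans_le (min_le_left _ _)).le
    have hτ1 : (lam + k + 1) * |τ| ≤ 1 := by
      have := (hτ.trans_le (min_le_right _ _)).le
      rw [le_div_iff₀ (by positivity)] at this
      linarith
    have hτ0 := abs_nonneg τ
    have hlτ : |-(lam * τ)| ≤ 1 := by
      rw [abs_neg, abs_mul, abs_of_nonneg hlam0]; nlinarith
    have hkτ : |-(k * τ)| ≤ 1 := by
      rw [abs_neg, abs_mul, abs_of_pos hk]; nlinarith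
    have e1 := (abs_le.1 (Real.abs_exp_sub_one_sub_id_le hlτ)).2
    have e2 := (abs_le.1 (Real.abs_exp_sub_one_sub_id_le hkτ)).2
    have e3 := Real.abs_exp_sub_one_le hlτ
    rw [abs_neg, abs_mul, abs_of_nonneg hlam0] at e3
    have hx := hexp x h hhB
    rw [← hp] at hx
    have h1 := (abs_le.1 hx).2
    set p' := (1 + ‖x + h‖ ^ 2) ^ (n + 1) with hp'
    have hd : |p' - p ^ (n + 1)| ≤ K * ‖h‖ := by
      have h2 : p' - p ^ (n + 1) = (p' - p ^ (n + 1) - 2 * (n + 1) * p ^ n * inner ℝ x h)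
        + 2 * (n + 1) * p ^ n * inner ℝ x h := by ring
      rw [h2]
      refine (abs_add_le _ _).trans ?_
      rw [abs_mul (2 * ((n : ℝ) + 1) * p ^ n),
        abs_of_nonneg (by positivity : 0 ≤ 2 * ((n : ℝ) + 1) * p ^ n)]
      have h3 := mul_le_mul_of_nonneg_left (abs_real_inner_le_norm x h)
        (by positivity : 0 ≤ 2 * ((n : ℝ) + 1) * p ^ n)
      have h4 : C₁ * p ^ n * ‖h‖ ^ 2 ≤ C₁ * p ^ n * (B * ‖h‖) := by
        rw [pow_two]; gcongr
      rw [hK]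
      linarith
    obtain ⟨e, he⟩ : ∃ e, e = Real.exp (-(lam * τ)) - 1 := ⟨_, rfl⟩
    have h5 : e * (p' - p ^ (n + 1)) ≤ p ^ n * ‖h‖ ^ 2 + (lam * K) ^ 2 * τ ^ 2 := by
      have h6 : e * (p' - p ^ (n + 1)) ≤ 2 * (lam * |τ|) * (K * ‖h‖) := by
        refine (le_abs_self _).trans ?_
        rw [abs_mul, he]
        exact mul_le_mul e3 hd (abs_nonneg _) (by positivity)
      have h7 : ‖h‖ ^ 2 ≤ p ^ n * ‖h‖ ^ 2 := le_mul_of_one_le_left (by positivity) hpn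
      have h8 : 2 * (lam * |τ|) * (K * ‖h‖) ≤ ‖h‖ ^ 2 + (lam * K) ^ 2 * τ ^ 2 := by
        rw [← sq_abs τ]
        linarith [sq_nonneg (‖h‖ - lam * K * |τ|)]
      exact h6.trans (h8.trans (add_le_add_left h7 _))
    have h10 : e * p ^ (n + 1) ≤ (-(lam * τ) + lam ^ 2 * τ ^ 2) * p ^ (n + 1) :=
      mul_le_mul_of_nonneg_right (by rw [he]; linarith) (by positivity)
    have h11 : Real.exp (-(lam * τ)) * p' ≤ p ^ (n + 1) + 2 * (n + 1) * p ^ n * inner ℝ x h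
        + Cq * p ^ n * ‖h‖ ^ 2 - lam * τ * p ^ (n + 1)
        + (lam ^ 2 * p ^ (n + 1) + (lam * K) ^ 2) * τ ^ 2 := by
      have : Real.exp (-(lam * τ)) * p' = p' + e * p ^ (n + 1) + e * (p' - p ^ (n + 1)) := by
        rw [he]; ring
      rw [this, hCq]
      linarith
    have h12 := mul_le_mul_of_nonneg_left h11 (hEp t).le
    have h13 : Real.exp (-(k * τ)) ≤ 1 - k * τ + k ^ 2 * τ ^ 2 := by linarith
    have h14 := mul_le_mul_of_nonneg_left h13
      (by positivity : 0 ≤ C * Real.exp (-(k * t)))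
    have h15 : penalty T lam θ C k n (x + h) (t + τ) =
        E t * (Real.exp (-(lam * τ)) * p') + C * Real.exp (-(k * t)) * Real.exp (-(k * τ)) := by
      simp only [penalty, hE, hp']
      rw [show lam * (T - (t + τ)) = lam * (T - t) + -(lam * τ) by ring,
        show -(k * (t + τ)) = -(k * t) + -(k * τ) by ring, Real.exp_add, Real.exp_add]
      ring
    have h16 : penalty T lam θ C k n x t = E t * p ^ (n + 1) + C * Real.exp (-(k * t)) := rfl
    rw [h15, h16, real_inner_smul_left]
    linarith
  · set p := 1 + ‖x‖ ^ 2 with hp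
    have hp0 : 0 < p := by positivity
    set G := E t * (n + 1) * p ^ n with hG
    have hG0 : 0 ≤ G := by have := hEp t; positivity
    have hE0 := hEp t
    have hx0 := norm_nonneg x
    have hDf : ‖(E t * (2 * (n + 1) * p ^ n)) • x‖ = G * (2 * ‖x‖) := by
      rw [norm_smul, Real.norm_of_nonneg (by positivity), hG]; ring
    have h1 := ha x t ht ((E t * (2 * (n + 1) * p ^ n)) • x)
    have h2 : K₂ * (1 + ‖x‖) * ‖(E t * (2 * (n + 1) * p ^ n)) • x‖ ≤ K₂ * G * (3 * p) := by
      rw [hDf]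
      have : (1 + ‖x‖) * (2 * ‖x‖) ≤ 3 * p := by
        rw [hp]; nlinarith [sq_nonneg (‖x‖ - 1)]
      have := mul_le_mul_of_nonneg_left this (mul_nonneg hK₂ hG0)
      linarith
    have h3 : B * ‖(E t * (2 * (n + 1) * p ^ n)) • x‖ * ν₁ ≤ B * (G * p) * ν₁ := by
      rw [hDf]
      gcongr
      rw [hp]; nlinarith [sq_nonneg (‖x‖ - 1)]
    have h4 : E t * (Cq * p ^ n) * S x t ≤ E t * (Cq * p ^ n) * (K₁ * p) := by
      gcongr
      exact hS x t ht
    have h5 : E t * (Cq * p ^ n) * B ^ 2 * b₀ ≤ E t * (Cq * p ^ n) * B ^ 2 * b₀ * p := by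
      refine le_mul_of_one_le_right (by positivity) ?_
      rw [hp]; nlinarith
    have h6 : k * C * Real.exp (-(k * T)) ≤ k * C * Real.exp (-(k * t)) := by
      gcongr
      exact ht.2
    have h7 : lam * E t * p ^ (n + 1) = 2 * (E t * (Cq * p ^ n) * (K₁ * p)) + K₂ * G * (3 * p)
        + E t * (Cq * p ^ n) * B ^ 2 * b₀ * p + B * (G * p) * ν₁ := by
      rw [hlam, hG]; ring
    linarith

/-- The `j`-th column of the diffusion matrix. -/
noncomputable def diffusionColumn {N : ℕ} (σ : Euc N → ℝ → Matrix (Fin N) (Fin N) ℝ)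
    (x : Euc N) (t : ℝ) (j : Fin N) : Euc N := WithLp.toLp 2 fun k => σ x t k j

/-- The drift as a Euclidean vector. -/
noncomputable def driftVector {N : ℕ} (a : Euc N → ℝ → Fin N → ℝ) (x : Euc N) (t : ℝ) : Euc N :=
  WithLp.toLp 2 (a x t)

/-- The structural assumptions on the operator, rephrased with Euclidean norms. -/
structure OperatorBounds {N l : ℕ} (T : ℝ) (σ : Euc N → ℝ → Matrix (Fin N) (Fin N) ℝ)
    (a : Euc N → ℝ → Fin N → ℝ) (ν : Measure (Euc l)) (η : Euc N → ℝ → Euc l → Euc N)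
    (B K : ℝ) : Prop where
  B_pos : 0 < B
  K_nonneg : 0 ≤ K
  jump_le : ∀ x t z, ‖η x t z‖ ≤ B * min ‖z‖ 1
  jump_lip : ∀ x y t z, ‖η x t z - η y t z‖ ≤ B * min ‖z‖ 1 * ‖x - y‖
  jump_cont : ∀ z, Continuous (fun p : Euc N × ℝ => η p.1 p.2 z)
  jump_meas : ∀ x t, Measurable (fun z => η x t z)
  levy : Integrable (fun z : Euc l => (min ‖z‖ 1) ^ 2) ν
  drift_le : ∀ x, ∀ t ∈ Icc (0 : ℝ) T, ‖driftVector a x t‖ ≤ K * (1 + ‖x‖)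
  drift_lip : ∀ x y, ∀ t ∈ Icc (0 : ℝ) T, ∀ s ∈ Icc (0 : ℝ) T,
    ‖driftVector a x t - driftVector a y s‖ ≤ K * ‖x - y‖
  diffusion_le : ∀ x, ∀ t ∈ Icc (0 : ℝ) T,
    ∑ j, ‖diffusionColumn σ x t j‖ ^ 2 ≤ K * (1 + ‖x‖ ^ 2)
  diffusion_lip : ∀ x y, ∀ t ∈ Icc (0 : ℝ) T, ∀ s ∈ Icc (0 : ℝ) T,
    ∑ j, ‖diffusionColumn σ x t j - diffusionColumn σ y s j‖ ^ 2 ≤ K * ‖x - y‖ ^ 2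

theorem norm_le_card_mul_of_abs_le {N : ℕ} {v : Euc N} {m : ℝ} (h : ∀ k, |v k| ≤ m) :
    ‖v‖ ≤ N * m := by
  rcases Nat.eq_zero_or_pos N with rfl | hN
  · simp [Subsingleton.elim v 0]
  have hm : 0 ≤ m := (abs_nonneg _).trans (h ⟨0, hN⟩)
  have hN1 : (1 : ℝ) ≤ N := by exact_mod_cast hN
  refine abs_le_of_sq_le_sq' ?_ (by positivity) |>.2
  rw [EuclideanSpace.real_norm_sq_eq]
  calc ∑ k, v k ^ 2 ≤ ∑ _k : Fin N, m ^ 2 :=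
        Finset.sum_le_sum fun k _ => sq_le_sq' (abs_le.1 (h k)).1 (abs_le.1 (h k)).2
    _ = N * m ^ 2 := by simp
    _ ≤ N * (N * m ^ 2) := le_mul_of_one_le_left (by positivity) hN1
    _ = (N * m) ^ 2 := by ring

theorem OperatorAssumptions.exists_bounds {N l : ℕ} {T : ℝ}
    {σ : Euc N → ℝ → Matrix (Fin N) (Fin N) ℝ} {a : Euc N → ℝ → Fin N → ℝ}
    {ν : Measure (Euc l)} {η : Euc N → ℝ → Euc l → Euc N}
    (hop : OperatorAssumptions N l T σ a ν η) : ∃ B K : ℝ, OperatorBounds T σ a ν η B K := by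
  obtain ⟨A, hA, hco⟩ := hop.coeff
  obtain ⟨B, hB, hη⟩ := hop.eta_bound
  obtain ⟨Λ₀, At, hΛ, -, hν1, hν2, -⟩ := hop.levy
  have hN : (1 : ℝ) ≤ N := by exact_mod_cast hop.dimN
  have hsum : ∀ (v : Fin N → Euc N) (m : ℝ), (∀ j k, |v j k| ≤ A * m) →
      ∑ j, ‖v j‖ ^ 2 ≤ N ^ 3 * A ^ 2 * m ^ 2 := fun v m h => by
    calc ∑ j, ‖v j‖ ^ 2 ≤ ∑ _j : Fin N, (N * (A * m)) ^ 2 := by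
          gcongr with j
          exact norm_le_card_mul_of_abs_le (h j)
      _ = N ^ 3 * A ^ 2 * m ^ 2 := by simp; ring
  refine ⟨N * B, N * A + 2 * (N ^ 3 * A ^ 2), by positivity, by positivity, fun x t z => ?_,
    fun x y t z => ?_, hop.eta_cont, hop.eta_meas, ?_, fun x t ht => ?_, fun x y t ht s hs => ?_,
    fun x t ht => ?_, fun x y t ht s hs => ?_⟩
  · rw [mul_assoc]
    exact norm_le_card_mul_of_abs_le fun k => (hη x x t z k).1
  · rw [mul_assoc, mul_assoc, ← mul_assoc B]
    exact norm_le_card_mul_of_abs_le fun k => (hη x y t z k).2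
  · have hm : Measurable fun z : Euc l => (min ‖z‖ 1) ^ 2 := by fun_prop
    have h1 : IntegrableOn (fun z : Euc l => (min ‖z‖ 1) ^ 2) {z | 0 < ‖z‖ ∧ ‖z‖ ≤ 1} ν := by
      refine hν1.mono' hm.aestronglyMeasurable (ae_of_all _ fun z => ?_)
      rw [Real.norm_of_nonneg (by positivity)]
      gcongr
      exact min_le_left _ _
    have h2 : IntegrableOn (fun z : Euc l => (min ‖z‖ 1) ^ 2) {z | 1 < ‖z‖} ν := by
      refine hν2.mono' hm.aestronglyMeasurable (ae_of_all _ fun z => ?_)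
      rw [Real.norm_of_nonneg (by positivity)]
      refine le_trans ?_ (Real.one_le_exp (by positivity : 0 ≤ Λ₀ * ‖z‖))
      exact pow_le_one₀ (le_min (norm_nonneg _) zero_le_one) (min_le_right _ _)
    have h3 : IntegrableOn (fun z : Euc l => (min ‖z‖ 1) ^ 2) {0} ν :=
      IntegrableOn.of_measure_zero hop.levy_null
    refine integrableOn_univ.1 (((h3.union h1).union h2).mono_set fun z _ => ?_)
    rcases eq_or_ne z 0 with rfl | hz
    · exact Or.inl (Or.inl rfl)
    · rcases le_or_gt ‖z‖ 1 with h | h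
      · exact Or.inl (Or.inr ⟨norm_pos_iff.2 hz, h⟩)
      · exact Or.inr h
  · have : ‖driftVector a x t‖ ≤ N * (A * (1 + ‖x‖)) := norm_le_card_mul_of_abs_le fun k => by
      have := (hco x x t t ht ht k k).2
      have h0 := abs_nonneg (σ x t k k)
      change |a x t k| ≤ _
      linarith
    have h1 : 0 ≤ 2 * ((N : ℝ) ^ 3 * A ^ 2) * (1 + ‖x‖) := by positivity
    linarith
  · have : ‖driftVector a x t - driftVector a y s‖ ≤ N * (A * ‖x - y‖) :=
      norm_le_card_mul_of_abs_le fun k => by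
        have := (hco x y t s ht hs k k).1
        have h0 := abs_nonneg (σ x t k k - σ y s k k)
        change |a x t k - a y s k| ≤ _
        linarith
    have h1 : 0 ≤ 2 * ((N : ℝ) ^ 3 * A ^ 2) * ‖x - y‖ := by positivity
    linarith
  · have := hsum (diffusionColumn σ x t) (1 + ‖x‖) fun j k => by
      have := (hco x x t t ht ht k j).2
      have h0 := abs_nonneg (a x t k)
      change |σ x t k j| ≤ _
      linarith
    have h1 : 0 ≤ (N : ℝ) * A * (1 + ‖x‖ ^ 2) := by positivity
    have h2 : (N : ℝ) ^ 3 * A ^ 2 * (1 + ‖x‖) ^ 2 ≤ N ^ 3 * A ^ 2 * (2 * (1 + ‖x‖ ^ 2)) := by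
      gcongr
      nlinarith [sq_nonneg (‖x‖ - 1)]
    linarith
  · have := hsum (fun j => diffusionColumn σ x t j - diffusionColumn σ y s j) ‖x - y‖ fun j k => by
      have := (hco x y t s ht hs k j).1
      have h0 := abs_nonneg (a x t k - a y s k)
      change |σ x t k j - σ y s k j| ≤ _
      linarith
    have h1 : 0 ≤ (N : ℝ) * A * ‖x - y‖ ^ 2 := by positivity
    have h2 : 0 ≤ (N : ℝ) ^ 3 * A ^ 2 * ‖x - y‖ ^ 2 := by positivity
    linarith

namespace OperatorBounds

variable {N l : ℕ} {T B K : ℝ} {σ : Euc N → ℝ → Matrix (Fin N) (Fin N) ℝ}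
  {a : Euc N → ℝ → Fin N → ℝ} {ν : Measure (Euc l)} {η : Euc N → ℝ → Euc l → Euc N}

theorem jump_le_const (h : OperatorBounds T σ a ν η B K) (x : Euc N) (t : ℝ) (z : Euc l) :
    ‖η x t z‖ ≤ B :=
  (h.jump_le x t z).trans (mul_le_of_le_one_right h.B_pos.le (min_le_right _ _))

theorem integrableOn_norm_sq (h : OperatorBounds T σ a ν η B K) :
    IntegrableOn (fun z : Euc l => ‖z‖ ^ 2) {z | 0 < ‖z‖ ∧ ‖z‖ ≤ 1} ν := by
  refine (h.levy.integrableOn (s := {z | 0 < ‖z‖ ∧ ‖z‖ ≤ 1})).congr_fun (fun z hz => ?_) ?_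
  · simp only [min_eq_left hz.2]
  · measurability

theorem measure_norm_ge_lt_top (h : OperatorBounds T σ a ν η B K) {κ : ℝ} (hκ : 0 < κ) :
    ν {z | κ ≤ ‖z‖} < ⊤ := by
  have h1 := h.levy.measure_norm_ge_lt_top (ε := (min κ 1) ^ 2) (by positivity)
  refine (measure_mono fun z (hz : κ ≤ ‖z‖) => ?_).trans_lt h1
  change _ ≤ ‖(min ‖z‖ 1) ^ 2‖
  rw [Real.norm_of_nonneg (by positivity)]
  gcongr

theorem measure_norm_gt_one_lt_top (h : OperatorBounds T σ a ν η B K) :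
    ν {z | 1 < ‖z‖} < ⊤ := by
  refine (measure_mono fun z hz => ?_).trans_lt (h.measure_norm_ge_lt_top one_pos)
  exact (show 1 < ‖z‖ from hz).le

theorem jump_sq_le (h : OperatorBounds T σ a ν η B K) (x : Euc N) (t : ℝ) (z : Euc l) :
    ‖η x t z‖ ^ 2 ≤ B ^ 2 * (min ‖z‖ 1) ^ 2 := by
  rw [← mul_pow]
  exact pow_le_pow_left₀ (norm_nonneg _) (h.jump_le x t z) 2

theorem jump_sub_sq_le (h : OperatorBounds T σ a ν η B K) (x y : Euc N) (t s : ℝ) (z : Euc l) :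
    ‖η x t z - η y s z‖ ^ 2 ≤ 4 * B ^ 2 * (min ‖z‖ 1) ^ 2 := by
  have h1 := norm_sub_le (η x t z) (η y s z)
  have h2 := h.jump_le x t z
  have h3 := h.jump_le y s z
  have h4 : ‖η x t z - η y s z‖ ≤ 2 * (B * min ‖z‖ 1) := by linarith
  refine (pow_le_pow_left₀ (norm_nonneg _) h4 2).trans_eq (by ring)

theorem integrable_jump_sub_sq (h : OperatorBounds T σ a ν η B K) (x y : Euc N) (t s : ℝ) :
    Integrable (fun z => ‖η x t z - η y s z‖ ^ 2) ν := by
  refine (h.levy.const_mul (4 * B ^ 2)).mono' ?_ (ae_of_all _ fun z => ?_)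
  · exact (((h.jump_meas x t).sub (h.jump_meas y s)).norm.pow_const 2).aestronglyMeasurable
  · rw [Real.norm_of_nonneg (by positivity)]
    exact h.jump_sub_sq_le x y t s z

/-- The jumps depend continuously on time in `L²(ν)`, locally uniformly in space. -/
theorem exists_integral_jump_sub_sq_le (h : OperatorBounds T σ a ν η B K) (x₀ : Euc N) (R : ℝ)
    {δ : ℝ} (hδ : 0 < δ) :
    ∃ ρ > 0, ∀ y, ‖y - x₀‖ ≤ R → ∀ t ∈ Icc (0 : ℝ) T, ∀ s ∈ Icc (0 : ℝ) T, |t - s| < ρ →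
      ∫ z, ‖η y t z - η y s z‖ ^ 2 ∂ν ≤ δ := by
  set F : Euc N × ℝ × ℝ → ℝ := fun p => ∫ z, ‖η p.1 p.2.1 z - η p.1 p.2.2 z‖ ^ 2 ∂ν with hF
  have hcont : Continuous F := by
    refine continuous_of_dominated (bound := fun z => 4 * B ^ 2 * (min ‖z‖ 1) ^ 2)
      (fun p => (h.integrable_jump_sub_sq _ _ _ _).aestronglyMeasurable)
      (fun p => ae_of_all _ fun z => ?_) (h.levy.const_mul _) (ae_of_all _ fun z => ?_)
    · rw [Real.norm_of_nonneg (by positivity)]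
      exact h.jump_sub_sq_le _ _ _ _ z
    · have h1 : Continuous fun p : Euc N × ℝ × ℝ => η p.1 p.2.1 z :=
        (h.jump_cont z).comp (by fun_prop : Continuous fun p : Euc N × ℝ × ℝ => (p.1, p.2.1))
      have h2 : Continuous fun p : Euc N × ℝ × ℝ => η p.1 p.2.2 z :=
        (h.jump_cont z).comp (by fun_prop : Continuous fun p : Euc N × ℝ × ℝ => (p.1, p.2.2))
      exact (h1.sub h2).norm.pow 2
  have hcpt : IsCompact (Metric.closedBall x₀ R ×ˢ (Icc (0 : ℝ) T ×ˢ Icc (0 : ℝ) T)) :=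
    (isCompact_closedBall _ _).prod (isCompact_Icc.prod isCompact_Icc)
  obtain ⟨ρ, hρ, hu⟩ := Metric.uniformContinuousOn_iff.1
    (hcpt.uniformContinuousOn_of_continuous hcont.continuousOn) δ hδ
  refine ⟨ρ, hρ, fun y hy t ht s hs hts => ?_⟩
  have hy' : y ∈ Metric.closedBall x₀ R := by rwa [mem_closedBall_iff_norm]
  have := hu (y, t, s) ⟨hy', ht, hs⟩ (y, s, s) ⟨hy', hs, hs⟩ (by
    simp only [Prod.dist_eq, dist_self, Real.dist_eq]
    simp [hts])
  have h0 : F (y, s, s) = 0 := by simp [hF]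
  rw [h0, Real.dist_eq, sub_zero] at this
  exact (le_abs_self _).trans this.le

end OperatorBounds

section Negation

variable {N l : ℕ} (σ : Euc N → ℝ → Matrix (Fin N) (Fin N) ℝ)
  (a : Euc N → ℝ → Fin N → ℝ) (ν : Measure (Euc l)) (η : Euc N → ℝ → Euc l → Euc N)

theorem pd1_neg (φ : Euc N → ℝ → ℝ) (x : Euc N) (t : ℝ) (k : Fin N) :
    pd1 (fun x t => -φ x t) x t k = -pd1 φ x t k := by
  simp [pd1, fderiv_fun_neg]

theorem pd2_neg (φ : Euc N → ℝ → ℝ) (x : Euc N) (t : ℝ) (k m : Fin N) :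
    pd2 (fun x t => -φ x t) x t k m = -pd2 φ x t k m := by
  simp [pd2, pd1_neg, fderiv_fun_neg]

theorem Kker_neg (x : Euc N) (t : ℝ) (z : Euc l) (φ : Euc N → ℝ → ℝ) (p : Fin N → ℝ) :
    Kker η x t z (fun x t => -φ x t) (fun k => -p k) = -Kker η x t z φ p := by
  simp only [Kker, mul_neg, Finset.sum_neg_distrib]
  split_ifs <;> ring

theorem Hkop_neg (κ : ℝ) (φ u : Euc N → ℝ → ℝ) (x : Euc N) (t : ℝ) :
    Hkop σ a ν η κ (fun x t => -φ x t) (fun x t => -u x t) x t = -Hkop σ a ν η κ φ u x t := by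
  have h : pd1 (fun x t => -φ x t) x t = fun k => -pd1 φ x t k := funext fun k => pd1_neg φ x t k
  simp only [Hkop, Lop, Ismall, Ilarge, h, Kker_neg, integral_neg, pd2_neg, pdt, deriv.fun_neg,
    mul_neg, Finset.sum_neg_distrib]
  ring

theorem IsC12.neg {T : ℝ} {φ : Euc N → ℝ → ℝ} (h : IsC12 T φ) : IsC12 T fun x t => -φ x t :=
  ⟨fun t ht => (h.1 t ht).neg, fun x t ht => (h.2.1 x t ht).neg, h.2.2.neg⟩

end Negation

theorem sum_mul_eq_inner {N : ℕ} (v w : Euc N) : ∑ k, v k * w k = inner ℝ w v := by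
  simp [PiLp.inner_apply]

namespace OperatorBounds

variable {N l : ℕ} {T B K : ℝ} {σ : Euc N → ℝ → Matrix (Fin N) (Fin N) ℝ}
  {a : Euc N → ℝ → Fin N → ℝ} {ν : Measure (Euc l)} {η : Euc N → ℝ → Euc l → Euc N}

theorem integrableOn_Kker (h : OperatorBounds T σ a ν η B K) {u : Euc N → ℝ → ℝ} {x : Euc N}
    {t C κ : ℝ} (hκ : 0 < κ) (hu : UpperSemicontinuous fun y => u y t)
    (hC : ∀ y, ‖y - x‖ ≤ B → |u y t| ≤ C) (p : Euc N) :
    IntegrableOn (fun z => Kker η x t z u fun k => p k) {z | κ ≤ ‖z‖} ν := by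
  have hmeas : Measurable fun z => Kker η x t z u fun k => p k := by
    have h1 : Measurable fun z => u (x + η x t z) t :=
      hu.measurable.comp ((h.jump_meas x t).const_add x)
    have h2 : Measurable fun z => ∑ k, η x t z k * p k := by
      simp only [sum_mul_eq_inner]
      exact (innerSL ℝ p).continuous.measurable.comp (h.jump_meas x t)
    exact (h1.sub_const _).sub (Measurable.ite (measurableSet_le measurable_norm measurable_const)
      h2 measurable_const)
  have hfin := h.measure_norm_ge_lt_top hκ
  refine (integrableOn_const (C := C + C + ‖p‖ * B) hfin.ne).mono' hmeas.aestronglyMeasurable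
    (ae_of_all _ fun z => ?_)
  have h1 := hC (x + η x t z) (by simpa using h.jump_le_const x t z)
  have h2 := hC x (by simpa using h.B_pos.le)
  have h3 : |if ‖z‖ ≤ 1 then ∑ k, η x t z k * p k else 0| ≤ ‖p‖ * B := by
    split_ifs
    · rw [sum_mul_eq_inner]
      exact (abs_real_inner_le_norm _ _).trans
        (mul_le_mul_of_nonneg_left (h.jump_le_const x t z) (norm_nonneg p))
    · rw [abs_zero]
      exact mul_nonneg (norm_nonneg _) h.B_pos.le
  rw [Real.norm_eq_abs, Kker]
  exact (abs_sub _ _).trans (add_le_add ((abs_sub _ _).trans (add_le_add h1 h2)) h3)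

/-- The nonlocal terms of two jets obtained by doubling variables. -/
theorem Ilarge_add_le (h : OperatorBounds T σ a ν η B K) {u v f : Euc N → ℝ → ℝ}
    {y₁ y₂ : Euc N} {t₁ t₂ C₁ C₂ κ ϑ α M G : ℝ} {p₁ p₂ Df : Euc N}
    (hκ : κ ∈ Ioo (0 : ℝ) 1) (hu : UpperSemicontinuous fun y => u y t₁)
    (hv : UpperSemicontinuous fun y => v y t₂)
    (hC₁ : ∀ y, ‖y - y₁‖ ≤ B → |u y t₁| ≤ C₁) (hC₂ : ∀ y, ‖y - y₂‖ ≤ B → |v y t₂| ≤ C₂)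
    (hϑ : 0 ≤ ϑ) (hα : 0 ≤ α) (hM : 0 ≤ M) (hG : 0 ≤ G)
    (hf : ∀ h, ‖h‖ ≤ B → f (y₁ + h) t₁ ≤ f y₁ t₁ + inner ℝ Df h + M * ‖h‖ ^ 2)
    (hinc : ∀ h k, ‖h‖ ≤ B → ‖k‖ ≤ B →
      u (y₁ + h) t₁ - f (y₁ + h) t₁ + v (y₂ + k) t₂ ≤ u y₁ t₁ - f y₁ t₁ + v y₂ t₂
        + inner ℝ p₁ h + inner ℝ p₂ k + ϑ * ‖h‖ ^ 2 + ϑ * ‖k‖ ^ 2 + α * ‖h - k‖ ^ 2)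
    (hp : ∀ h k, ‖h‖ ≤ B → ‖k‖ ≤ B → inner ℝ p₁ h + inner ℝ p₂ k ≤ G + α * ‖h - k‖ ^ 2) :
    Ilarge ν η κ u (fun k => (p₁ + Df) k) y₁ t₁ + Ilarge ν η κ v (fun k => p₂ k) y₂ t₂ ≤
      (M + 2 * ϑ) * B ^ 2 * (∫ z, (min ‖z‖ 1) ^ 2 ∂ν)
        + 2 * α * (∫ z, ‖η y₁ t₁ z - η y₂ t₂ z‖ ^ 2 ∂ν)
        + (B * ‖Df‖ + G) * ν.real {z | 1 < ‖z‖} := by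
  have hi₁ := h.integrableOn_Kker hκ.1 hu hC₁ (p₁ + Df)
  have hi₂ := h.integrableOn_Kker hκ.1 hv hC₂ p₂
  have hB := h.B_pos
  have hset : MeasurableSet {z : Euc l | 1 < ‖z‖} :=
    measurableSet_lt measurable_const measurable_norm
  have hI₁ := h.levy.const_mul ((M + 2 * ϑ) * B ^ 2)
  have hI₂ := (h.integrable_jump_sub_sq y₁ y₂ t₁ t₂).const_mul (2 * α)
  have hI₃ : Integrable ({z : Euc l | 1 < ‖z‖}.indicator fun _ => B * ‖Df‖ + G) ν :=
    (integrableOn_const h.measure_norm_gt_one_lt_top.ne).integrable_indicator hset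
  have hnn : ∀ z, 0 ≤ {z : Euc l | 1 < ‖z‖}.indicator (fun _ => B * ‖Df‖ + G) z :=
    indicator_nonneg fun _ _ => by positivity
  rw [Ilarge, Ilarge, ← integral_add hi₁ hi₂]
  calc _ ≤ ∫ z in {z | κ ≤ ‖z‖}, ((M + 2 * ϑ) * B ^ 2 * (min ‖z‖ 1) ^ 2
          + 2 * α * ‖η y₁ t₁ z - η y₂ t₂ z‖ ^ 2
          + {z : Euc l | 1 < ‖z‖}.indicator (fun _ => B * ‖Df‖ + G) z) ∂ν := by
        refine integral_mono (hi₁.add hi₂) ((hI₁.add hI₂).add hI₃).integrableOn fun z => ?_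
        have b₁ := h.jump_le_const y₁ t₁ z
        have b₂ := h.jump_le_const y₂ t₂ z
        have e₁ := hf _ b₁
        have e₂ := hinc _ _ b₁ b₂
        have e₃ := hp _ _ b₁ b₂
        have s₁ := mul_le_mul_of_nonneg_left (h.jump_sq_le y₁ t₁ z) (add_nonneg hM hϑ)
        have s₂ := mul_le_mul_of_nonneg_left (h.jump_sq_le y₂ t₂ z) hϑ
        have s₃ := mul_nonneg hα (sq_nonneg ‖η y₁ t₁ z - η y₂ t₂ z‖)
        simp only [Kker, sum_mul_eq_inner, inner_add_left]
        by_cases hz : ‖z‖ ≤ 1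
        · rw [if_pos hz, if_pos hz, indicator_of_notMem (by simpa using hz)]
          linarith
        · rw [if_neg hz, if_neg hz, indicator_of_mem (by simpa using hz)]
          have e₄ : inner ℝ Df (η y₁ t₁ z) ≤ B * ‖Df‖ := by
            refine (real_inner_le_norm _ _).trans ?_
            rw [mul_comm]
            gcongr
          linarith
    _ ≤ ∫ z, ((M + 2 * ϑ) * B ^ 2 * (min ‖z‖ 1) ^ 2
          + 2 * α * ‖η y₁ t₁ z - η y₂ t₂ z‖ ^ 2
          + {z : Euc l | 1 < ‖z‖}.indicator (fun _ => B * ‖Df‖ + G) z) ∂ν := by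
        refine setIntegral_le_integral ((hI₁.add hI₂).add hI₃) (ae_of_all _ fun z => ?_)
        have := hnn z
        change (0 : ℝ) ≤ _
        positivity
    _ = _ := by
        refine (integral_add (hI₁.add hI₂) hI₃).trans ?_
        rw [integral_add' hI₁ hI₂, integral_const_mul, integral_const_mul,
          integral_indicator hset, setIntegral_const, smul_eq_mul]
        ring

end OperatorBounds

/-- The anisotropic scaling `(x, t) ↦ (α x, β t)` of space-time. -/
noncomputable def scaleST (N : ℕ) (α β : ℝ) : SpaceTime N →L[ℝ] SpaceTime N :=
  ((WithLp.prodContinuousLinearEquiv 2 ℝ (Euc N) ℝ).symm.toContinuousLinearMap.comp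
    ((α • ContinuousLinearMap.id ℝ (Euc N)).prodMap (β • ContinuousLinearMap.id ℝ ℝ))).comp
    (WithLp.prodContinuousLinearEquiv 2 ℝ (Euc N) ℝ).toContinuousLinearMap

theorem scaleST_apply {N : ℕ} (α β : ℝ) (ζ : SpaceTime N) :
    scaleST N α β ζ = st (α • ζ.fst) (β * ζ.snd) := rfl

theorem inner_scaleST {N : ℕ} (α β : ℝ) (ζ ξ : SpaceTime N) :
    inner ℝ (scaleST N α β ζ) ξ = α * inner ℝ ζ.fst ξ.fst + β * (ζ.snd * ξ.snd) := by
  rw [scaleST_apply, inner_eq_fst_snd, st_fst, st_snd, real_inner_smul_left, mul_assoc]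

theorem inner_scaleST_self {N : ℕ} (α β : ℝ) (ζ : SpaceTime N) :
    inner ℝ (scaleST N α β ζ) ζ = α * ‖ζ.fst‖ ^ 2 + β * ζ.snd ^ 2 := by
  rw [inner_scaleST, real_inner_self_eq_norm_sq, ← pow_two]

/-- The viscosity inequality for `u` at a point where `u - f` has a superjet, when `f` has a
quadratic upper expansion. -/
theorem exists_viscosity_inequality_of_sub {N l : ℕ} {T B K : ℝ}
    {σ : Euc N → ℝ → Matrix (Fin N) (Fin N) ℝ} {a : Euc N → ℝ → Fin N → ℝ}
    {ν : Measure (Euc l)} {η : Euc N → ℝ → Euc l → Euc N} (h : OperatorBounds T σ a ν η B K)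
    {u f : Euc N → ℝ → ℝ} {c γ : ℝ} (hc : 0 ≤ c) (hγ : 0 ≤ γ)
    (hu : ∀ x, ∀ t ∈ Icc (0 : ℝ) T, |u x t| ≤ c * (1 + ‖x‖ ^ γ))
    {y Df : Euc N} {t ft M : ℝ} {P : SpaceTime N} {Q : SpaceTime N →L[ℝ] SpaceTime N}
    {W : Set (SpaceTime N)} (hW : ∀ ζ, ‖ζ - st y t‖ < 1 → ζ.snd ∈ Icc (0 : ℝ) T → ζ ∈ W)
    (hjet : ∀ ε > 0, ∃ ρ > 0, ∀ ζ ∈ W, ‖ζ - st y t‖ < ρ →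
      u ζ.fst ζ.snd - f ζ.fst ζ.snd ≤ u y t - f y t + inner ℝ P (ζ - st y t)
        + inner ℝ (Q (ζ - st y t)) (ζ - st y t) + ε * ‖ζ - st y t‖ ^ 2)
    (hf : ∃ M' : ℝ, ∃ ρ > 0, ∀ h τ, ‖h‖ < ρ → |τ| < ρ →
      f (y + h) (t + τ) ≤ f y t + inner ℝ Df h + ft * τ + M * ‖h‖ ^ 2 + M' * τ ^ 2)
    {R : ℝ} (hR : ∀ φ, IsC12 T φ → φ y t = u y t →
      (∀ x, ∀ s ∈ Ico (0 : ℝ) T, φ y t - u y t ≤ φ x s - u x s) →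
      ∀ κ ∈ Ioo (0 : ℝ) 1, R ≤ Hkop σ a ν η κ φ u y t)
    {e : ℝ} (he : 0 < e) :
    ∃ κ₀ ∈ Ioo (0 : ℝ) 1, ∀ κ ∈ Ioo 0 κ₀,
      R ≤ 2 * ∑ j, inner ℝ (Q (st (diffusionColumn σ y t j) 0)) (st (diffusionColumn σ y t j) 0)
        + 2 * (M * ∑ j, ‖diffusionColumn σ y t j‖ ^ 2)
        + inner ℝ (driftVector a y t) (P.fst + Df) + (P.snd + ft)
        + Ilarge ν η κ u (fun k => (P.fst + Df) k) y t + e := by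
  obtain ⟨M', ρ₁, hρ₁, hf⟩ := hf
  have hj : ∀ ε > 0, ∃ ρ > 0, ∀ x, ∀ s ∈ Icc (0 : ℝ) T, ‖st (x - y) (s - t)‖ < ρ →
      u x s ≤ u y t + inner ℝ (P + st Df ft) (st (x - y) (s - t))
        + inner ℝ ((Q + scaleST N M M') (st (x - y) (s - t))) (st (x - y) (s - t))
        + ε * ‖st (x - y) (s - t)‖ ^ 2 := by
    intro ε hε
    obtain ⟨ρ₂, hρ₂, hjet⟩ := hjet ε hε
    refine ⟨min 1 (min ρ₁ ρ₂), by positivity, fun x s hs hxs => ?_⟩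
    have l1 := hxs.trans_le (min_le_left _ _)
    have l2 := hxs.trans_le ((min_le_right _ _).trans (min_le_left _ _))
    have l3 := hxs.trans_le ((min_le_right _ _).trans (min_le_right _ _))
    have e1 := hjet (st x s) (hW _ l1 hs) l3
    have e2 := hf (x - y) (s - t) ((norm_fst_le_norm_st (st (x - y) (s - t))).trans_lt l2)
      ((abs_snd_le_norm_st (st (x - y) (s - t))).trans_lt l2)
    rw [add_sub_cancel, add_sub_cancel] at e2
    rw [st_sub, st_fst, st_snd] at e1
    rw [inner_add_left, add_apply, inner_add_left, inner_scaleST_self, inner_eq_fst_snd (st Df ft)]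
    simp only [st_fst, st_snd]
    linarith
  obtain ⟨κ₀, hκ₀, hκ⟩ := viscosity_inequality_of_superjet (P := P + st Df ft)
    (Q := Q + scaleST N M M') h.jump_le h.integrableOn_norm_sq hc hγ hu hj hR he
  refine ⟨κ₀, hκ₀, fun κ hκ' => (hκ κ hκ').trans_eq ?_⟩
  have h1 : ∀ j, inner ℝ ((Q + scaleST N M M') (st (WithLp.toLp 2 fun k => σ y t k j) 0))
      (st (WithLp.toLp 2 fun k => σ y t k j) 0) =
      inner ℝ (Q (st (diffusionColumn σ y t j) 0)) (st (diffusionColumn σ y t j) 0)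
        + M * ‖diffusionColumn σ y t j‖ ^ 2 := fun j => by
    rw [add_apply, inner_add_left, inner_scaleST_self, st_fst, st_snd]
    simp [diffusionColumn]
  have h2 : ∑ k, a y t k * (P + st Df ft).fst k = inner ℝ (driftVector a y t) (P.fst + Df) := by
    rw [real_inner_comm, ← sum_mul_eq_inner]
    rfl
  have h3 : (P + st Df ft).snd = P.snd + ft := rfl
  have h4 : (fun k => (P + st Df ft).fst k) = fun k => (P.fst + Df) k := rfl
  rw [h2, h3, h4, Finset.sum_congr rfl fun j _ => h1 j, Finset.sum_add_distrib, ← Finset.mul_sum]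
  ring

/-- The two viscosity inequalities obtained by doubling variables, added together. -/
theorem doubling_inequality {N l : ℕ} {T B K : ℝ}
    {σ : Euc N → ℝ → Matrix (Fin N) (Fin N) ℝ} {a : Euc N → ℝ → Fin N → ℝ}
    {ν : Measure (Euc l)} {η : Euc N → ℝ → Euc l → Euc N} (h : OperatorBounds T σ a ν η B K)
    {u v f : Euc N → ℝ → ℝ} {c₁ γ₁ c₂ γ₂ : ℝ} (hc₁ : 0 ≤ c₁) (hγ₁ : 0 ≤ γ₁) (hc₂ : 0 ≤ c₂)
    (hγ₂ : 0 ≤ γ₂) (hu : ∀ x, ∀ t ∈ Icc (0 : ℝ) T, |u x t| ≤ c₁ * (1 + ‖x‖ ^ γ₁))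
    (hv : ∀ x, ∀ t ∈ Icc (0 : ℝ) T, |v x t| ≤ c₂ * (1 + ‖x‖ ^ γ₂))
    (hus : ∀ t ∈ Icc (0 : ℝ) T, UpperSemicontinuous fun x => u x t)
    (hvs : ∀ t ∈ Icc (0 : ℝ) T, UpperSemicontinuous fun x => v x t)
    {x y w₁ w₂ q₁ q₂ o : SpaceTime N} {Q₁ Q₂ : SpaceTime N →L[ℝ] SpaceTime N}
    {α β ϑ : ℝ} (hα : 0 ≤ α) (hϑ : 0 ≤ ϑ) {W : Set (SpaceTime N)}
    (hW₁ : ∀ ζ, ‖ζ - w₁‖ < 1 → ζ.snd ∈ Icc (0 : ℝ) T → ζ ∈ W)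
    (hW₂ : ∀ ζ, ‖ζ - w₂‖ < 1 → ζ.snd ∈ Icc (0 : ℝ) T → ζ ∈ W)
    (hWB₁ : ∀ h, ‖h‖ ≤ B → w₁ + st h 0 ∈ W) (hWB₂ : ∀ h, ‖h‖ ≤ B → w₂ + st h 0 ∈ W)
    (ht₁ : w₁.snd ∈ Icc (0 : ℝ) T) (ht₂ : w₂.snd ∈ Icc (0 : ℝ) T)
    (hmax : ∀ x' y', ∀ a ∈ W, ∀ b ∈ W,
      u a.fst a.snd - f a.fst a.snd - β * ‖x' - a‖ ^ 2 + v b.fst b.snd - β * ‖y' - b‖ ^ 2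
          - (ϑ * ‖x' - o‖ ^ 2 + ϑ * ‖y' - o‖ ^ 2
            + inner ℝ (scaleST N α β (x' - y')) (x' - y')) - inner ℝ q₁ x' - inner ℝ q₂ y' ≤
        u w₁.fst w₁.snd - f w₁.fst w₁.snd - β * ‖x - w₁‖ ^ 2 + v w₂.fst w₂.snd
          - β * ‖y - w₂‖ ^ 2 - (ϑ * ‖x - o‖ ^ 2 + ϑ * ‖y - o‖ ^ 2
            + inner ℝ (scaleST N α β (x - y)) (x - y)) - inner ℝ q₁ x - inner ℝ q₂ y)
    (hjet₁ : ∀ ε > 0, ∃ ρ > 0, ∀ a ∈ W, ‖a - w₁‖ < ρ → u a.fst a.snd - f a.fst a.snd ≤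
      u w₁.fst w₁.snd - f w₁.fst w₁.snd
        + inner ℝ ((2 * ϑ) • (x - o) + (2 : ℝ) • scaleST N α β (x - y) + q₁) (a - w₁)
        + inner ℝ (Q₁ (a - w₁)) (a - w₁) + ε * ‖a - w₁‖ ^ 2)
    (hjet₂ : ∀ ε > 0, ∃ ρ > 0, ∀ b ∈ W, ‖b - w₂‖ < ρ → v b.fst b.snd ≤ v w₂.fst w₂.snd
        + inner ℝ ((2 * ϑ) • (y - o) - (2 : ℝ) • scaleST N α β (x - y) + q₂) (b - w₂)
        + inner ℝ (Q₂ (b - w₂)) (b - w₂) + ε * ‖b - w₂‖ ^ 2)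
    (hQ : ∀ h k, inner ℝ (Q₁ h) h + inner ℝ (Q₂ k) k ≤
      ϑ * ‖h‖ ^ 2 + ϑ * ‖k‖ ^ 2 + inner ℝ (scaleST N α β (h - k)) (h - k))
    {Df : Euc N} {ft M : ℝ} (hM : 0 ≤ M)
    (hf₁ : ∀ h, ‖h‖ ≤ B → f (w₁.fst + h) w₁.snd ≤
      f w₁.fst w₁.snd + inner ℝ Df h + M * ‖h‖ ^ 2)
    (hf₂ : ∃ M' : ℝ, ∃ ρ > 0, ∀ h τ, ‖h‖ < ρ → |τ| < ρ →
      f (w₁.fst + h) (w₁.snd + τ) ≤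
        f w₁.fst w₁.snd + inner ℝ Df h + ft * τ + M * ‖h‖ ^ 2 + M' * τ ^ 2)
    {R₁ R₂ : ℝ} (hR₁ : ∀ φ, IsC12 T φ → φ w₁.fst w₁.snd = u w₁.fst w₁.snd →
      (∀ x, ∀ s ∈ Ico (0 : ℝ) T, φ w₁.fst w₁.snd - u w₁.fst w₁.snd ≤ φ x s - u x s) →
      ∀ κ ∈ Ioo (0 : ℝ) 1, R₁ ≤ Hkop σ a ν η κ φ u w₁.fst w₁.snd)
    (hR₂ : ∀ φ, IsC12 T φ → φ w₂.fst w₂.snd = v w₂.fst w₂.snd →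
      (∀ x, ∀ s ∈ Ico (0 : ℝ) T, φ w₂.fst w₂.snd - v w₂.fst w₂.snd ≤ φ x s - v x s) →
      ∀ κ ∈ Ioo (0 : ℝ) 1, R₂ ≤ Hkop σ a ν η κ φ v w₂.fst w₂.snd)
    {e : ℝ} (he : 0 < e) :
    R₁ + R₂ ≤ (2 * (M * ∑ j, ‖diffusionColumn σ w₁.fst w₁.snd j‖ ^ 2)
        + inner ℝ (driftVector a w₁.fst w₁.snd) Df + ft
        + M * B ^ 2 * (∫ z, (min ‖z‖ 1) ^ 2 ∂ν) + B * ‖Df‖ * ν.real {z | 1 < ‖z‖})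
      + 2 * (ϑ * ∑ j, ‖diffusionColumn σ w₁.fst w₁.snd j‖ ^ 2
        + ϑ * ∑ j, ‖diffusionColumn σ w₂.fst w₂.snd j‖ ^ 2
        + α * ∑ j, ‖diffusionColumn σ w₁.fst w₁.snd j - diffusionColumn σ w₂.fst w₂.snd j‖ ^ 2)
      + (inner ℝ (driftVector a w₁.fst w₁.snd) ((2 * ϑ) • (x.fst - o.fst) + q₁.fst)
        + inner ℝ (driftVector a w₂.fst w₂.snd) ((2 * ϑ) • (y.fst - o.fst) + q₂.fst)
        + 2 * α * inner ℝ (driftVector a w₁.fst w₁.snd - driftVector a w₂.fst w₂.snd)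
          (x.fst - y.fst))
      + (2 * ϑ * (x.snd - o.snd) + 2 * ϑ * (y.snd - o.snd) + q₁.snd + q₂.snd)
      + 2 * ϑ * B ^ 2 * (∫ z, (min ‖z‖ 1) ^ 2 ∂ν)
      + 2 * α * (∫ z, ‖η w₁.fst w₁.snd z - η w₂.fst w₂.snd z‖ ^ 2 ∂ν)
      + (B * (‖(2 * ϑ) • (x.fst - o.fst) + q₁.fst‖ + ‖(2 * ϑ) • (y.fst - o.fst) + q₂.fst‖)
        + α * ‖x.fst - y.fst‖ ^ 2) * ν.real {z | 1 < ‖z‖} + 2 * e := by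
  obtain ⟨d₁, hd₁⟩ : ∃ d, d = (2 * ϑ) • (x.fst - o.fst) + q₁.fst := ⟨_, rfl⟩
  obtain ⟨d₂, hd₂⟩ : ∃ d, d = (2 * ϑ) • (y.fst - o.fst) + q₂.fst := ⟨_, rfl⟩
  obtain ⟨P₁, hP₁⟩ : ∃ P, P = (2 * ϑ) • (x - o) + (2 : ℝ) • scaleST N α β (x - y) + q₁ := ⟨_, rfl⟩
  obtain ⟨P₂, hP₂⟩ : ∃ P, P = (2 * ϑ) • (y - o) - (2 : ℝ) • scaleST N α β (x - y) + q₂ := ⟨_, rfl⟩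
  have hP₁f : P₁.fst = d₁ + (2 * α) • (x.fst - y.fst) := by
    rw [hP₁, hd₁, mul_smul 2 α]
    change (2 * ϑ) • (x.fst - o.fst) + (2 : ℝ) • α • (x.fst - y.fst) + q₁.fst = _
    abel
  have hP₂f : P₂.fst = d₂ - (2 * α) • (x.fst - y.fst) := by
    rw [hP₂, hd₂, mul_smul 2 α]
    change (2 * ϑ) • (y.fst - o.fst) - (2 : ℝ) • α • (x.fst - y.fst) + q₂.fst = _
    abel
  have hPs : P₁.snd + P₂.snd
      = 2 * ϑ * (x.snd - o.snd) + 2 * ϑ * (y.snd - o.snd) + q₁.snd + q₂.snd := by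
    rw [hP₁, hP₂]
    change (2 * ϑ) * (x.snd - o.snd) + 2 * (β * (x.snd - y.snd)) + q₁.snd +
      ((2 * ϑ) * (y.snd - o.snd) - 2 * (β * (x.snd - y.snd)) + q₂.snd) = _
    ring
  rw [← hP₁] at hjet₁
  rw [← hP₂] at hjet₂
  rw [← hd₁, ← hd₂, ← hPs]
  have hjet₂' : ∀ ε > 0, ∃ ρ > 0, ∀ b ∈ W, ‖b - st w₂.fst w₂.snd‖ < ρ →
      v b.fst b.snd - 0 ≤ v w₂.fst w₂.snd - 0 + inner ℝ P₂ (b - st w₂.fst w₂.snd)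
        + inner ℝ (Q₂ (b - st w₂.fst w₂.snd)) (b - st w₂.fst w₂.snd)
        + ε * ‖b - st w₂.fst w₂.snd‖ ^ 2 := by
    simp only [sub_zero, st_eta]
    exact hjet₂
  obtain ⟨κ₁, hκ₁, h₁⟩ := exists_viscosity_inequality_of_sub (y := w₁.fst)
    (t := w₁.snd) h hc₁ hγ₁ hu hW₁ hjet₁ hf₂ hR₁ he
  obtain ⟨κ₂, hκ₂, h₂⟩ := exists_viscosity_inequality_of_sub (y := w₂.fst)
    (t := w₂.snd) (f := fun _ _ => 0) (Df := 0)
    (ft := 0) (M := 0) h hc₂ hγ₂ hv hW₂ hjet₂'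
    ⟨0, 1, one_pos, fun _ _ _ _ => by simp⟩ hR₂ he
  obtain ⟨κ, hκ⟩ : ∃ κ, κ = min κ₁ κ₂ / 2 := ⟨_, rfl⟩
  have hm : 0 < min κ₁ κ₂ := lt_min hκ₁.1 hκ₂.1
  have m1 := min_le_left κ₁ κ₂
  have m2 := min_le_right κ₁ κ₂
  have h₁' := h₁ κ ⟨by linarith, by linarith⟩
  have h₂' := h₂ κ ⟨by linarith, by linarith⟩
  have hloc : ∀ {w : Euc N → ℝ → ℝ} {c γ : ℝ}, 0 ≤ c → 0 ≤ γ →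
      (∀ x, ∀ t ∈ Icc (0 : ℝ) T, |w x t| ≤ c * (1 + ‖x‖ ^ γ)) → ∀ (x : Euc N), ∀ t ∈ Icc (0 : ℝ) T,
      ∀ y, ‖y - x‖ ≤ B → |w y t| ≤ c * (1 + (‖x‖ + B) ^ γ) := by
    intro w c γ hc hγ hw x t ht y hy
    refine (hw y t ht).trans ?_
    gcongr
    have := norm_add_le x (y - x)
    rw [add_sub_cancel] at this
    linarith
  have hB := h.B_pos
  have hinc : ∀ h k : Euc N, ‖h‖ ≤ B → ‖k‖ ≤ B →
      u (w₁.fst + h) w₁.snd - f (w₁.fst + h) w₁.snd + v (w₂.fst + k) w₂.snd ≤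
        u w₁.fst w₁.snd - f w₁.fst w₁.snd + v w₂.fst w₂.snd + inner ℝ P₁.fst h + inner ℝ P₂.fst k
          + ϑ * ‖h‖ ^ 2 + ϑ * ‖k‖ ^ 2 + α * ‖h - k‖ ^ 2 := by
    intro h k hh hk
    have e₁ := hmax (x + st h 0) (y + st k 0) _ (hWB₁ h hh) _ (hWB₂ k hk)
    have s₁ : x + st h 0 - (w₁ + st h 0) = x - w₁ := by abel
    have s₂ : y + st k 0 - (w₂ + st k 0) = y - w₂ := by abel
    have s₃ : x + st h 0 - o = (x - o) + st h 0 := by abel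
    have s₄ : y + st k 0 - o = (y - o) + st k 0 := by abel
    have s₅ : x + st h 0 - (y + st k 0) = (x - y) + st (h - k) 0 := by
      rw [show st (h - k) (0 : ℝ) = st h 0 - st k 0 by rw [st_sub, sub_zero]]
      abel
    have s₆ : inner ℝ (scaleST N α β (x - y + st (h - k) 0)) (x - y + st (h - k) 0)
        = inner ℝ (scaleST N α β (x - y)) (x - y) + 2 * α * inner ℝ (x.fst - y.fst) (h - k)
          + α * ‖h - k‖ ^ 2 := by
      rw [inner_scaleST_self, inner_scaleST_self]
      change α * ‖(x.fst - y.fst) + (h - k)‖ ^ 2 + β * ((x.snd - y.snd) + 0) ^ 2 =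
        α * ‖x.fst - y.fst‖ ^ 2 + β * (x.snd - y.snd) ^ 2 + _ + _
      rw [norm_add_sq_real]
      ring
    have s₇ : ∀ (ζ : SpaceTime N) (h : Euc N), inner ℝ ζ (st h 0) = inner ℝ ζ.fst h := by
      intro ζ h
      rw [inner_eq_fst_snd, st_fst, st_snd, mul_zero, add_zero]
    rw [s₁, s₂, s₃, s₄, s₅, s₆, norm_add_sq_real, norm_add_sq_real, norm_st_zero, norm_st_zero,
      inner_add_right, inner_add_right, s₇, s₇, s₇, s₇] at e₁
    rw [hP₁f, hP₂f, hd₁, hd₂]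
    simp only [inner_add_left, inner_sub_left, real_inner_smul_left]
    have r₁ : (w₁ + st h 0).snd = w₁.snd := add_zero _
    have r₂ : (w₂ + st k 0).snd = w₂.snd := add_zero _
    have r₃ : (w₁ + st h 0).fst = w₁.fst + h := rfl
    have r₄ : (w₂ + st k 0).fst = w₂.fst + k := rfl
    have r₅ : (x - o).fst = x.fst - o.fst := rfl
    have r₆ : (y - o).fst = y.fst - o.fst := rfl
    rw [r₁, r₂, r₃, r₄, r₅, r₆] at e₁
    simp only [inner_sub_left, inner_sub_right] at e₁ ⊢
    linarith
  have hp : ∀ h k : Euc N, ‖h‖ ≤ B → ‖k‖ ≤ B → inner ℝ P₁.fst h + inner ℝ P₂.fst k ≤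
      B * (‖d₁‖ + ‖d₂‖) + α * ‖x.fst - y.fst‖ ^ 2 + α * ‖h - k‖ ^ 2 := by
    intro h k hh hk
    rw [hP₁f, hP₂f]
    have e₁ : inner ℝ d₁ h ≤ ‖d₁‖ * B :=
      (real_inner_le_norm _ _).trans (mul_le_mul_of_nonneg_left hh (norm_nonneg _))
    have e₂ : inner ℝ d₂ k ≤ ‖d₂‖ * B :=
      (real_inner_le_norm _ _).trans (mul_le_mul_of_nonneg_left hk (norm_nonneg _))
    have e₃ : 2 * inner ℝ (x.fst - y.fst) (h - k) ≤ ‖x.fst - y.fst‖ ^ 2 + ‖h - k‖ ^ 2 := by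
      have := norm_sub_sq_real (x.fst - y.fst) (h - k)
      have := sq_nonneg ‖x.fst - y.fst - (h - k)‖
      linarith
    have e₄ := mul_le_mul_of_nonneg_left e₃ hα
    rw [inner_add_left, inner_sub_left, real_inner_smul_left, real_inner_smul_left]
    rw [inner_sub_right] at e₄
    linarith
  have hnl := h.Ilarge_add_le (κ := κ) (y₂ := w₂.fst) (p₁ := P₁.fst) (p₂ := P₂.fst) (ϑ := ϑ)
    (α := α)
    (G := B * (‖d₁‖ + ‖d₂‖) + α * ‖x.fst - y.fst‖ ^ 2)
    ⟨by linarith, by linarith [hκ₁.2]⟩ (hus _ ht₁) (hvs _ ht₂)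
    (hloc hc₁ hγ₁ hu _ _ ht₁) (hloc hc₂ hγ₂ hv _ _ ht₂) hϑ hα hM (by positivity) hf₁
    hinc hp
  have hsum : ∑ j, inner ℝ (Q₁ (st (diffusionColumn σ w₁.fst w₁.snd j) 0))
        (st (diffusionColumn σ w₁.fst w₁.snd j) 0)
      + ∑ j, inner ℝ (Q₂ (st (diffusionColumn σ w₂.fst w₂.snd j) 0))
        (st (diffusionColumn σ w₂.fst w₂.snd j) 0) ≤
      ϑ * ∑ j, ‖diffusionColumn σ w₁.fst w₁.snd j‖ ^ 2
      + ϑ * ∑ j, ‖diffusionColumn σ w₂.fst w₂.snd j‖ ^ 2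
      + α * ∑ j, ‖diffusionColumn σ w₁.fst w₁.snd j
        - diffusionColumn σ w₂.fst w₂.snd j‖ ^ 2 := by
    rw [← Finset.sum_add_distrib, Finset.mul_sum, Finset.mul_sum, Finset.mul_sum,
      ← Finset.sum_add_distrib, ← Finset.sum_add_distrib]
    refine Finset.sum_le_sum fun j _ => (hQ _ _).trans_eq ?_
    rw [st_sub, inner_scaleST_self, norm_st_zero, norm_st_zero, st_fst, st_snd]
    ring
  have hd : inner ℝ (driftVector a w₁.fst w₁.snd) P₁.fst
      + inner ℝ (driftVector a w₂.fst w₂.snd) P₂.fst =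
      inner ℝ (driftVector a w₁.fst w₁.snd) d₁ + inner ℝ (driftVector a w₂.fst w₂.snd) d₂
      + 2 * α * inner ℝ (driftVector a w₁.fst w₁.snd - driftVector a w₂.fst w₂.snd)
        (x.fst - y.fst) := by
    rw [hP₁f, hP₂f, inner_add_right, inner_sub_right, inner_smul_right, inner_smul_right,
      inner_sub_left]
    ring
  rw [inner_add_right] at h₁'
  simp only [add_zero, zero_mul, mul_zero] at h₂'
  linarith

namespace OperatorBounds

variable {N l : ℕ} {T B K : ℝ} {σ : Euc N → ℝ → Matrix (Fin N) (Fin N) ℝ}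
  {a : Euc N → ℝ → Fin N → ℝ} {ν : Measure (Euc l)} {η : Euc N → ℝ → Euc l → Euc N}

theorem integral_jump_sub_sq_le (h : OperatorBounds T σ a ν η B K) (y₁ y₂ : Euc N) (t s : ℝ) :
    ∫ z, ‖η y₁ t z - η y₂ s z‖ ^ 2 ∂ν ≤
      2 * B ^ 2 * (∫ z, (min ‖z‖ 1) ^ 2 ∂ν) * ‖y₁ - y₂‖ ^ 2
        + 2 * ∫ z, ‖η y₂ t z - η y₂ s z‖ ^ 2 ∂ν := by
  have h1 := h.levy.const_mul (2 * B ^ 2 * ‖y₁ - y₂‖ ^ 2)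
  have h2 := (h.integrable_jump_sub_sq y₂ y₂ t s).const_mul 2
  have h3 : ∫ z, ‖η y₁ t z - η y₂ s z‖ ^ 2 ∂ν ≤
      ∫ z, (2 * B ^ 2 * ‖y₁ - y₂‖ ^ 2 * (min ‖z‖ 1) ^ 2 + 2 * ‖η y₂ t z - η y₂ s z‖ ^ 2) ∂ν := by
    refine integral_mono (h.integrable_jump_sub_sq _ _ _ _) (h1.add h2) fun z => ?_
    have e1 := norm_add_le (η y₁ t z - η y₂ t z) (η y₂ t z - η y₂ s z)
    rw [sub_add_sub_cancel] at e1
    have e2 := h.jump_lip y₁ y₂ t z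
    have e3 : ‖η y₁ t z - η y₂ t z‖ ^ 2 ≤ (B * min ‖z‖ 1 * ‖y₁ - y₂‖) ^ 2 :=
      pow_le_pow_left₀ (norm_nonneg _) e2 2
    have e4 := pow_le_pow_left₀ (norm_nonneg _) e1 2
    have e5 := sq_nonneg (‖η y₁ t z - η y₂ t z‖ - ‖η y₂ t z - η y₂ s z‖)
    rw [mul_pow, mul_pow] at e3
    change _ ≤ 2 * B ^ 2 * ‖y₁ - y₂‖ ^ 2 * (min ‖z‖ 1) ^ 2 + 2 * ‖η y₂ t z - η y₂ s z‖ ^ 2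
    linarith
  rw [integral_add h1 h2, integral_const_mul, integral_const_mul] at h3
  linarith

/-- The error terms in `doubling_inequality` are controlled by the penalization terms. -/
theorem doubling_error_le (h : OperatorBounds T σ a ν η B K) {x y w₁ w₂ q₁ q₂ o : SpaceTime N}
    {α ϑ R ω : ℝ} (hα : 0 ≤ α) (hϑ : 0 ≤ ϑ) (hR₁ : ‖w₁.fst‖ ≤ R) (hR₂ : ‖w₂.fst‖ ≤ R)
    (ht₁ : w₁.snd ∈ Icc (0 : ℝ) T) (ht₂ : w₂.snd ∈ Icc (0 : ℝ) T)
    (hx : ‖x - o‖ ≤ 1) (hy : ‖y - o‖ ≤ 1) (hq₁ : ‖q₁‖ ≤ ϑ) (hq₂ : ‖q₂‖ ≤ ϑ)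
    (hω : ∫ z, ‖η w₂.fst w₁.snd z - η w₂.fst w₂.snd z‖ ^ 2 ∂ν ≤ ω) :
    2 * (ϑ * ∑ j, ‖diffusionColumn σ w₁.fst w₁.snd j‖ ^ 2
        + ϑ * ∑ j, ‖diffusionColumn σ w₂.fst w₂.snd j‖ ^ 2
        + α * ∑ j, ‖diffusionColumn σ w₁.fst w₁.snd j - diffusionColumn σ w₂.fst w₂.snd j‖ ^ 2)
      + (inner ℝ (driftVector a w₁.fst w₁.snd) ((2 * ϑ) • (x.fst - o.fst) + q₁.fst)
        + inner ℝ (driftVector a w₂.fst w₂.snd) ((2 * ϑ) • (y.fst - o.fst) + q₂.fst)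
        + 2 * α * inner ℝ (driftVector a w₁.fst w₁.snd - driftVector a w₂.fst w₂.snd)
          (x.fst - y.fst))
      + (2 * ϑ * (x.snd - o.snd) + 2 * ϑ * (y.snd - o.snd) + q₁.snd + q₂.snd)
      + 2 * ϑ * B ^ 2 * (∫ z, (min ‖z‖ 1) ^ 2 ∂ν)
      + 2 * α * (∫ z, ‖η w₁.fst w₁.snd z - η w₂.fst w₂.snd z‖ ^ 2 ∂ν)
      + (B * (‖(2 * ϑ) • (x.fst - o.fst) + q₁.fst‖ + ‖(2 * ϑ) • (y.fst - o.fst) + q₂.fst‖)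
        + α * ‖x.fst - y.fst‖ ^ 2) * ν.real {z | 1 < ‖z‖} ≤
      ϑ * (4 * K * (1 + R ^ 2) + 6 * K * (1 + R) + 6 + 6 * B * ν.real {z | 1 < ‖z‖}
          + 2 * B ^ 2 * ∫ z, (min ‖z‖ 1) ^ 2 ∂ν)
        + α * ‖w₁.fst - w₂.fst‖ ^ 2 * (3 * K + 4 * B ^ 2 * ∫ z, (min ‖z‖ 1) ^ 2 ∂ν)
        + α * ‖x.fst - y.fst‖ ^ 2 * (K + ν.real {z | 1 < ‖z‖}) + 4 * (α * ω) := by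
  obtain ⟨b₀, hb₀⟩ : ∃ b, b = ∫ z : Euc l, (min ‖z‖ 1) ^ 2 ∂ν := ⟨_, rfl⟩
  obtain ⟨n₁, hn₁⟩ : ∃ b, b = ν.real {z : Euc l | 1 < ‖z‖} := ⟨_, rfl⟩
  have hn₁0 : 0 ≤ n₁ := hn₁ ▸ measureReal_nonneg
  have hJ := h.integral_jump_sub_sq_le w₁.fst w₂.fst w₁.snd w₂.snd
  rw [← hb₀] at hJ
  rw [← hb₀, ← hn₁]
  have hK := h.K_nonneg
  have hB := h.B_pos
  have hR0 : 0 ≤ R := (norm_nonneg _).trans hR₁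
  have hd : ∀ {ξ q : SpaceTime N}, ‖ξ - o‖ ≤ 1 → ‖q‖ ≤ ϑ →
      ‖(2 * ϑ) • (ξ.fst - o.fst) + q.fst‖ ≤ 3 * ϑ ∧ 2 * ϑ * (ξ.snd - o.snd) + q.snd ≤ 3 * ϑ := by
    intro ξ q hξ hq
    have f1 : ‖ξ.fst - o.fst‖ ≤ 1 := (norm_fst_le_norm_st (ξ - o)).trans hξ
    have f2 : ‖q.fst‖ ≤ ϑ := (norm_fst_le_norm_st q).trans hq
    have f3 : ξ.snd - o.snd ≤ 1 :=
      (le_abs_self _).trans ((abs_snd_le_norm_st (ξ - o)).trans hξ)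
    have f4 : q.snd ≤ ϑ := (le_abs_self _).trans ((abs_snd_le_norm_st q).trans hq)
    constructor
    · refine (norm_add_le _ _).trans ?_
      rw [norm_smul, Real.norm_of_nonneg (by positivity)]
      nlinarith
    · nlinarith
  obtain ⟨g₁, s₁⟩ := hd hx hq₁
  obtain ⟨g₂, s₂⟩ := hd hy hq₂
  have hdr : ∀ {w : SpaceTime N} {v : Euc N}, ‖w.fst‖ ≤ R → w.snd ∈ Icc (0 : ℝ) T →
      ‖v‖ ≤ 3 * ϑ → inner ℝ (driftVector a w.fst w.snd) v ≤ K * (1 + R) * (3 * ϑ) := by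
    intro w v hw ht hv
    refine (real_inner_le_norm _ _).trans (mul_le_mul ?_ hv (norm_nonneg _) (by positivity))
    exact (h.drift_le _ _ ht).trans (by gcongr)
  have hdf : ∀ {w : SpaceTime N}, ‖w.fst‖ ≤ R → w.snd ∈ Icc (0 : ℝ) T →
      ∑ j, ‖diffusionColumn σ w.fst w.snd j‖ ^ 2 ≤ K * (1 + R ^ 2) := by
    intro w hw ht
    exact (h.diffusion_le _ _ ht).trans (by gcongr)
  have i₁ := mul_le_mul_of_nonneg_left (hdf hR₁ ht₁) hϑ
  have i₂ := mul_le_mul_of_nonneg_left (hdf hR₂ ht₂) hϑ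
  have i₃ := mul_le_mul_of_nonneg_left (h.diffusion_lip w₁.fst w₂.fst _ ht₁ _ ht₂) hα
  have i₄ := hdr hR₁ ht₁ g₁
  have i₅ := hdr hR₂ ht₂ g₂
  have i₆ : inner ℝ (driftVector a w₁.fst w₁.snd - driftVector a w₂.fst w₂.snd) (x.fst - y.fst) ≤
      K * (‖w₁.fst - w₂.fst‖ * ‖x.fst - y.fst‖) := by
    refine (real_inner_le_norm _ _).trans ?_
    rw [← mul_assoc]
    gcongr
    exact h.drift_lip _ _ _ ht₁ _ ht₂
  have i₇ := mul_le_mul_of_nonneg_left i₆ (by positivity : 0 ≤ 2 * α)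
  have i₈ := mul_le_mul_of_nonneg_left
    (two_mul_le_add_sq ‖w₁.fst - w₂.fst‖ ‖x.fst - y.fst‖) (by positivity : 0 ≤ α * K)
  have i₉ := mul_le_mul_of_nonneg_left (hJ.trans (add_le_add_right
    (mul_le_mul_of_nonneg_left hω zero_le_two) _)) (by positivity : 0 ≤ 2 * α)
  have i₁₀ := mul_le_mul_of_nonneg_left (mul_le_mul_of_nonneg_left (add_le_add g₁ g₂) hB.le) hn₁0
  linarith

end OperatorBounds

section Penalization

theorem UpperSemicontinuousOn.exists_add_lt_of_norm_sub_lt {V : Type*} [NormedAddCommGroup V]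
    {W : Set V} {u₁ u₂ : V → ℝ} (hW : IsCompact W) (hu₁ : UpperSemicontinuousOn u₁ W)
    (hu₂ : UpperSemicontinuousOn u₂ W) {m : ℝ} (hm : ∀ a ∈ W, u₁ a + u₂ a < m) :
    ∃ ρ > 0, ∀ a ∈ W, ∀ b ∈ W, ‖a - b‖ < ρ → u₁ a + u₂ b < m := by
  have hF : UpperSemicontinuousOn (fun p : V × V => u₁ p.1 + u₂ p.2) (W ×ˢ W) :=
    UpperSemicontinuousOn.add (hu₁.comp continuous_fst.continuousOn fun _ h => h.1)
      (hu₂.comp continuous_snd.continuousOn fun _ h => h.2)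
  have hK := hF.isCompact_inter_preimage_Ici (hW.prod hW) m
  rcases Set.eq_empty_or_nonempty
    ((W ×ˢ W) ∩ (fun p : V × V => u₁ p.1 + u₂ p.2) ⁻¹' Ici m) with he | hne
  · refine ⟨1, one_pos, fun a ha b hb _ => ?_⟩
    by_contra! hlt
    have hmem : (a, b) ∈ ((W ×ˢ W) ∩ (fun p : V × V => u₁ p.1 + u₂ p.2) ⁻¹' Ici m) :=
      ⟨⟨ha, hb⟩, hlt⟩
    rw [he] at hmem
    exact hmem
  · obtain ⟨p, hp, hmin⟩ := hK.exists_isMinOn hne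
      (f := fun p : V × V => ‖p.1 - p.2‖) (by fun_prop)
    refine ⟨‖p.1 - p.2‖, ?_, fun a ha b hb hab => ?_⟩
    · rw [gt_iff_lt, norm_pos_iff, sub_ne_zero]
      intro h
      have h1 : m ≤ u₁ p.1 + u₂ p.2 := hp.2
      have h2 := hm p.1 hp.1.1
      rw [← h] at h1
      linarith
    · by_contra! hlt
      have h1 := isMinOn_iff.1 hmin (a, b) ⟨⟨ha, hb⟩, hlt⟩
      exact absurd h1 (not_le.2 hab)

theorem UpperSemicontinuousOn.exists_upper_bound {V : Type*} [TopologicalSpace V] {W : Set V}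
    {u : V → ℝ} (hW : IsCompact W) (hu : UpperSemicontinuousOn u W) : ∃ m, ∀ a ∈ W, u a ≤ m := by
  obtain ⟨m, hm⟩ := hu.bddAbove_of_isCompact hW
  exact ⟨m, fun a ha => hm ⟨a, ha, rfl⟩⟩

variable {V : Type*} [NormedAddCommGroup V] [InnerProductSpace ℝ V] {W : Set V} {u₁ u₂ : V → ℝ}

/-- The maximum points of the doubled and inf-convolved penalization of `u₁ + u₂` converge to the
centre `o` of the localization. -/
theorem exists_penalization_close (hW : IsCompact W) (hu₁ : UpperSemicontinuousOn u₁ W)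
    (hu₂ : UpperSemicontinuousOn u₂ W) {o : V} (ho : o ∈ W)
    (hmax : ∀ a ∈ W, u₁ a + u₂ a ≤ u₁ o + u₂ o) {ϑ δ : ℝ} (hϑ : 0 < ϑ) (hδ : 0 < δ) :
    ∃ α₀ > 0, ∃ r₀ > 0, ∀ (Λ : V →L[ℝ] V) (D r : ℝ) (x y w₁ w₂ q₁ q₂ : V),
      (∀ h, α₀ * ‖h‖ ^ 2 ≤ inner ℝ (Λ h) h) → α₀ ≤ D → 0 ≤ r → r ≤ r₀ → w₁ ∈ W → w₂ ∈ W →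
      ‖q₁‖ ≤ r → ‖q₂‖ ≤ r →
      u₁ o - D * ‖o - o‖ ^ 2 + u₂ o - D * ‖o - o‖ ^ 2
          - (ϑ * ‖o - o‖ ^ 2 + ϑ * ‖o - o‖ ^ 2 + inner ℝ (Λ (o - o)) (o - o))
          - inner ℝ q₁ o - inner ℝ q₂ o ≤
        u₁ w₁ - D * ‖x - w₁‖ ^ 2 + u₂ w₂ - D * ‖y - w₂‖ ^ 2
          - (ϑ * ‖x - o‖ ^ 2 + ϑ * ‖y - o‖ ^ 2 + inner ℝ (Λ (x - y)) (x - y))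
          - inner ℝ q₁ x - inner ℝ q₂ y →
      D * ‖x - w₁‖ ^ 2 ≤ δ ∧ D * ‖y - w₂‖ ^ 2 ≤ δ ∧ inner ℝ (Λ (x - y)) (x - y) ≤ δ ∧
        ‖x - o‖ ≤ δ ∧ ‖y - o‖ ≤ δ ∧ ‖w₁ - o‖ ≤ δ ∧ ‖w₂ - o‖ ≤ δ ∧ |u₁ w₁ - u₁ o| ≤ δ := by
  obtain ⟨m₁, hm₁⟩ := hu₁.exists_upper_bound hW
  obtain ⟨m₂, hm₂⟩ := hu₂.exists_upper_bound hW
  have husc : ∀ {u : V → ℝ}, UpperSemicontinuousOn u W →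
      ∃ ρ > 0, ∀ a ∈ W, ‖a - o‖ < ρ → u a ≤ u o + δ / 2 := by
    intro u hu
    have h1 := hu o ho (u o + δ / 2) (by linarith)
    rw [eventually_nhdsWithin_iff, Metric.eventually_nhds_iff] at h1
    obtain ⟨ρ, hρ, h1⟩ := h1
    exact ⟨ρ, hρ, fun a ha hd => (h1 (by rwa [dist_eq_norm]) ha).le⟩
  obtain ⟨ρ₁, hρ₁, hn₁⟩ := husc hu₁
  obtain ⟨ρ₂, hρ₂, hn₂⟩ := husc hu₂
  obtain ⟨d, hd0, hdδ, hdρ₁, hdρ₂⟩ : ∃ d > 0, d ≤ δ ∧ d < ρ₁ ∧ d < ρ₂ := by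
    refine ⟨min δ (min (ρ₁ / 2) (ρ₂ / 2)), by positivity, min_le_left _ _, ?_, ?_⟩
    · have := (min_le_right δ _).trans (min_le_left (ρ₁ / 2) (ρ₂ / 2))
      linarith
    · have := (min_le_right δ _).trans (min_le_right (ρ₁ / 2) (ρ₂ / 2))
      linarith
  obtain ⟨δ', hδ'0, hδ'1, hδ'2⟩ : ∃ δ' > 0, δ' ≤ δ / 2 ∧ δ' ≤ ϑ / 2 * (d / 2) ^ 2 :=
    ⟨min (δ / 2) (ϑ / 2 * (d / 2) ^ 2), by positivity, min_le_left _ _, min_le_right _ _⟩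
  obtain ⟨ρ, hρ, hclose⟩ := hu₁.exists_add_lt_of_norm_sub_lt hW hu₂
    (m := u₁ o + u₂ o + δ' / 2) (fun a ha => by linarith [hmax a ha])
  obtain ⟨C, hC0, hC⟩ : ∃ C > 0, m₁ + m₂ - (u₁ o + u₂ o) + δ' / 2 ≤ C :=
    ⟨max 1 (m₁ + m₂ - (u₁ o + u₂ o) + δ' / 2), by positivity, le_max_right _ _⟩
  obtain ⟨α₀, hα₀, hα₁, hα₂⟩ : ∃ α₀ > 0, C < α₀ * (ρ / 3) ^ 2 ∧ δ' ≤ α₀ * (d / 2) ^ 2 := by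
    refine ⟨(C + 1) / (ρ / 3) ^ 2 + δ' / (d / 2) ^ 2, by positivity, ?_, ?_⟩
    · have h1 : ((C + 1) / (ρ / 3) ^ 2 + δ' / (d / 2) ^ 2) * (ρ / 3) ^ 2
          = C + 1 + δ' / (d / 2) ^ 2 * (ρ / 3) ^ 2 := by field_simp
      have h2 : 0 ≤ δ' / (d / 2) ^ 2 * (ρ / 3) ^ 2 := by positivity
      linarith
    · have h1 : ((C + 1) / (ρ / 3) ^ 2 + δ' / (d / 2) ^ 2) * (d / 2) ^ 2
          = (C + 1) / (ρ / 3) ^ 2 * (d / 2) ^ 2 + δ' := by field_simp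
      have h2 : 0 ≤ (C + 1) / (ρ / 3) ^ 2 * (d / 2) ^ 2 := by positivity
      linarith
  obtain ⟨r₀, hr₀, hr₀'⟩ : ∃ r₀ > 0, r₀ ^ 2 / ϑ ≤ δ' / 2 := by
    refine ⟨Real.sqrt (δ' / 2 * ϑ), by positivity, ?_⟩
    rw [Real.sq_sqrt (by positivity)]
    exact (mul_div_cancel_right₀ _ hϑ.ne').le
  refine ⟨α₀, hα₀, r₀, hr₀, ?_⟩
  intro Λ D r x y w₁ w₂ q₁ q₂ hΛ hD hr hrr hw₁ hw₂ hq₁ hq₂ hle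
  have habs : ∀ q p : V, ‖q‖ ≤ r → -(inner ℝ q (p - o)) ≤ ϑ / 2 * ‖p - o‖ ^ 2 + δ' / 4 := by
    intro q p hq
    have h1 : |inner ℝ q (p - o)| ≤ r₀ * ‖p - o‖ :=
      (abs_real_inner_le_norm _ _).trans
        (mul_le_mul_of_nonneg_right (hq.trans hrr) (norm_nonneg _))
    have h2 : r₀ * ‖p - o‖ ≤ ϑ / 2 * ‖p - o‖ ^ 2 + r₀ ^ 2 / ϑ / 2 := by
      have h3 : ϑ / 2 * ‖p - o‖ ^ 2 + r₀ ^ 2 / ϑ / 2 - r₀ * ‖p - o‖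
          = (ϑ * ‖p - o‖ - r₀) ^ 2 / (2 * ϑ) := by field_simp; ring
      have h4 : 0 ≤ (ϑ * ‖p - o‖ - r₀) ^ 2 / (2 * ϑ) := by positivity
      linarith
    have h5 := neg_abs_le (inner ℝ q (p - o))
    linarith
  have h1 := habs q₁ x hq₁
  have h2 := habs q₂ y hq₂
  rw [inner_sub_right] at h1 h2
  simp only [sub_self, norm_zero, map_zero, inner_zero_right] at hle
  have hX : 0 ≤ D * ‖x - w₁‖ ^ 2 := mul_nonneg (hα₀.le.trans hD) (sq_nonneg _)
  have hY : 0 ≤ D * ‖y - w₂‖ ^ 2 := mul_nonneg (hα₀.le.trans hD) (sq_nonneg _)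
  have hXY := hΛ (x - y)
  have hXY0 : 0 ≤ α₀ * ‖x - y‖ ^ 2 := by positivity
  have hXo : 0 ≤ ϑ / 2 * ‖x - o‖ ^ 2 := by positivity
  have hYo : 0 ≤ ϑ / 2 * ‖y - o‖ ^ 2 := by positivity
  have hE : D * ‖x - w₁‖ ^ 2 + D * ‖y - w₂‖ ^ 2 + ϑ / 2 * ‖x - o‖ ^ 2 + ϑ / 2 * ‖y - o‖ ^ 2
      + inner ℝ (Λ (x - y)) (x - y) ≤ u₁ w₁ + u₂ w₂ - (u₁ o + u₂ o) + δ' / 2 := by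
    linarith
  have hαX : α₀ * ‖x - w₁‖ ^ 2 ≤ D * ‖x - w₁‖ ^ 2 :=
    mul_le_mul_of_nonneg_right hD (sq_nonneg _)
  have hαY : α₀ * ‖y - w₂‖ ^ 2 ≤ D * ‖y - w₂‖ ^ 2 :=
    mul_le_mul_of_nonneg_right hD (sq_nonneg _)
  have hsmall : ∀ {p : V}, α₀ * ‖p‖ ^ 2 ≤ C → ‖p‖ < ρ / 3 := by
    intro p hp
    have h3 : α₀ * ‖p‖ ^ 2 < α₀ * (ρ / 3) ^ 2 := hp.trans_lt hα₁
    exact lt_of_pow_lt_pow_left₀ 2 (by positivity) (lt_of_mul_lt_mul_left h3 hα₀.le)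
  have hb₁ := hm₁ w₁ hw₁
  have hb₂ := hm₂ w₂ hw₂
  have hs₁ := hsmall (p := x - w₁) (by linarith)
  have hs₂ := hsmall (p := y - w₂) (by linarith)
  have hs₃ := hsmall (p := x - y) (by linarith)
  have hww : ‖w₁ - w₂‖ < ρ := by
    have h3 : w₁ - w₂ = (x - y) - (x - w₁) + (y - w₂) := by abel
    rw [h3]
    have h4 := norm_add_le ((x - y) - (x - w₁)) (y - w₂)
    have h5 := norm_sub_le (x - y) (x - w₁)
    linarith
  have hub := hclose w₁ hw₁ w₂ hw₂ hww
  have hclose_o : ∀ {p w : V}, ϑ / 2 * ‖p - o‖ ^ 2 ≤ δ' → α₀ * ‖p - w‖ ^ 2 ≤ δ' →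
      ‖p - o‖ ≤ d / 2 ∧ ‖w - o‖ ≤ d := by
    intro p w hp hw
    have h3 : ‖p - o‖ ≤ d / 2 := by
      have h4 : ϑ / 2 * ‖p - o‖ ^ 2 ≤ ϑ / 2 * (d / 2) ^ 2 := hp.trans hδ'2
      exact le_of_sq_le_sq (le_of_mul_le_mul_left h4 (by positivity)) (by positivity)
    have h5 : ‖p - w‖ ≤ d / 2 :=
      le_of_sq_le_sq (le_of_mul_le_mul_left (hw.trans hα₂) hα₀) (by positivity)
    refine ⟨h3, ?_⟩
    have h6 : w - o = (p - o) - (p - w) := by abel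
    rw [h6]
    have h7 := norm_sub_le (p - o) (p - w)
    linarith
  obtain ⟨hxo, hw₁o⟩ := hclose_o (p := x) (w := w₁) (by linarith) (by linarith)
  obtain ⟨hyo, hw₂o⟩ := hclose_o (p := y) (w := w₂) (by linarith) (by linarith)
  have hv₁ := hn₁ w₁ hw₁ (by linarith)
  have hv₂ := hn₂ w₂ hw₂ (by linarith)
  refine ⟨by linarith, by linarith, by linarith, by linarith, by linarith, by linarith,
    by linarith, ?_⟩
  rw [abs_le]
  constructor <;> linarith

end Penalization

section LocalContradiction

variable {N l : ℕ} {T B K : ℝ} {σ : Euc N → ℝ → Matrix (Fin N) (Fin N) ℝ}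
  {a : Euc N → ℝ → Fin N → ℝ} {ν : Measure (Euc l)} {η : Euc N → ℝ → Euc l → Euc N}

theorem continuous_fst_snd_spaceTime : Continuous fun ζ : SpaceTime N => (ζ.fst, ζ.snd) :=
  WithLp.prod_continuous_ofLp 2 (Euc N) ℝ

theorem isCompact_spaceTime_cylinder (x₀ : Euc N) (R T : ℝ) :
    IsCompact {ζ : SpaceTime N | ‖ζ.fst - x₀‖ ≤ R ∧ ζ.snd ∈ Icc 0 T} := by
  have h : {ζ : SpaceTime N | ‖ζ.fst - x₀‖ ≤ R ∧ ζ.snd ∈ Icc 0 T}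
      = (fun p : Euc N × ℝ => st p.1 p.2) '' (Metric.closedBall x₀ R ×ˢ Icc 0 T) := by
    ext ζ
    constructor
    · rintro ⟨h1, h2⟩
      exact ⟨(ζ.fst, ζ.snd), ⟨by rwa [mem_closedBall_iff_norm], h2⟩, rfl⟩
    · rintro ⟨p, ⟨h1, h2⟩, rfl⟩
      exact ⟨by rwa [mem_closedBall_iff_norm] at h1, h2⟩
  rw [h]
  exact ((isCompact_closedBall x₀ R).prod isCompact_Icc).image continuous_st

theorem norm_scaled_sub_sq_le {V : Type*} [SeminormedAddCommGroup V] (x y w₁ w₂ : V) {α : ℝ}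
    (hα : 0 ≤ α) : α * ‖w₁ - w₂‖ ^ 2 ≤
      3 * (α * ‖x - w₁‖ ^ 2 + α * ‖y - w₂‖ ^ 2 + α * ‖x - y‖ ^ 2) := by
  have h1 : ‖w₁ - w₂‖ ≤ ‖x - w₁‖ + ‖y - w₂‖ + ‖x - y‖ := by
    have h2 : w₁ - w₂ = (x - y) - (x - w₁) + (y - w₂) := by abel
    rw [h2]
    have h3 := norm_add_le ((x - y) - (x - w₁)) (y - w₂)
    have h4 := norm_sub_le (x - y) (x - w₁)
    linarith
  have h5 : ‖w₁ - w₂‖ ^ 2 ≤ (‖x - w₁‖ + ‖y - w₂‖ + ‖x - y‖) ^ 2 :=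
    pow_le_pow_left₀ (norm_nonneg _) h1 2
  have h6 : ‖w₁ - w₂‖ ^ 2 ≤ 3 * (‖x - w₁‖ ^ 2 + ‖y - w₂‖ ^ 2 + ‖x - y‖ ^ 2) := by
    nlinarith [sq_nonneg (‖x - w₁‖ - ‖y - w₂‖), sq_nonneg (‖x - w₁‖ - ‖x - y‖),
      sq_nonneg (‖y - w₂‖ - ‖x - y‖)]
  have h7 := mul_le_mul_of_nonneg_left h6 hα
  linarith

theorem exists_abs_sub_le_of_continuous {f : Euc N → ℝ → ℝ}
    (hf : Continuous fun p : Euc N × ℝ => f p.1 p.2) (o : SpaceTime N) {ε : ℝ} (hε : 0 < ε) :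
    ∃ ρ > 0, ∀ w : SpaceTime N, ‖w - o‖ ≤ ρ → |f w.fst w.snd - f o.fst o.snd| ≤ ε := by
  have hc : Continuous fun w : SpaceTime N => f w.fst w.snd := hf.comp continuous_fst_snd_spaceTime
  obtain ⟨ρ, hρ, h⟩ := Metric.continuous_iff.1 hc o ε hε
  refine ⟨ρ / 2, by linarith, fun w hw => ?_⟩
  have h1 := h w (by rw [dist_eq_norm]; linarith)
  rw [Real.dist_eq] at h1
  exact h1.le

/-- If `f` is a strict supersolution of the homogeneous equation, then `u + v - f` has no interior
maximum when `u` is a subsolution with source `-ψ` near the maximum and `v` one with source `ψ`. -/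
theorem OperatorBounds.not_isMax_of_strict (h : OperatorBounds T σ a ν η B K)
    {u v f ψ : Euc N → ℝ → ℝ} {c₁ γ₁ c₂ γ₂ : ℝ} (hc₁ : 0 ≤ c₁) (hγ₁ : 0 ≤ γ₁) (hc₂ : 0 ≤ c₂)
    (hγ₂ : 0 ≤ γ₂) (hu : ∀ x, ∀ t ∈ Icc (0 : ℝ) T, |u x t| ≤ c₁ * (1 + ‖x‖ ^ γ₁))
    (hv : ∀ x, ∀ t ∈ Icc (0 : ℝ) T, |v x t| ≤ c₂ * (1 + ‖x‖ ^ γ₂))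
    (hus : UpperSemicontinuousOn (fun p : Euc N × ℝ => u p.1 p.2) (univ ×ˢ Icc 0 T))
    (hvs : UpperSemicontinuousOn (fun p : Euc N × ℝ => v p.1 p.2) (univ ×ˢ Icc 0 T))
    (hfc : Continuous fun p : Euc N × ℝ => f p.1 p.2)
    (hψc : Continuous fun p : Euc N × ℝ => ψ p.1 p.2) {x₀ : Euc N} {t₀ : ℝ}
    (ht₀ : t₀ ∈ Ioo (0 : ℝ) T)
    (hmax : ∀ x, ∀ t ∈ Icc (0 : ℝ) T, u x t + v x t - f x t ≤ u x₀ t₀ + v x₀ t₀ - f x₀ t₀)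
    {Df : Euc N → ℝ → Euc N} {ft M : Euc N → ℝ → ℝ} (hM : ∀ x t, 0 ≤ M x t)
    (hf₁ : ∀ x t h, ‖h‖ ≤ B → f (x + h) t ≤ f x t + inner ℝ (Df x t) h + M x t * ‖h‖ ^ 2)
    (hf₂ : ∀ x t, ∃ M' : ℝ, ∃ ρ > 0, ∀ h τ, ‖h‖ < ρ → |τ| < ρ → f (x + h) (t + τ) ≤
      f x t + inner ℝ (Df x t) h + ft x t * τ + M x t * ‖h‖ ^ 2 + M' * τ ^ 2)
    {δ₀ : ℝ} (hδ₀ : 0 < δ₀)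
    (hf₃ : ∀ x, ∀ t ∈ Icc (0 : ℝ) T, 2 * (M x t * ∑ j, ‖diffusionColumn σ x t j‖ ^ 2)
      + inner ℝ (driftVector a x t) (Df x t) + ft x t
      + M x t * B ^ 2 * (∫ z, (min ‖z‖ 1) ^ 2 ∂ν) + B * ‖Df x t‖ * ν.real {z | 1 < ‖z‖} ≤ -δ₀)
    {δ₁ : ℝ} (hδ₁ : 0 < δ₁)
    (hsub : ∀ x, ∀ t ∈ Ioo (0 : ℝ) T, ‖x - x₀‖ ≤ δ₁ → |t - t₀| ≤ δ₁ → |u x t - u x₀ t₀| ≤ δ₁ →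
      ∀ φ, IsC12 T φ → φ x t = u x t →
        (∀ y, ∀ s ∈ Ico (0 : ℝ) T, φ x t - u x t ≤ φ y s - u y s) →
        ∀ κ ∈ Ioo (0 : ℝ) 1, -ψ x t ≤ Hkop σ a ν η κ φ u x t)
    (hsup : ∀ x, ∀ t ∈ Ioo (0 : ℝ) T, ∀ φ, IsC12 T φ → φ x t = v x t →
        (∀ y, ∀ s ∈ Ico (0 : ℝ) T, φ x t - v x t ≤ φ y s - v y s) →
        ∀ κ ∈ Ioo (0 : ℝ) 1, ψ x t ≤ Hkop σ a ν η κ φ v x t) : False := by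
  obtain ⟨o, ho⟩ : ∃ o, o = st x₀ t₀ := ⟨_, rfl⟩
  have hof : o.fst = x₀ := by rw [ho]; rfl
  have hos : o.snd = t₀ := by rw [ho]; rfl
  have hB := h.B_pos
  have hK := h.K_nonneg
  obtain ⟨W, hWdef⟩ : ∃ W, W = {ζ : SpaceTime N | ‖ζ.fst - x₀‖ ≤ B + 2 ∧ ζ.snd ∈ Icc 0 T} :=
    ⟨_, rfl⟩
  have hWc : IsCompact W := hWdef ▸ isCompact_spaceTime_cylinder x₀ (B + 2) T
  have hWmem : ∀ ζ, ζ ∈ W ↔ ‖ζ.fst - x₀‖ ≤ B + 2 ∧ ζ.snd ∈ Icc 0 T := fun ζ => by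
    rw [hWdef]; rfl
  have hoW : o ∈ W := by
    rw [hWmem, hof, hos, sub_self, norm_zero]
    exact ⟨by linarith, Ioo_subset_Icc_self ht₀⟩
  have hmaps : MapsTo (fun ζ : SpaceTime N => (ζ.fst, ζ.snd)) W (univ ×ˢ Icc 0 T) := fun ζ hζ =>
    ⟨mem_univ _, ((hWmem ζ).1 hζ).2⟩
  have hnegf : Continuous fun ζ : SpaceTime N => -f ζ.fst ζ.snd :=
    (hfc.comp continuous_fst_snd_spaceTime).neg
  have hu₁ : UpperSemicontinuousOn (fun ζ : SpaceTime N => u ζ.fst ζ.snd - f ζ.fst ζ.snd) W := by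
    have h1 := (hus.comp continuous_fst_snd_spaceTime.continuousOn hmaps).add
      hnegf.continuousOn.upperSemicontinuousOn
    exact h1
  have hu₂ : UpperSemicontinuousOn (fun ζ : SpaceTime N => v ζ.fst ζ.snd) W :=
    hvs.comp continuous_fst_snd_spaceTime.continuousOn hmaps
  have hmaxW : ∀ ζ ∈ W, (u ζ.fst ζ.snd - f ζ.fst ζ.snd) + v ζ.fst ζ.snd ≤
      (u o.fst o.snd - f o.fst o.snd) + v o.fst o.snd := by
    intro ζ hζ
    have h1 := hmax ζ.fst ζ.snd ((hWmem ζ).1 hζ).2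
    rw [hof, hos]
    linarith
  obtain ⟨I, hI⟩ : ∃ I, I = ∫ z : Euc l, (min ‖z‖ 1) ^ 2 ∂ν := ⟨_, rfl⟩
  have hI0 : 0 ≤ I := hI ▸ integral_nonneg fun z => sq_nonneg _
  obtain ⟨n₁, hn₁⟩ : ∃ n₁, n₁ = ν.real {z : Euc l | 1 < ‖z‖} := ⟨_, rfl⟩
  have hn₁0 : 0 ≤ n₁ := hn₁ ▸ measureReal_nonneg
  obtain ⟨R, hR⟩ : ∃ R, R = ‖x₀‖ + 1 := ⟨_, rfl⟩
  have hR0 : 0 ≤ R := by rw [hR]; positivity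
  obtain ⟨C₁, hC₁⟩ : ∃ C₁, C₁ = 4 * K * (1 + R ^ 2) + 6 * K * (1 + R) + 6 + 6 * B * n₁
      + 2 * B ^ 2 * I := ⟨_, rfl⟩
  have hC₁0 : 0 < C₁ := by rw [hC₁]; positivity
  obtain ⟨C₂, hC₂⟩ : ∃ C₂, C₂ = 3 * K + 4 * B ^ 2 * I := ⟨_, rfl⟩
  have hC₂0 : 0 ≤ C₂ := by rw [hC₂]; positivity
  obtain ⟨C₃, hC₃⟩ : ∃ C₃, C₃ = K + n₁ := ⟨_, rfl⟩
  have hC₃0 : 0 ≤ C₃ := by rw [hC₃]; positivity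
  obtain ⟨ϑ, hϑ, hϑC⟩ : ∃ ϑ > 0, ϑ * C₁ ≤ δ₀ / 8 :=
    ⟨δ₀ / 8 / C₁, by positivity, (div_mul_cancel₀ _ hC₁0.ne').le⟩
  obtain ⟨ρψ, hρψ, hψo⟩ := exists_abs_sub_le_of_continuous hψc o (ε := δ₀ / 8) (by linarith)
  obtain ⟨ρf, hρf, hfo⟩ := exists_abs_sub_le_of_continuous hfc o (ε := δ₁ / 2) (by linarith)
  obtain ⟨δ, hδ, hδ1, hδδ₁, hδt, hδT, hδψ, hδf, hδC⟩ : ∃ δ > 0, δ ≤ 1 ∧ δ ≤ δ₁ / 2 ∧ δ ≤ t₀ / 2 ∧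
      δ ≤ (T - t₀) / 2 ∧ δ ≤ ρψ ∧ δ ≤ ρf ∧ δ * (9 * C₂ + C₃) ≤ δ₀ / 8 := by
    have ht1 := ht₀.1
    have ht2 := sub_pos.2 ht₀.2
    have hev : ∀ᶠ δ in 𝓝[>] (0 : ℝ), 0 < δ ∧ δ ≤ 1 ∧ δ ≤ δ₁ / 2 ∧ δ ≤ t₀ / 2 ∧
        δ ≤ (T - t₀) / 2 ∧ δ ≤ ρψ ∧ δ ≤ ρf ∧ δ ≤ δ₀ / 8 / (9 * C₂ + C₃ + 1) := by
      have hle : ∀ b : ℝ, 0 < b → ∀ᶠ δ in 𝓝[>] (0 : ℝ), δ ≤ b := fun b hb =>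
        nhdsWithin_le_nhds ((eventually_lt_nhds hb).mono fun _ hx => le_of_lt hx)
      filter_upwards [self_mem_nhdsWithin, hle 1 one_pos, hle (δ₁ / 2) (by linarith),
        hle (t₀ / 2) (by linarith), hle ((T - t₀) / 2) (by linarith), hle ρψ hρψ, hle ρf hρf,
        hle (δ₀ / 8 / (9 * C₂ + C₃ + 1)) (by positivity)] with δ h1 h2 h3 h4 h5 h6 h7 h8
      exact ⟨h1, h2, h3, h4, h5, h6, h7, h8⟩
    obtain ⟨δ, h1, h2, h3, h4, h5, h6, h7, h8⟩ := hev.exists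
    refine ⟨δ, h1, h2, h3, h4, h5, h6, h7, ?_⟩
    rw [le_div_iff₀ (by positivity)] at h8
    nlinarith
  obtain ⟨α, hα, r₀, hr₀, hconv⟩ := exists_penalization_close hWc hu₁ hu₂ hoW hmaxW hϑ hδ
  obtain ⟨ρ, hρ, hjump⟩ := h.exists_integral_jump_sub_sq_le x₀ 1 (δ := δ₀ / (32 * α))
    (by positivity)
  obtain ⟨β, hαβ, hβρ⟩ : ∃ β, α ≤ β ∧ 9 * δ < β * ρ ^ 2 := by
    have h1 : 0 < 9 * δ / ρ ^ 2 := by positivity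
    refine ⟨α + 9 * δ / ρ ^ 2, by linarith, ?_⟩
    rw [add_mul, div_mul_cancel₀ _ (pow_pos hρ 2).ne']
    linarith [mul_pos hα (pow_pos hρ 2)]
  have hβ : 0 < β := hα.trans_le hαβ
  obtain ⟨r, hr, hrr₀, hrϑ⟩ : ∃ r > 0, r ≤ r₀ ∧ r ≤ ϑ :=
    ⟨min r₀ ϑ, lt_min hr₀ hϑ, min_le_left _ _, min_le_right _ _⟩
  have hΛs : ∀ h k : SpaceTime N, inner ℝ (scaleST N α β h) k = inner ℝ (scaleST N α β k) h := by
    intro h k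
    rw [inner_scaleST, inner_scaleST, real_inner_comm, mul_comm h.snd]
  have hΛα : ∀ h : SpaceTime N, α * ‖h‖ ^ 2 ≤ inner ℝ (scaleST N α β h) h := by
    intro h
    rw [inner_scaleST_self, ← st_eta h, norm_st_sq]
    simp only [st_fst, st_snd]
    have := mul_le_mul_of_nonneg_right hαβ (sq_nonneg h.snd)
    linarith
  have hΛp : ∀ h : SpaceTime N, 0 ≤ inner ℝ (scaleST N α β h) h := fun h =>
    (by positivity : 0 ≤ α * ‖h‖ ^ 2).trans (hΛα h)
  obtain ⟨x, y, w₁, w₂, q₁, q₂, Q₁, Q₂, hw₁, hw₂, hq₁, hq₂, hmx, hj₁, hj₂, hQ⟩ :=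
    exists_doubling_superjets hWc ⟨o, hoW⟩ hu₁ hu₂ (scaleST N α β) hΛs hΛp o hϑ hβ hr
  obtain ⟨hxw, hyw, hxy, hxo, hyo, hw₁o, hw₂o, huo⟩ := hconv (scaleST N α β) β r x y w₁ w₂ q₁ q₂
    hΛα hαβ hr.le hrr₀ hw₁ hw₂ hq₁ hq₂ (hmx o o o hoW o hoW)
  have hfst : ∀ w : SpaceTime N, ‖w - o‖ ≤ δ → ‖w.fst - x₀‖ ≤ δ := fun w hw =>
    hof ▸ (norm_fst_le_norm_st (w - o)).trans hw
  have hsnd : ∀ w : SpaceTime N, ‖w - o‖ ≤ δ → |w.snd - t₀| ≤ δ := fun w hw =>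
    hos ▸ (abs_snd_le_norm_st (w - o)).trans hw
  have hIoo : ∀ w : SpaceTime N, ‖w - o‖ ≤ δ → w.snd ∈ Ioo 0 T := by
    intro w hw
    have h1 := abs_le.1 (hsnd w hw)
    exact ⟨by linarith [ht₀.1, h1.1], by linarith [ht₀.2, h1.2]⟩
  have hRw : ∀ w : SpaceTime N, ‖w - o‖ ≤ δ → ‖w.fst‖ ≤ R := by
    intro w hw
    have h1 := norm_add_le (w.fst - x₀) x₀
    rw [sub_add_cancel] at h1
    linarith [hfst w hw]
  have hWball : ∀ w : SpaceTime N, ‖w - o‖ ≤ δ → ∀ ζ, ‖ζ - w‖ < 1 → ζ.snd ∈ Icc 0 T → ζ ∈ W := by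
    intro w hw ζ hζ hζt
    rw [hWmem]
    refine ⟨?_, hζt⟩
    have h1 := norm_add_le (ζ.fst - w.fst) (w.fst - x₀)
    rw [sub_add_sub_cancel] at h1
    have h2 : ‖ζ.fst - w.fst‖ ≤ ‖ζ - w‖ := norm_fst_le_norm_st (ζ - w)
    linarith [hfst w hw]
  have hWjump : ∀ w : SpaceTime N, ‖w - o‖ ≤ δ → ∀ h, ‖h‖ ≤ B → w + st h 0 ∈ W := by
    intro w hw h hh
    rw [hWmem]
    have h0 : (w + st h 0).snd = w.snd := add_zero _
    refine ⟨?_, h0 ▸ Ioo_subset_Icc_self (hIoo w hw)⟩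
    have h1 : (w + st h 0).fst - x₀ = (w.fst - x₀) + h := by
      change w.fst + h - x₀ = _
      abel
    rw [h1]
    have h2 := norm_add_le (w.fst - x₀) h
    linarith [hfst w hw]
  have hslice : ∀ {u : Euc N → ℝ → ℝ},
      UpperSemicontinuousOn (fun p : Euc N × ℝ => u p.1 p.2) (univ ×ˢ Icc 0 T) →
      ∀ t ∈ Icc (0 : ℝ) T, UpperSemicontinuous fun x => u x t := by
    intro u hu t ht
    rw [← upperSemicontinuousOn_univ_iff]
    exact hu.comp (g := fun x : Euc N => (x, t)) (by fun_prop) fun x _ => ⟨mem_univ _, ht⟩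
  have hut : |u w₁.fst w₁.snd - u x₀ t₀| ≤ δ₁ := by
    have h1 := abs_le.1 (hfo w₁ (hw₁o.trans hδf))
    have h2 := abs_le.1 huo
    rw [hof, hos] at h1 h2
    rw [abs_le]
    constructor <;> linarith [h1.1, h1.2, h2.1, h2.2]
  have hmain := doubling_inequality h hc₁ hγ₁ hc₂ hγ₂ hu hv (hslice hus) (hslice hvs) hα.le hϑ.le
    (hWball w₁ hw₁o) (hWball w₂ hw₂o) (hWjump w₁ hw₁o) (hWjump w₂ hw₂o)
    (Ioo_subset_Icc_self (hIoo w₁ hw₁o)) (Ioo_subset_Icc_self (hIoo w₂ hw₂o)) hmx hj₁ hj₂ hQ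
    (hM w₁.fst w₁.snd) (hf₁ w₁.fst w₁.snd) (hf₂ w₁.fst w₁.snd)
    (hsub w₁.fst w₁.snd (hIoo w₁ hw₁o) (by linarith [hfst w₁ hw₁o])
      (by linarith [hsnd w₁ hw₁o]) hut)
    (hsup w₂.fst w₂.snd (hIoo w₂ hw₂o)) (e := δ₀ / 16) (by linarith)
  rw [inner_scaleST_self] at hxy
  have hsq : ∀ ζ : SpaceTime N, ‖ζ‖ ^ 2 = ‖ζ.fst‖ ^ 2 + ζ.snd ^ 2 := fun ζ =>
    norm_st_sq ζ.fst ζ.snd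
  rw [hsq] at hxw hyw
  have hβs : ∀ ζ : SpaceTime N, 0 ≤ β * ζ.snd ^ 2 := fun ζ => mul_nonneg hβ.le (sq_nonneg _)
  have hαf : ∀ ζ : SpaceTime N, 0 ≤ α * ‖ζ.fst‖ ^ 2 := fun ζ => mul_nonneg hα.le (sq_nonneg _)
  have hαβf : ∀ ζ : SpaceTime N, α * ‖ζ.fst‖ ^ 2 ≤ β * ‖ζ.fst‖ ^ 2 := fun ζ =>
    mul_le_mul_of_nonneg_right hαβ (sq_nonneg _)
  have hxyα : α * ‖x.fst - y.fst‖ ^ 2 ≤ δ := by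
    have h1 : α * ‖(x - y).fst‖ ^ 2 ≤ δ := by linarith [hβs (x - y)]
    exact h1
  have hwα : α * ‖w₁.fst - w₂.fst‖ ^ 2 ≤ 9 * δ := by
    have h1 := norm_scaled_sub_sq_le x.fst y.fst w₁.fst w₂.fst hα.le
    have h2 : α * ‖x.fst - w₁.fst‖ ^ 2 ≤ δ := by
      have h3 : α * ‖(x - w₁).fst‖ ^ 2 ≤ δ := by linarith [hβs (x - w₁), hαβf (x - w₁)]
      exact h3
    have h4 : α * ‖y.fst - w₂.fst‖ ^ 2 ≤ δ := by
      have h3 : α * ‖(y - w₂).fst‖ ^ 2 ≤ δ := by linarith [hβs (y - w₂), hαβf (y - w₂)]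
      exact h3
    linarith
  have hwρ : |w₁.snd - w₂.snd| < ρ := by
    have h1 := norm_scaled_sub_sq_le x.snd y.snd w₁.snd w₂.snd hβ.le
    simp only [Real.norm_eq_abs] at h1
    have h2 : β * |x.snd - w₁.snd| ^ 2 ≤ δ := by
      have h3 : β * (x - w₁).snd ^ 2 ≤ δ := by linarith [hαf (x - w₁), hαβf (x - w₁)]
      rw [sq_abs]
      exact h3
    have h4 : β * |y.snd - w₂.snd| ^ 2 ≤ δ := by
      have h3 : β * (y - w₂).snd ^ 2 ≤ δ := by linarith [hαf (y - w₂), hαβf (y - w₂)]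
      rw [sq_abs]
      exact h3
    have h5 : β * |x.snd - y.snd| ^ 2 ≤ δ := by
      have h3 : β * (x - y).snd ^ 2 ≤ δ := by linarith [hαf (x - y)]
      rw [sq_abs]
      exact h3
    have h6 : β * |w₁.snd - w₂.snd| ^ 2 < β * ρ ^ 2 := by linarith
    exact lt_of_pow_lt_pow_left₀ 2 hρ.le (lt_of_mul_lt_mul_left h6 hβ.le)
  have hω := hjump w₂.fst ((hfst w₂ hw₂o).trans hδ1) w₁.snd
    (Ioo_subset_Icc_self (hIoo w₁ hw₁o)) w₂.snd (Ioo_subset_Icc_self (hIoo w₂ hw₂o)) hwρ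
  have herr := h.doubling_error_le (x := x) (y := y) (o := o) (q₁ := q₁) (q₂ := q₂) hα.le hϑ.le
    (hRw w₁ hw₁o) (hRw w₂ hw₂o) (Ioo_subset_Icc_self (hIoo w₁ hw₁o))
    (Ioo_subset_Icc_self (hIoo w₂ hw₂o)) (hxo.trans hδ1) (hyo.trans hδ1) (hq₁.trans hrϑ)
    (hq₂.trans hrϑ) hω
  have hstrict := hf₃ w₁.fst w₁.snd (Ioo_subset_Icc_self (hIoo w₁ hw₁o))
  have hψ₁ := (abs_le.1 (hψo w₁ (hw₁o.trans hδψ))).2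
  have hψ₂ := (abs_le.1 (hψo w₂ (hw₂o.trans hδψ))).1
  rw [← hI, ← hn₁] at herr
  rw [← hC₁, ← hC₂, ← hC₃] at herr
  have hωα : 4 * (α * (δ₀ / (32 * α))) = δ₀ / 8 := by field_simp; norm_num
  have he₂ := mul_le_mul_of_nonneg_right hwα hC₂0
  have he₃ := mul_le_mul_of_nonneg_right hxyα hC₃0
  rw [← hI, ← hn₁] at hmain hstrict
  linarith

end LocalContradiction

section MaximumPoint

/-- Under the no-loop condition, switching is inactive for `p` at some index maximizing `p - q`
as soon as `q` dominates its switching obstacles. -/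
theorem exists_max_index_no_switching {d : ℕ} {c : Fin d → Fin d → ℝ} {p q : Fin d → ℝ}
    (hloop : ∀ (k : ℕ), ∀ idx : Fin (k + 2) → Fin d, Function.Injective idx →
      0 < ∑ m : Fin (k + 2), c (idx m) (idx (m + 1)))
    (hq : ∀ i, ∀ j ≠ i, -c i j + q j ≤ q i) {i₀ : Fin d}
    (hi₀ : ∀ j, p j - q j ≤ p i₀ - q i₀) :
    ∃ i, p i - q i = p i₀ - q i₀ ∧ ∀ j ≠ i, -c i j + p j < p i := by
  by_contra! hcon
  have hstep : ∀ i, ∃ j, p i - q i = p i₀ - q i₀ →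
      j ≠ i ∧ p j - q j = p i₀ - q i₀ ∧ c i j = p j - p i := by
    intro i
    by_cases hi : p i - q i = p i₀ - q i₀
    · obtain ⟨j, hji, hj⟩ := hcon i hi
      have h1 := hq i j hji
      have h2 := hi₀ j
      exact ⟨j, fun _ => ⟨hji, by linarith, by linarith⟩⟩
    · exact ⟨i, fun h => absurd h hi⟩
  choose F hF using hstep
  have horbit : ∀ {i}, p i - q i = p i₀ - q i₀ → ∀ n, p (F^[n] i) - q (F^[n] i) = p i₀ - q i₀ := by
    intro i hi n
    induction n with
    | zero => exact hi
    | succ n ih =>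
      rw [Function.iterate_succ_apply']
      exact (hF _ ih).2.1
  obtain ⟨m, n, hmn, hEq⟩ := Finite.exists_ne_map_eq_of_infinite fun n => F^[n] i₀
  obtain ⟨i, hi, hper⟩ : ∃ i, p i - q i = p i₀ - q i₀ ∧ i ∈ Function.periodicPts F := by
    wlog hlt : m < n generalizing m n
    · exact this n m hmn.symm hEq.symm (lt_of_le_of_ne (not_lt.1 hlt) hmn.symm)
    refine ⟨F^[m] i₀, horbit rfl m, Function.mk_mem_periodicPts (Nat.sub_pos_of_lt hlt) ?_⟩
    change F^[n - m] (F^[m] i₀) = F^[m] i₀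
    rw [← Function.iterate_add_apply, Nat.sub_add_cancel hlt.le]
    exact hEq.symm
  have hpos := Function.minimalPeriod_pos_of_mem_periodicPts hper
  have hne1 : Function.minimalPeriod F i ≠ 1 := fun h1 =>
    (hF i hi).1 (Function.minimalPeriod_eq_one_iff_isFixedPt.1 h1)
  obtain ⟨k, hk⟩ : ∃ k, Function.minimalPeriod F i = k + 2 :=
    ⟨Function.minimalPeriod F i - 2, by omega⟩
  have hinj : Function.Injective fun m : Fin (k + 2) => F^[m.val] i := by
    intro a b hab
    have hmem : ∀ a : Fin (k + 2), a.val ∈ Iio (Function.minimalPeriod F i) := fun a => by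
      rw [hk]
      exact a.isLt
    exact Fin.ext (Function.iterate_injOn_Iio_minimalPeriod (hmem a) (hmem b) hab)
  have hlt := hloop k _ hinj
  have hnext : ∀ m : Fin (k + 2), F^[(m + 1).val] i = F (F^[m.val] i) := by
    intro m
    have h1 := Function.iterate_mod_minimalPeriod_eq (f := F) (x := i) (n := m.val + 1)
    rw [hk] at h1
    rw [← Function.iterate_succ_apply' F, Fin.val_add, Fin.val_one]
    exact h1
  have hsum : ∑ m : Fin (k + 2), c (F^[m.val] i) (F^[(m + 1).val] i) = 0 := by
    have h1 : ∀ m : Fin (k + 2), c (F^[m.val] i) (F^[(m + 1).val] i) =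
        p (F^[(m + 1).val] i) - p (F^[m.val] i) := by
      intro m
      rw [hnext]
      exact (hF _ (horbit hi m.val)).2.2
    rw [Finset.sum_congr rfl fun m _ => h1 m, Finset.sum_sub_distrib, sub_eq_zero]
    exact Equiv.sum_comp (Equiv.addRight (1 : Fin (k + 2))) fun m => p (F^[m.val] i)
  exact hlt.ne' hsum

theorem exists_mul_pow_le_mul_pow_succ_add {C₀ θ : ℝ} (hC₀ : 0 ≤ C₀) (hθ : 0 < θ) (n : ℕ) :
    ∃ C > 0, ∀ X : ℝ, 1 ≤ X → C₀ * X ^ n ≤ θ * X ^ (n + 1) + C := by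
  refine ⟨C₀ * (C₀ / θ) ^ n + 1, by positivity, fun X hX => ?_⟩
  have hX0 : 0 ≤ X := by linarith
  rcases le_total X (C₀ / θ) with h | h
  · have h1 := mul_le_mul_of_nonneg_left (pow_le_pow_left₀ hX0 h n) hC₀
    have h2 : 0 ≤ θ * X ^ (n + 1) := by positivity
    linarith
  · rw [div_le_iff₀ hθ] at h
    have h1 := mul_le_mul_of_nonneg_right h (pow_nonneg hX0 n)
    have h2 : X * θ * X ^ n = θ * X ^ (n + 1) := by ring
    have h3 : 0 ≤ C₀ * (C₀ / θ) ^ n := by positivity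
    linarith

variable {N : ℕ} {T : ℝ}

theorem exists_isMax_of_coercive {Φ : Euc N → ℝ → ℝ} (hT : 0 ≤ T)
    (hΦ : UpperSemicontinuousOn (fun p : Euc N × ℝ => Φ p.1 p.2) (univ ×ˢ Icc 0 T)) {C₀ θ : ℝ}
    (hθ : 0 < θ) (n : ℕ) (hle : ∀ x, ∀ t ∈ Icc (0 : ℝ) T,
      Φ x t ≤ C₀ * (1 + ‖x‖ ^ 2) ^ n - θ * (1 + ‖x‖ ^ 2) ^ (n + 1)) :
    ∃ x₀, ∃ t₀ ∈ Icc (0 : ℝ) T, ∀ x, ∀ t ∈ Icc (0 : ℝ) T, Φ x t ≤ Φ x₀ t₀ := by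
  obtain ⟨R, hR⟩ : ∃ R, R = (|C₀| + |Φ 0 0|) / θ := ⟨_, rfl⟩
  have hR0 : 0 ≤ R := by rw [hR]; positivity
  have hRθ : θ * R = |C₀| + |Φ 0 0| := by rw [hR]; field_simp
  have hne : (Metric.closedBall (0 : Euc N) (R + 1) ×ˢ Icc 0 T).Nonempty :=
    ⟨(0, 0), Metric.mem_closedBall_self (by linarith), left_mem_Icc.2 hT⟩
  obtain ⟨p, hp, hmax⟩ := (hΦ.mono (prod_mono_left (subset_univ _))).exists_isMaxOn hne
    ((isCompact_closedBall (0 : Euc N) (R + 1)).prod isCompact_Icc)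
  refine ⟨p.1, p.2, hp.2, fun x t ht => ?_⟩
  by_cases hx : ‖x‖ ≤ R + 1
  · exact hmax (a := (x, t)) ⟨by rwa [mem_closedBall_zero_iff], ht⟩
  · have h0 : Φ 0 0 ≤ Φ p.1 p.2 :=
      hmax (a := ((0 : Euc N), (0 : ℝ))) ⟨Metric.mem_closedBall_self (by linarith),
        left_mem_Icc.2 hT⟩
    have h1 := hle x t ht
    have h2 : R ≤ 1 + ‖x‖ ^ 2 := by nlinarith
    have h3 : (1 : ℝ) ≤ (1 + ‖x‖ ^ 2) ^ n := one_le_pow₀ (by nlinarith [sq_nonneg ‖x‖])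
    have h4 : C₀ * (1 + ‖x‖ ^ 2) ^ n - θ * (1 + ‖x‖ ^ 2) ^ (n + 1)
        = (C₀ - θ * (1 + ‖x‖ ^ 2)) * (1 + ‖x‖ ^ 2) ^ n := by ring
    have h5 : C₀ - θ * (1 + ‖x‖ ^ 2) ≤ -|Φ 0 0| := by
      have h6 := mul_le_mul_of_nonneg_left h2 hθ.le
      linarith [le_abs_self C₀]
    have h7 := mul_le_mul_of_nonneg_right h5 (zero_le_one.trans h3)
    have h8 := mul_le_mul_of_nonneg_left h3 (abs_nonneg (Φ 0 0))
    linarith [neg_abs_le (Φ 0 0)]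

theorem exists_penalized_max {d : ℕ} {lam C₀ : ℝ} (hlam : 0 ≤ lam) (hC₀ : 0 ≤ C₀) (n : ℕ)
    {w : Fin d → Euc N → ℝ → ℝ}
    (hw : ∀ i, UpperSemicontinuousOn (fun p : Euc N × ℝ => w i p.1 p.2) (univ ×ˢ Icc 0 T))
    (hle : ∀ i x, ∀ t ∈ Icc (0 : ℝ) T, w i x t ≤ C₀ * (1 + ‖x‖ ^ 2) ^ n)
    (hwT : ∀ i x, w i x T ≤ 0) {i₁ : Fin d} {x₁ : Euc N} {t₁ : ℝ} (ht₁ : t₁ ∈ Ioc 0 T)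
    (hpos : 0 < w i₁ x₁ t₁) :
    ∃ θ C k, 0 < θ ∧ 0 < C ∧ 0 < k ∧ ∃ i₀ x₀, ∃ t₀ ∈ Ioo (0 : ℝ) T, ∀ i x, ∀ t ∈ Icc (0 : ℝ) T,
      w i x t - penalty T lam θ C k n x t ≤ w i₀ x₀ t₀ - penalty T lam θ C k n x₀ t₀ := by
  have hT : 0 < T := ht₁.1.trans_le ht₁.2
  obtain ⟨m, hm⟩ : ∃ m, m = w i₁ x₁ t₁ := ⟨_, rfl⟩
  rw [← hm] at hpos
  obtain ⟨E, hE⟩ : ∃ E, E = Real.exp (lam * (T - t₁)) * (1 + ‖x₁‖ ^ 2) ^ (n + 1) := ⟨_, rfl⟩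
  have hE0 : 0 < E := by rw [hE]; positivity
  obtain ⟨θ, hθ, hθm⟩ : ∃ θ > 0, θ * E = m / 3 :=
    ⟨m / 3 / E, by positivity, div_mul_cancel₀ _ hE0.ne'⟩
  obtain ⟨C, hC, hCX⟩ := exists_mul_pow_le_mul_pow_succ_add hC₀ hθ n
  obtain ⟨k, hk, hkm⟩ : ∃ k > 0, C * Real.exp (-(k * t₁)) ≤ m / 3 := by
    refine ⟨3 * C / m / t₁, div_pos (by positivity) ht₁.1, ?_⟩
    rw [div_mul_cancel₀ _ ht₁.1.ne', Real.exp_neg, ← div_eq_mul_inv,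
      div_le_iff₀ (Real.exp_pos _)]
    have h1 := Real.add_one_le_exp (3 * C / m)
    have h2 : m / 3 * (3 * C / m) = C := by field_simp
    have h3 := mul_le_mul_of_nonneg_left h1 (by positivity : 0 ≤ m / 3)
    linarith
  have hpen : ∀ (x : Euc N), ∀ t ∈ Icc (0 : ℝ) T,
      θ * (1 + ‖x‖ ^ 2) ^ (n + 1) + C * Real.exp (-(k * t)) ≤ penalty T lam θ C k n x t := by
    intro x t ht
    have h1 : 1 ≤ Real.exp (lam * (T - t)) :=
      Real.one_le_exp (mul_nonneg hlam (sub_nonneg.2 ht.2))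
    have h2 : 0 ≤ θ * (1 + ‖x‖ ^ 2) ^ (n + 1) := by positivity
    have h3 := mul_le_mul_of_nonneg_left h1 h2
    rw [penalty]
    linarith
  have hexp : ∀ t, 0 < C * Real.exp (-(k * t)) := fun t => by positivity
  have hmaxi : ∀ i, ∃ x₀, ∃ t₀ ∈ Icc (0 : ℝ) T, ∀ x, ∀ t ∈ Icc (0 : ℝ) T,
      w i x t - penalty T lam θ C k n x t ≤ w i x₀ t₀ - penalty T lam θ C k n x₀ t₀ := by
    intro i
    refine exists_isMax_of_coercive (Φ := fun x t => w i x t - penalty T lam θ C k n x t) hT.le ?_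
      (C₀ := C₀) hθ n fun x t ht => ?_
    · exact (hw i).add
        (continuous_penalty T lam θ C k n).neg.continuousOn.upperSemicontinuousOn
    · linarith [hpen x t ht, hle i x t ht, hexp t]
  choose X S hS hXS using hmaxi
  obtain ⟨i₀, hi₀⟩ : ∃ i₀, ∀ i, w i (X i) (S i) - penalty T lam θ C k n (X i) (S i) ≤
      w i₀ (X i₀) (S i₀) - penalty T lam θ C k n (X i₀) (S i₀) :=
    @Finite.exists_max _ _ _ ⟨i₁⟩ _ fun i => w i (X i) (S i) - penalty T lam θ C k n (X i) (S i)
  have hall : ∀ i x, ∀ t ∈ Icc (0 : ℝ) T, w i x t - penalty T lam θ C k n x t ≤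
      w i₀ (X i₀) (S i₀) - penalty T lam θ C k n (X i₀) (S i₀) := fun i x t ht =>
    (hXS i x t ht).trans (hi₀ i)
  have hval : 0 < w i₀ (X i₀) (S i₀) - penalty T lam θ C k n (X i₀) (S i₀) := by
    have h1 := hall i₁ x₁ t₁ (Ioc_subset_Icc_self ht₁)
    have h2 : penalty T lam θ C k n x₁ t₁ = θ * E + C * Real.exp (-(k * t₁)) := by
      rw [penalty, hE]
      ring
    linarith
  refine ⟨θ, C, k, hθ, hC, hk, i₀, X i₀, S i₀, ⟨?_, ?_⟩, hall⟩
  · refine lt_of_le_of_ne (hS i₀).1 fun h0 => ?_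
    have h1 := hpen (X i₀) (S i₀) (hS i₀)
    have h2 := hle i₀ (X i₀) (S i₀) (hS i₀)
    have h3 := hCX (1 + ‖X i₀‖ ^ 2) (by linarith [sq_nonneg ‖X i₀‖])
    rw [← h0, mul_zero, neg_zero, Real.exp_zero, mul_one] at h1
    rw [← h0] at h2 hval
    linarith
  · refine lt_of_le_of_ne (hS i₀).2 fun hT' => ?_
    have h1 := hpen (X i₀) (S i₀) (hS i₀)
    have h2 := hwT i₀ (X i₀)
    have h3 := hexp (S i₀)
    have h4 : 0 ≤ θ * (1 + ‖X i₀‖ ^ 2) ^ (n + 1) := by positivity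
    rw [hT'] at h1 h3 hval
    linarith

end MaximumPoint

section Obstacles

variable {N : ℕ} {T : ℝ}

theorem mul_one_add_norm_rpow_le {V : Type*} [SeminormedAddCommGroup V] (x : V) {c γ : ℝ}
    (hc : 0 ≤ c) (hγ : 0 ≤ γ) {n : ℕ} (hn : γ ≤ n) :
    c * (1 + ‖x‖ ^ γ) ≤ 2 * c * (1 + ‖x‖ ^ 2) ^ n := by
  have hX : (1 : ℝ) ≤ 1 + ‖x‖ ^ 2 := by linarith [sq_nonneg ‖x‖]
  have h1 : ‖x‖ ^ γ ≤ (1 + ‖x‖ ^ 2) ^ n := by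
    rw [← Real.rpow_natCast]
    exact (Real.rpow_le_rpow (norm_nonneg x) (by nlinarith [sq_nonneg (‖x‖ - 1)]) hγ).trans
      (Real.rpow_le_rpow_of_exponent_le hX hn)
  have h2 : (1 : ℝ) ≤ (1 + ‖x‖ ^ 2) ^ n := one_le_pow₀ hX
  have h3 := mul_le_mul_of_nonneg_left (add_le_add h2 h1) hc
  linarith

theorem exists_pos_forall_near {P : Euc N × ℝ → Prop} {s : Set (Euc N × ℝ)} {x₀ : Euc N} {t₀ : ℝ}
    (h : ∀ᶠ p in 𝓝[s] (x₀, t₀), P p) :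
    ∃ ρ > 0, ∀ x t, (x, t) ∈ s → ‖x - x₀‖ < ρ → |t - t₀| < ρ → P (x, t) := by
  rw [eventually_nhdsWithin_iff, Metric.eventually_nhds_iff] at h
  obtain ⟨ρ, hρ, h⟩ := h
  refine ⟨ρ, hρ, fun x t hs hx ht => h ?_ hs⟩
  rw [Prod.dist_eq, dist_eq_norm, Real.dist_eq]
  exact max_lt hx ht

/-- An obstacle inequality for a lower semicontinuous function `w` that holds wherever `w` can be
touched from below by a test function holds everywhere. -/
theorem obstacle_le_of_touching {w w' b : Euc N → ℝ → ℝ}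
    (hw : LowerSemicontinuousOn (fun p : Euc N × ℝ => w p.1 p.2) (univ ×ˢ Icc 0 T))
    {C₀ : ℝ} (hC₀ : 0 ≤ C₀) {n : ℕ}
    (hgrow : ∀ x, ∀ t ∈ Icc (0 : ℝ) T, |w x t| ≤ C₀ * (1 + ‖x‖ ^ 2) ^ n)
    (hw' : LowerSemicontinuousOn (fun p : Euc N × ℝ => w' p.1 p.2) (univ ×ˢ Icc 0 T))
    (hb : Continuous fun p : Euc N × ℝ => b p.1 p.2)
    (htouch : ∀ x, ∀ t ∈ Ioo (0 : ℝ) T, ∀ φ, IsC12 T φ → φ x t = w x t →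
      (∀ y, ∀ s ∈ Ico (0 : ℝ) T, φ y s - w y s ≤ φ x t - w x t) → -b x t + w' x t ≤ w x t)
    {x₀ : Euc N} {t₀ : ℝ} (ht₀ : t₀ ∈ Ioo (0 : ℝ) T) : -b x₀ t₀ + w' x₀ t₀ ≤ w x₀ t₀ := by
  by_contra! hlt
  have hcX : Continuous fun p : Euc N × ℝ => (1 + ‖p.1‖ ^ 2) ^ (n + 1) - b p.1 p.2 := by fun_prop
  have hG := hw'.add hcX.continuousOn.lowerSemicontinuousOn
  obtain ⟨ρ₁, hρ₁, hnear⟩ := exists_pos_forall_near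
    (hG (x₀, t₀) ⟨mem_univ _, Ioo_subset_Icc_self ht₀⟩ (w x₀ t₀ + (1 + ‖x₀‖ ^ 2) ^ (n + 1))
      (by dsimp only; linarith))
  obtain ⟨ρ, hρ, hρρ₁, hρt, hρT⟩ : ∃ ρ > 0, ρ ≤ ρ₁ ∧ ρ ≤ t₀ ∧ ρ ≤ T - t₀ :=
    ⟨min ρ₁ (min t₀ (T - t₀)), lt_min hρ₁ (lt_min ht₀.1 (sub_pos.2 ht₀.2)), min_le_left _ _,
      (min_le_right _ _).trans (min_le_left _ _), (min_le_right _ _).trans (min_le_right _ _)⟩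
  obtain ⟨C, hC, hCX⟩ := exists_mul_pow_le_mul_pow_succ_add hC₀ one_pos n
  obtain ⟨m, hm, hmρ⟩ : ∃ m > 0, w x₀ t₀ + (1 + ‖x₀‖ ^ 2) ^ (n + 1) + C < m * ρ ^ 2 := by
    refine ⟨(|w x₀ t₀ + (1 + ‖x₀‖ ^ 2) ^ (n + 1) + C| + 1) / ρ ^ 2, by positivity, ?_⟩
    rw [div_mul_cancel₀ _ (pow_pos hρ 2).ne']
    linarith [le_abs_self (w x₀ t₀ + (1 + ‖x₀‖ ^ 2) ^ (n + 1) + C)]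
  obtain ⟨E, hE⟩ : ∃ E : Euc N → ℝ → ℝ, E = fun x t =>
      (1 + ‖x‖ ^ 2) ^ (n + 1) + m * (‖x - x₀‖ ^ 2 + (t - t₀) ^ 2) := ⟨_, rfl⟩
  have hEc : Continuous fun p : Euc N × ℝ => E p.1 p.2 := by
    rw [hE]
    fun_prop
  have hsq : ∀ (x : Euc N) (t : ℝ), 0 ≤ m * (‖x - x₀‖ ^ 2 + (t - t₀) ^ 2) := fun x t => by
    positivity
  have husc : UpperSemicontinuousOn (fun p : Euc N × ℝ => -(w p.1 p.2 + E p.1 p.2))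
      (univ ×ˢ Icc 0 T) := by
    intro p hp y hy
    filter_upwards [(hw.add hEc.continuousOn.lowerSemicontinuousOn) p hp (-y)
      (by dsimp only; linarith)] with q hq
    linarith
  obtain ⟨x, t, ht, hmax⟩ := exists_isMax_of_coercive (Φ := fun x t => -(w x t + E x t))
    (ht₀.1.trans ht₀.2).le husc (C₀ := C₀) one_pos n fun x t ht => by
      have h1 := (abs_le.1 (hgrow x t ht)).1
      have h2 := hsq x t
      simp only [hE]
      linarith
  have hmin : w x t + (1 + ‖x‖ ^ 2) ^ (n + 1) + m * (‖x - x₀‖ ^ 2 + (t - t₀) ^ 2) ≤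
      w x₀ t₀ + (1 + ‖x₀‖ ^ 2) ^ (n + 1) := by
    have h1 := hmax x₀ t₀ (Ioo_subset_Icc_self ht₀)
    simp only [hE, sub_self, norm_zero] at h1
    linarith
  have hd : ‖x - x₀‖ ^ 2 + (t - t₀) ^ 2 < ρ ^ 2 := by
    have h1 := (abs_le.1 (hgrow x t ht)).1
    have h2 := hCX (1 + ‖x‖ ^ 2) (by linarith [sq_nonneg ‖x‖])
    exact lt_of_mul_lt_mul_left (by linarith : m * (‖x - x₀‖ ^ 2 + (t - t₀) ^ 2) < m * ρ ^ 2) hm.le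
  have hx : ‖x - x₀‖ < ρ := lt_of_pow_lt_pow_left₀ 2 hρ.le (by linarith [sq_nonneg (t - t₀)])
  have htρ : |t - t₀| < ρ := by
    refine lt_of_pow_lt_pow_left₀ 2 hρ.le ?_
    rw [sq_abs]
    linarith [sq_nonneg ‖x - x₀‖]
  have h1 := hnear x t ⟨mem_univ _, ht⟩ (hx.trans_le hρρ₁) (htρ.trans_le hρρ₁)
  have hIoo : t ∈ Ioo 0 T := by
    have h2 := abs_lt.1 htρ
    exact ⟨by linarith [h2.1], by linarith [h2.2]⟩
  have hC12 : IsC12 T fun y s => w x t + E x t - E y s := by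
    rw [hE]
    refine ⟨fun s _ => ?_, fun y s _ => ?_, ?_⟩
    · have h2 : ContDiff ℝ 2 fun y : Euc N => ‖y‖ ^ 2 := contDiff_norm_sq ℝ
      have h3 : ContDiff ℝ 2 fun y : Euc N => ‖y - x₀‖ ^ 2 :=
        (contDiff_id.sub contDiff_const).norm_sq ℝ
      fun_prop
    · fun_prop
    · fun_prop
  have h2 := htouch x t hIoo _ hC12 (by ring) fun y s hs => by
    have h3 := hmax y s (Ico_subset_Icc_self hs)
    linarith
  have h3 := hsq x t
  linarith

/-- If the obstacles `u' j - b j` lie strictly below `u` at a point, they lie strictly below nearby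
values of `u` at nearby points. -/
theorem exists_obstacle_inactive_near {ι : Type*} [Finite ι] {p : ι → Prop}
    {b u' : ι → Euc N → ℝ → ℝ}
    (hu' : ∀ j, UpperSemicontinuousOn (fun p : Euc N × ℝ => u' j p.1 p.2) (univ ×ˢ Icc 0 T))
    (hb : ∀ j, Continuous fun p : Euc N × ℝ => b j p.1 p.2) {x₀ : Euc N} {t₀ m : ℝ}
    (ht₀ : t₀ ∈ Icc (0 : ℝ) T) (hlt : ∀ j, p j → -b j x₀ t₀ + u' j x₀ t₀ < m) :
    ∃ δ > 0, ∀ j, p j → ∀ x, ∀ t ∈ Icc (0 : ℝ) T, ‖x - x₀‖ ≤ δ → |t - t₀| ≤ δ →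
      -b j x t + u' j x t < m - δ := by
  have hev : ∀ᶠ δ in 𝓝[>] (0 : ℝ), ∀ j, p j → ∀ x, ∀ t ∈ Icc (0 : ℝ) T, ‖x - x₀‖ ≤ δ →
      |t - t₀| ≤ δ → -b j x t + u' j x t < m - δ := by
    rw [eventually_all]
    intro j
    by_cases hj : p j
    · obtain ⟨ε, hε, hεm⟩ : ∃ ε > 0, -b j x₀ t₀ + u' j x₀ t₀ < m - ε :=
        ⟨(m - (-b j x₀ t₀ + u' j x₀ t₀)) / 2, by linarith [hlt j hj], by linarith [hlt j hj]⟩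
      have hG := (hb j).neg.continuousOn.upperSemicontinuousOn.add (hu' j)
      obtain ⟨ρ, hρ, h⟩ := exists_pos_forall_near (hG (x₀, t₀) ⟨mem_univ _, ht₀⟩ (m - ε) hεm)
      have hlt : ∀ᶠ δ in 𝓝[>] (0 : ℝ), δ < min ρ ε :=
        nhdsWithin_le_nhds (eventually_lt_nhds (lt_min hρ hε))
      filter_upwards [hlt] with δ hδ _ x t ht hx htt
      have h1 : -b j x t + u' j x t < m - ε := h x t ⟨mem_univ _, ht⟩
        (hx.trans_lt (hδ.trans_le (min_le_left _ _))) (htt.trans_lt (hδ.trans_le (min_le_left _ _)))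
      have h2 := hδ.trans_le (min_le_right ρ ε)
      linarith
    · exact Eventually.of_forall fun _ h => absurd h hj
  obtain ⟨δ, hδ, h⟩ := (hev.and self_mem_nhdsWithin).exists.imp fun _ h => And.symm h
  exact ⟨δ, hδ, h⟩

end Obstacles

theorem exists_common_growth {N d : ℕ} {T : ℝ} {u : Fin d → Euc N → ℝ → ℝ}
    (h : ∀ i, ∃ c γ : ℝ, 1 ≤ c ∧ 1 ≤ γ ∧ ∀ x, ∀ t ∈ Icc (0 : ℝ) T, |u i x t| ≤ c * (1 + ‖x‖ ^ γ)) :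
    ∃ c γ : ℝ, 0 ≤ c ∧ 0 ≤ γ ∧ ∀ i x, ∀ t ∈ Icc (0 : ℝ) T, |u i x t| ≤ c * (1 + ‖x‖ ^ γ) := by
  choose c γ hc hγ h using h
  have hc0 : ∀ i, 0 ≤ c i := fun i => zero_le_one.trans (hc i)
  obtain ⟨n, hn⟩ := exists_nat_ge (∑ i, γ i)
  refine ⟨∑ i, 2 * c i * 2 ^ n, 2 * n, Finset.sum_nonneg fun i _ => by have := hc0 i; positivity,
    by positivity, fun i x t ht => ?_⟩
  have hγi : γ i ≤ n := (Finset.single_le_sum (f := γ)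
    (fun j _ => zero_le_one.trans (hγ j)) (Finset.mem_univ i)).trans hn
  have h1 := (h i x t ht).trans
    (mul_one_add_norm_rpow_le x (hc0 i) (zero_le_one.trans (hγ i)) hγi)
  have h2 : (1 + ‖x‖ ^ 2) ^ n ≤ 2 ^ n * (1 + ‖x‖ ^ (2 * n : ℝ)) := by
    have h3 : (1 + ‖x‖ ^ 2) ^ n ≤ 2 ^ (n - 1) * (1 ^ n + (‖x‖ ^ 2) ^ n) :=
      add_pow_le zero_le_one (sq_nonneg _) n
    have h4 : ‖x‖ ^ (2 * n : ℝ) = (‖x‖ ^ 2) ^ n := by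
      rw [← pow_mul, ← Real.rpow_natCast]
      push_cast
      rfl
    rw [h4]
    rw [one_pow] at h3
    refine h3.trans ?_
    gcongr
    · norm_num
    · omega
  refine h1.trans ((mul_le_mul_of_nonneg_left h2 (by have := hc0 i; positivity)).trans ?_)
  rw [← mul_assoc]
  refine mul_le_mul_of_nonneg_right ?_ (by positivity)
  exact Finset.single_le_sum (f := fun i => 2 * c i * 2 ^ n)
    (fun j _ => by have := hc0 j; positivity) (Finset.mem_univ i)

noncomputable section
/-- Theorem 1.1 (comparison principle): a viscosity subsolution lies below a viscosity
supersolution on `ℝ^N × (0,T]`. -/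
theorem comparison_principle
    {N l d : ℕ} (T : ℝ)
    (σ : Euc N → ℝ → Matrix (Fin N) (Fin N) ℝ) (a : Euc N → ℝ → Fin N → ℝ)
    (ν : Measure (Euc l)) (η : Euc N → ℝ → Euc l → Euc N)
    (ψ : Fin d → Euc N → ℝ → ℝ) (c : Fin d → Fin d → Euc N → ℝ → ℝ)
    (g : Fin d → Euc N → ℝ)
    (hop : OperatorAssumptions N l T σ a ν η)
    (hdata : DataAssumptions N d T ψ c g)
    (up um : Fin d → Euc N → ℝ → ℝ)
    (hsuper : IsSupersol T σ a ν η ψ c g up)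
    (hsub : IsSubsol T σ a ν η ψ c g um) :
    ∀ (i : Fin d) (x : Euc N), ∀ t ∈ Ioc (0:ℝ) T, um i x t ≤ up i x t := by
  by_contra! hcon
  obtain ⟨i₁, x₁, t₁, ht₁, hpos⟩ := hcon
  obtain ⟨B, K, hbd⟩ := hop.exists_bounds
  obtain ⟨hpL, hpT, hpV⟩ := hsuper
  obtain ⟨hmU, hmT, hmV⟩ := hsub
  obtain ⟨c₁, γ₁, hc₁, hγ₁, hup⟩ := exists_common_growth fun i => (hpL i).2
  obtain ⟨c₂, γ₂, hc₂, hγ₂, hum⟩ := exists_common_growth fun i => (hmU i).2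
  obtain ⟨n, hn⟩ := exists_nat_ge (max γ₁ γ₂)
  have hup' : ∀ i x, ∀ t ∈ Icc 0 T, |up i x t| ≤ 2 * c₁ * (1 + ‖x‖ ^ 2) ^ n := fun i x t ht =>
    (hup i x t ht).trans (mul_one_add_norm_rpow_le x hc₁ hγ₁ ((le_max_left _ _).trans hn))
  have hum' : ∀ i x, ∀ t ∈ Icc 0 T, |um i x t| ≤ 2 * c₂ * (1 + ‖x‖ ^ 2) ^ n := fun i x t ht =>
    (hum i x t ht).trans (mul_one_add_norm_rpow_le x hc₂ hγ₂ ((le_max_right _ _).trans hn))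
  have hnegU : ∀ i, UpperSemicontinuousOn (fun p : Euc N × ℝ => -up i p.1 p.2)
      (univ ×ˢ Icc 0 T) := by
    intro i p hp y hy
    filter_upwards [(hpL i).1 p hp (-y) (by dsimp only; linarith)] with q hq
    linarith
  obtain ⟨lam, hlam, hpen⟩ := exists_penalty_strict_supersolution (T := T) (K₁ := K) (K₂ := K)
    (b₀ := ∫ z, (min ‖z‖ 1) ^ 2 ∂ν) (ν₁ := ν.real {z | 1 < ‖z‖}) n hbd.B_pos
    (integral_nonneg fun z => by positivity) measureReal_nonneg hbd.K_nonneg hbd.K_nonneg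
    hbd.diffusion_le (a := a) fun x t ht v => by
      refine (sum_mul_eq_inner (driftVector a x t) v).trans_le ?_
      rw [real_inner_comm]
      exact (real_inner_le_norm _ _).trans
        (mul_le_mul_of_nonneg_right (hbd.drift_le x t ht) (norm_nonneg v))
  obtain ⟨θ, C, k, hθ, hC, hk, i₀, x₀, t₀, ht₀, hmax⟩ := exists_penalized_max (T := T)
    (C₀ := 2 * c₁ + 2 * c₂) (w := fun i x t => um i x t + -up i x t) hlam (by positivity) n
    (fun i => (hmU i).1.add (hnegU i))
    (fun i x t ht => by
      have h1 := (abs_le.1 (hup' i x t ht)).1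
      have h2 := (abs_le.1 (hum' i x t ht)).2
      linarith)
    (fun i x => by linarith [hmT i x, hpT i x]) ht₁ (by linarith)
  have ht₀' := Ioo_subset_Icc_self ht₀
  obtain ⟨i, hi, hobs⟩ := exists_max_index_no_switching (c := fun i j => c i j x₀ t₀)
    (p := fun i => um i x₀ t₀) (q := fun i => up i x₀ t₀) (i₀ := i₀)
    (fun m idx hidx => hdata.no_loop m idx hidx x₀ t₀ ht₀')
    (fun i j hj => obstacle_le_of_touching (hpL i).1 (by positivity) (hup' i) (hpL j).1
      (hdata.cont_c i j) (fun x t ht φ hφ hφx hφm =>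
        (hpV i x t ht φ hφ hφx hφm (1 / 2) (by norm_num)).2 j hj) ht₀)
    (fun j => by linarith [hmax j x₀ t₀ ht₀'])
  obtain ⟨δ, hδ, hfar⟩ := exists_obstacle_inactive_near (p := fun j => j ≠ i)
    (fun j => (hmU j).1) (fun j => hdata.cont_c i j) ht₀' hobs
  obtain ⟨Df, ft, M, hM, hf₁, hf₂, hf₃⟩ := hpen θ C k hθ hC hk
  refine hbd.not_isMax_of_strict (ψ := ψ i) (v := fun x t => -up i x t) hc₂ hγ₂ hc₁ hγ₁ (hum i)
    (fun x t ht => (abs_neg (up i x t)).trans_le (hup i x t ht)) (hmU i).1 (hnegU i)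
    (continuous_penalty T lam θ C k n) (hdata.cont_psi i) ht₀
    (fun x t ht => by linarith [hmax i x t ht]) hM hf₁ hf₂
    (by positivity : 0 < k * C * Real.exp (-(k * T))) (fun x t ht => ?_) hδ ?_ ?_
  · rw [real_inner_comm, ← sum_mul_eq_inner]
    exact hf₃ x t ht
  · intro x t ht hx htt hut φ hφ hφx hφm κ hκ
    rcases hmV i x t ht φ hφ hφx hφm κ hκ with h | ⟨j, hj, h⟩
    · linarith
    · have h1 := hfar j hj x t (Ioo_subset_Icc_self ht) hx htt
      linarith [(abs_le.1 hut).1]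
  · intro x t ht φ hφ hφx hφm κ hκ
    have h1 := (hpV i x t ht (fun x t => -φ x t) hφ.neg (by linarith)
      (fun y s hs => by linarith [hφm y s hs]) κ hκ).1
    have h2 := Hkop_neg σ a ν η κ (fun x t => -φ x t) (up i) x t
    simp only [neg_neg] at h2
    rw [h2]
    linarith

end
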